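/- Let G be a finite group of odd order and let p be an odd prime. If the average of the degrees of the irreducible complex characters of G whose values all lie in the cyclotomic field Q_p = Q(ζ_p) (where ζ_p is a primitive pth root of unity) is strictly less than 2, then G has a normal p-complement. -/

import Mathlib

open scoped BigOperators

/-- The set of irreducible complex characters of `G`, viewed as functions `G → ℂ`. -/
def Irr (G : Type) [Monoid G] : Set (G → ℂ) :=
  {f | ∃ V : FDRep ℂ G, CategoryTheory.Simple V ∧ f = V.character}

/-- The degree of a character, i.e. its value at the identity (a natural number). -/
noncomputable def charDeg {G : Type} [One G] (f : G → ℂ) : ℕ := ⌊(f 1).re⌋₊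

/-- The average of the degrees of the characters in a set `S` of characters. -/
noncomputable def acd {G : Type} [One G] (S : Set (G → ℂ)) : ℝ :=
  (∑ᶠ f ∈ S, (f 1).re) / (S.ncard : ℝ)

/-- `G` has a normal `p`-complement: a normal subgroup of order coprime to `p`
whose index is a power of `p`. -/
def HasNormalPComplement (p : ℕ) (G : Type) [Group G] : Prop :=
  ∃ N : Subgroup G, N.Normal ∧ Nat.Coprime (Nat.card N) p ∧ ∃ n : ℕ, N.index = p ^ n

open Subgroup in
/-- `S` is a Sylow `p`-subgroup of the subgroup `X`. -/
def IsSyl {G : Type*} [Group G] (p : ℕ) (S X : Subgroup G) : Prop :=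
  S ≤ X ∧ IsPGroup p S ∧ ∀ Q : Subgroup G, IsPGroup p Q → Q ≤ X → S ≤ Q → Q ≤ S

section relsyl

variable {G : Type*} [Group G] {p : ℕ}

theorem Sylow.isSyl (P : Sylow p G) : IsSyl p (P : Subgroup G) ⊤ :=
  ⟨le_top, P.2, fun _ hQ _ h => (P.3 hQ h).le⟩

theorem IsSyl.exists_sylow_top {S : Subgroup G} (h : IsSyl p S ⊤) :
    ∃ P : Sylow p G, (P : Subgroup G) = S :=
  ⟨⟨S, h.2.1, fun hQ hS => le_antisymm (h.2.2 _ hQ le_top hS) hS⟩, rfl⟩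

theorem IsSyl.exists_sylow {S X : Subgroup G} (h : IsSyl p S X) :
    ∃ P : Sylow p X, (P : Subgroup X) = S.subgroupOf X := by
  refine ⟨⟨S.subgroupOf X, h.2.1.comap_subtype, ?_⟩, rfl⟩
  intro Q hQ hS
  apply le_antisymm _ hS
  have h1 := h.2.2 (Q.map X.subtype) (hQ.map _) (Subgroup.map_subtype_le Q) ?_
  · intro q hq
    exact h1 ⟨q, hq, rfl⟩
  · intro s hs
    exact ⟨⟨s, h.1 hs⟩, hS hs, rfl⟩

theorem Sylow.isSyl_map {X : Subgroup G} (P : Sylow p X) :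
    IsSyl p ((P : Subgroup X).map X.subtype) X := by
  refine ⟨Subgroup.map_subtype_le _, P.2.map _, fun Q hQ hQX hPQ => ?_⟩
  have h1 := P.3 (Q := Q.subgroupOf X) hQ.comap_subtype (by
    intro s hs
    exact hPQ ⟨s, hs, rfl⟩)
  intro q hq
  exact ⟨⟨q, hQX hq⟩, h1 ▸ hq, rfl⟩

theorem IsSyl.mono {S X Y : Subgroup G} (h : IsSyl p S X) (hY : Y ≤ X) (hS : S ≤ Y) :
    IsSyl p S Y :=
  ⟨hS, h.2.1, fun Q hQ hQY hSQ => h.2.2 Q hQ (hQY.trans hY) hSQ⟩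

theorem IsPGroup.exists_isSyl {Q X : Subgroup G} (hQ : IsPGroup p Q) (hX : Q ≤ X) :
    ∃ S, IsSyl p S X ∧ Q ≤ S := by
  have h1 : IsPGroup p (Q.subgroupOf X) := hQ.comap_subtype
  obtain ⟨P, hP⟩ := h1.exists_le_sylow
  refine ⟨_, P.isSyl_map, fun q hq => ⟨⟨q, hX hq⟩, hP hq, rfl⟩⟩

theorem exists_isSyl (p : ℕ) (X : Subgroup G) : ∃ S, IsSyl p S X := by
  obtain ⟨S, hS, _⟩ := (IsPGroup.of_bot (p := p) (G := G)).exists_isSyl (bot_le : ⊥ ≤ X)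
  exact ⟨S, hS⟩

variable [Finite G] [Fact p.Prime]

theorem IsSyl.conj_le {S X Q : Subgroup G} (h : IsSyl p S X) (hQ : IsPGroup p Q) (hX : Q ≤ X) :
    ∃ x ∈ X, ∀ q ∈ Q, x * q * x⁻¹ ∈ S := by
  obtain ⟨P, hP⟩ := h.exists_sylow
  have h1 : IsPGroup p (Q.subgroupOf X) := hQ.comap_subtype
  obtain ⟨R, hR⟩ := h1.exists_le_sylow
  obtain ⟨x, hx⟩ := MulAction.exists_smul_eq X R P
  refine ⟨x, x.2, fun q hq => ?_⟩
  have h2 : (⟨q, hX hq⟩ : X) ∈ R := hR hq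
  have h3 : x * ⟨q, hX hq⟩ * x⁻¹ ∈ (x • R : Sylow p X) := by
    have := Subgroup.smul_mem_pointwise_smul _ (MulAut.conj x) (R : Subgroup X) h2
    exact this
  rw [hx] at h3
  have h4 : x * ⟨q, hX hq⟩ * x⁻¹ ∈ (P : Subgroup X) := h3
  rw [hP] at h4
  exact h4

theorem IsSyl.card_eq {S S' X : Subgroup G} (h : IsSyl p S X) (h' : IsSyl p S' X) :
    Nat.card S = Nat.card S' := by
  obtain ⟨P, hP⟩ := h.exists_sylow
  obtain ⟨P', hP'⟩ := h'.exists_sylow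
  have := P.card_eq_multiplicity
  have := P'.card_eq_multiplicity
  rw [← Nat.card_congr (Subgroup.subgroupOfEquivOfLe h.1).toEquiv,
    ← Nat.card_congr (Subgroup.subgroupOfEquivOfLe h'.1).toEquiv, ← hP, ← hP']
  simp_all

theorem IsSyl.conj_eq {S S' X : Subgroup G} (h : IsSyl p S X) (h' : IsSyl p S' X) :
    ∃ x ∈ X, ∀ q, q ∈ S' ↔ x * q * x⁻¹ ∈ S := by
  obtain ⟨x, hx, h1⟩ := h.conj_le h'.2.1 h'.1
  refine ⟨x, hx, ?_⟩
  have h2 : S'.map (MulAut.conj x).toMonoidHom = S := by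
    apply Subgroup.eq_of_le_of_card_ge
    · rintro _ ⟨q, hq, rfl⟩
      exact h1 q hq
    · rw [h.card_eq h']
      exact (Nat.card_congr (S'.equivMapOfInjective _ (MulAut.conj x).injective).toEquiv).le
  intro q
  constructor
  · exact h1 q
  · intro hq
    rw [← h2] at hq
    obtain ⟨q', hq', h3⟩ := hq
    have : q' = q := (MulAut.conj x).injective h3
    exact this ▸ hq'

theorem IsSyl.conj {S X : Subgroup G} (h : IsSyl p S X) {x : G} (hx : x ∈ X) :
    IsSyl p (S.map (MulAut.conj x).toMonoidHom) X := by
  refine ⟨?_, h.2.1.map _, ?_⟩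
  · rintro _ ⟨q, hq, rfl⟩
    exact X.mul_mem (X.mul_mem hx (h.1 hq)) (X.inv_mem hx)
  · intro Q hQ hQX hSQ
    obtain ⟨R, hR, hQR⟩ := hQ.exists_isSyl hQX
    have h2 := hSQ.trans hQR
    have h3 : S.map (MulAut.conj x).toMonoidHom = R := by
      apply Subgroup.eq_of_le_of_card_ge h2
      rw [hR.card_eq h]
      exact (Nat.card_congr (S.equivMapOfInjective _ (MulAut.conj x).injective).toEquiv).le
    rw [h3]; exact hQR

/-- relative Frattini argument -/
theorem IsSyl.frattini {S N : Subgroup G} (h : IsSyl p S N) {g : G}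
    (hg : g ∈ Subgroup.normalizer (N : Set G)) :
    ∃ n ∈ N, n * g ∈ Subgroup.normalizer (S : Set G) := by
  have h1 : IsPGroup p (S.map (MulAut.conj g).toMonoidHom) := h.2.1.map _
  obtain ⟨n, hn, h2⟩ := h.conj_le h1 (by
    rintro _ ⟨q, hq, rfl⟩
    exact (Subgroup.mem_normalizer_iff.1 hg q).1 (h.1 hq))
  refine ⟨n, hn, ?_⟩
  have h3 : S.map (MulAut.conj (n * g)).toMonoidHom = S := by
    apply Subgroup.eq_of_le_of_card_ge
    · rintro _ ⟨q, hq, rfl⟩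
      have := h2 (g * q * g⁻¹) ⟨q, hq, rfl⟩
      simpa [mul_assoc] using this
    · exact (Nat.card_congr (S.equivMapOfInjective _ (MulAut.conj (n * g)).injective).toEquiv).le
  rw [Subgroup.mem_normalizer_iff]
  intro q
  constructor
  · intro hq
    rw [← h3]; exact ⟨q, hq, rfl⟩
  · intro hq
    rw [← h3] at hq
    obtain ⟨q', hq', h3⟩ := hq
    have : q' = q := (MulAut.conj (n * g)).injective h3
    exact this ▸ hq'

theorem mem_normalizer_of_conj {S : Subgroup G} {g : G} (h : ∀ s ∈ S, g * s * g⁻¹ ∈ S) :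
    g ∈ Subgroup.normalizer (S : Set G) := by
  have h3 : S.map (MulAut.conj g).toMonoidHom = S := by
    apply Subgroup.eq_of_le_of_card_ge
    · rintro _ ⟨q, hq, rfl⟩
      exact h q hq
    · exact (Nat.card_congr (S.equivMapOfInjective _ (MulAut.conj g).injective).toEquiv).le
  rw [Subgroup.mem_normalizer_iff]
  intro q
  refine ⟨h q, fun hq => ?_⟩
  rw [← h3] at hq
  obtain ⟨q', hq', h3⟩ := hq
  have : q' = q := (MulAut.conj g).injective h3
  exact this ▸ hq'

theorem IsSyl.inf_normal {S X N : Subgroup G} (h : IsSyl p S X) (hN : N ≤ X)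
    (hX : X ≤ Subgroup.normalizer (N : Set G)) : IsSyl p (S ⊓ N) N := by
  refine ⟨inf_le_right, h.2.1.to_inf_left, fun Q hQ hQN hSQ => ?_⟩
  obtain ⟨R, hR, hQR⟩ := hQ.exists_isSyl hQN
  obtain ⟨x, hx, h1⟩ := h.conj_le hR.2.1 (hR.1.trans hN)
  have hc : Nat.card R ≤ Nat.card ↥(S ⊓ N) := by
    rw [Nat.card_congr (R.equivMapOfInjective (MulAut.conj x).toMonoidHom
      (MulAut.conj x).injective).toEquiv]
    apply Subgroup.card_le_of_le
    rintro _ ⟨q, hq, rfl⟩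
    exact ⟨h1 q hq, (Subgroup.mem_normalizer_iff.1 (hX hx) q).1 (hR.1 hq)⟩
  have h3 := Subgroup.eq_of_le_of_card_ge (hSQ.trans hQR) hc
  rw [h3]; exact hQR

/-- normalizers grow in `p`-groups -/
theorem exists_mem_normalizer_of_lt {E P : Subgroup G} (hP : IsPGroup p P) (h : E < P) :
    E < P ⊓ Subgroup.normalizer (E : Set G) := by
  have : Group.IsNilpotent P := hP.isNilpotent
  have h1 := Group.normalizerCondition_of_isNilpotent (G := P) (E.subgroupOf P)
    (by
      rw [lt_top_iff_ne_top]
      intro h2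
      rw [Subgroup.subgroupOf_eq_top] at h2
      exact h.not_ge h2)
  obtain ⟨x, hx, hx'⟩ := SetLike.exists_of_lt h1
  refine lt_of_le_of_ne (le_inf h.le Subgroup.le_normalizer) ?_
  intro h3
  apply hx'
  have : (x : G) ∈ P ⊓ Subgroup.normalizer (E : Set G) := by
    refine ⟨x.2, mem_normalizer_of_conj fun s hs => ?_⟩
    exact (Subgroup.mem_normalizer_iff.1 hx ⟨s, h.le hs⟩).1 hs
  rw [← h3] at this
  exact this

end relsyl

theorem pow_card_of_mem {G : Type*} [Group G] {H : Subgroup G} {x : G} (h : x ∈ H) :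
    x ^ Nat.card H = 1 :=
  orderOf_dvd_iff_pow_eq_one.1 (H.orderOf_dvd_natCard h)

section baer

variable {G : Type*} [Group G] [Finite G] {p : ℕ} [Fact p.Prime]

theorem baer_aux (C : Set G) (hC : ∀ c ∈ C, ∀ g, g * c * g⁻¹ ∈ C) (P : Subgroup G)
    (hP : IsPGroup p P) (D : Set G) (hD : D ⊆ C) (hDP : ∃ E ≤ P, C ∩ E = D)
    (hne : C ∩ P ≠ D) : ∃ x ∈ C ∩ P, x ∉ D ∧ ∀ d ∈ D, x * d * x⁻¹ ∈ D := by
  obtain ⟨E, hE⟩ := (Set.toFinite {E : Subgroup G | E ≤ P ∧ C ∩ E = D}).exists_maximal hDP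
  have hEP : E < P := lt_of_le_of_ne hE.1.1 (by rintro rfl; exact hne hE.1.2)
  have hN := exists_mem_normalizer_of_lt hP hEP
  have h1 : C ∩ ((P ⊓ Subgroup.normalizer (E : Set G) : Subgroup G) : Set G) ≠ D := by
    intro h2
    exact hN.not_ge (hE.2 ⟨inf_le_left, h2⟩ hN.le)
  have h3 : D ⊆ C ∩ ((P ⊓ Subgroup.normalizer (E : Set G) : Subgroup G) : Set G) := by
    intro d hd
    refine ⟨hD hd, hN.le ?_⟩
    rw [← hE.1.2] at hd; exact hd.2
  obtain ⟨x, hx, hx'⟩ := Set.exists_of_ssubset (lt_of_le_of_ne h3 h1.symm)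
  refine ⟨x, ⟨hx.1, hx.2.1⟩, hx', fun d hd => ?_⟩
  rw [← hE.1.2] at hd ⊢
  exact ⟨hC _ hd.1 _, (Subgroup.mem_normalizer_iff.1 hx.2.2 d).1 hd.2⟩

theorem baer_suzuki (x : G) (h : ∀ g : G, IsPGroup p (Subgroup.closure {x, g * x * g⁻¹})) :
    ∃ N : Subgroup G, N.Normal ∧ IsPGroup p N ∧ x ∈ N := by
  set C : Set G := {y | ∃ g, g * x * g⁻¹ = y} with hCdef
  have hC : ∀ c ∈ C, ∀ g, g * c * g⁻¹ ∈ C := by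
    rintro _ ⟨k, rfl⟩ g
    exact ⟨g * k, by group⟩
  have hxC : x ∈ C := ⟨1, by simp⟩
  have hpair : ∀ a ∈ C, ∀ b ∈ C, IsPGroup p (Subgroup.closure {a, b}) := by
    rintro _ ⟨k, rfl⟩ _ ⟨l, rfl⟩
    have h1 := (h (k⁻¹ * l)).map (MulAut.conj k).toMonoidHom
    rw [MonoidHom.map_closure, Set.image_pair] at h1
    have e1 : (MulAut.conj k).toMonoidHom x = k * x * k⁻¹ := rfl
    have e2 : (MulAut.conj k).toMonoidHom (k⁻¹ * l * x * (k⁻¹ * l)⁻¹) = l * x * l⁻¹ := by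
      change k * _ * k⁻¹ = _
      group
    rwa [e1, e2] at h1
  have hconj : ∀ (P Q : Sylow p G) , (C ∩ (P : Set G)).ncard ≤ (C ∩ (Q : Set G)).ncard := by
    intro P Q
    obtain ⟨y, -, hy⟩ := Q.isSyl.conj_le P.2 le_top
    apply Set.ncard_le_ncard_of_injOn (MulAut.conj y)
    · rintro a ⟨ha, ha'⟩
      exact ⟨hC _ ha _, hy a ha'⟩
    · exact (MulAut.conj y).injective.injOn
  by_cases hall : ∀ P Q : Sylow p G, C ∩ (P : Set G) = C ∩ (Q : Set G)
  · have hpx : IsPGroup p (Subgroup.zpowers x) := by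
      have := h 1
      rw [show (1 : G) * x * 1⁻¹ = x by simp, Set.pair_eq_singleton] at this
      rwa [Subgroup.zpowers_eq_closure]
    obtain ⟨P, hP⟩ := hpx.exists_le_sylow
    have hxP : x ∈ (P : Subgroup G) := hP (Subgroup.mem_zpowers x)
    refine ⟨Subgroup.normalClosure {x}, inferInstance, P.2.to_le ?_,
      Subgroup.subset_normalClosure rfl⟩
    unfold Subgroup.normalClosure
    rw [Subgroup.closure_le]
    intro y hy
    rw [Group.mem_conjugatesOfSet_iff] at hy
    obtain ⟨a, ha, hy⟩ := hy
    rw [Set.mem_singleton_iff] at ha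
    subst ha
    rw [isConj_iff] at hy
    obtain ⟨g, hg⟩ := hy
    have h1 : y ∈ C ∩ ((g • P : Sylow p G) : Set G) := by
      refine ⟨⟨g, hg⟩, ?_⟩
      rw [← hg]
      exact Subgroup.smul_mem_pointwise_smul _ (MulAut.conj g) (P : Subgroup G) hxP
    rw [hall (g • P) P] at h1
    exact h1.2
  · exfalso
    push Not at hall
    obtain ⟨P₀, Q₀, h₀⟩ := hall
    obtain ⟨⟨P, Q⟩, hPQ, hmax⟩ := (Set.toFinite {t : Sylow p G × Sylow p G |
      C ∩ (t.1 : Set G) ≠ C ∩ (t.2 : Set G)}).exists_maximalFor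
      (fun t => (C ∩ (t.1 : Set G) ∩ (t.2 : Set G)).ncard) _ ⟨(P₀, Q₀), h₀⟩
    simp only [Set.mem_ofPred_eq] at hPQ hmax
    set D := C ∩ (P : Set G) ∩ (Q : Set G) with hD
    have hDC : D ⊆ C := fun d hd => hd.1.1
    have hcl : ∃ E : Subgroup G, E ≤ P ∧ E ≤ Q ∧ C ∩ E = D := by
      refine ⟨P ⊓ Q, inf_le_left, inf_le_right, ?_⟩
      ext y; simp [hD, and_assoc]
    obtain ⟨E, hEP, hEQ, hED⟩ := hcl
    have hPD : C ∩ ((P : Subgroup G) : Set G) ≠ D := by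
      intro h1
      apply hPQ
      have h2 : C ∩ (P : Set G) ⊆ C ∩ (Q : Set G) := by
        intro y hy
        have : y ∈ D := by rw [← h1]; exact hy
        exact ⟨hy.1, this.2⟩
      exact Set.eq_of_subset_of_ncard_le h2 (hconj Q P)
    have hQD : C ∩ ((Q : Subgroup G) : Set G) ≠ D := by
      intro h1
      apply hPQ
      have h2 : C ∩ (Q : Set G) ⊆ C ∩ (P : Set G) := by
        intro y hy
        have : y ∈ D := by rw [← h1]; exact hy
        exact this.1
      exact (Set.eq_of_subset_of_ncard_le h2 (hconj P Q)).symm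
    obtain ⟨a, ha, haD, haN⟩ := baer_aux C hC P P.2 D hDC ⟨E, hEP, hED⟩ hPD
    obtain ⟨b, hb, hbD, hbN⟩ := baer_aux C hC Q Q.2 D hDC ⟨E, hEQ, hED⟩ hQD
    have hDp : IsPGroup p (Subgroup.closure D) := P.2.to_le (by
      rw [Subgroup.closure_le]; exact fun d hd => hd.1.2)
    have hN : ∀ c : G, (∀ d ∈ D, c * d * c⁻¹ ∈ D) →
        c ∈ Subgroup.normalizer (Subgroup.closure D : Set G) := by
      intro c hc
      apply mem_normalizer_of_conj
      intro s hs
      have : Subgroup.closure D ≤ (Subgroup.closure D).comap (MulAut.conj c).toMonoidHom := by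
        rw [Subgroup.closure_le]
        intro d hd
        exact Subgroup.subset_closure (hc d hd)
      exact this hs
    have hp3 := (hpair a ha.1 b hb.1).to_sup_of_normal_right' hDp (by
      rw [Subgroup.closure_le]
      rintro c (rfl | rfl)
      · exact hN _ haN
      · exact hN _ hbN)
    obtain ⟨R, hR⟩ := hp3.exists_le_sylow
    have haR : a ∈ R := hR (Subgroup.mem_sup_left (Subgroup.subset_closure (by simp)))
    have hbR : b ∈ R := hR (Subgroup.mem_sup_left (Subgroup.subset_closure (by simp)))
    have hDR : ∀ d ∈ D, d ∈ R := fun d hd =>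
      hR (Subgroup.mem_sup_right (Subgroup.subset_closure hd))
    have hfin : ∀ (T : Sylow p G) (t : G), t ∈ C ∩ (T : Set G) → t ∉ D → t ∈ R →
        (∀ d ∈ D, d ∈ T) → C ∩ (T : Set G) = C ∩ (R : Set G) := by
      intro T t ht htD htR hDT
      by_contra hne
      have h1 : D.ncard < (C ∩ (T : Set G) ∩ (R : Set G)).ncard := by
        apply Set.ncard_lt_ncard _ (Set.toFinite _)
        refine ⟨fun d hd => ⟨⟨hDC hd, hDT d hd⟩, hDR d hd⟩, fun hsub => htD (hsub ⟨ht, htR⟩)⟩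
      exact absurd (hmax (j := (T, R)) hne h1.le) (not_le.2 h1)
    have e1 := hfin P a ha haD haR (fun d hd => hd.1.2)
    have e2 := hfin Q b hb hbD hbR (fun d hd => hd.2)
    exact hPQ (e1.trans e2.symm)

end baer

section quad

theorem quad_irred {p : ℕ} [Fact p.Prime] {U : Type*} [CommGroup U] [Finite U] (hU : IsPGroup p U)
    (hp2 : p ≠ 2) [Nontrivial U] (x y : MulAut U)
    (hodd : Odd (Nat.card (Subgroup.closure {x, y})))
    (hx : ∃ k, x ^ p ^ k = 1) (hy : ∃ k, y ^ p ^ k = 1)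
    (qx : ∀ u, x (x u * u⁻¹) = x u * u⁻¹) (qy : ∀ u, y (y u * u⁻¹) = y u * u⁻¹)
    (hirr : ∀ W : Subgroup U, (∀ w ∈ W, x w ∈ W) → (∀ w ∈ W, y w ∈ W) → W = ⊥ ∨ W = ⊤) :
    x = 1 ∧ y = 1 := by
  -- fixed point subgroups
  let A : Subgroup U := x.toMonoidHom.eqLocus (MonoidHom.id U)
  let B : Subgroup U := y.toMonoidHom.eqLocus (MonoidHom.id U)
  have hA : ∀ w, w ∈ A ↔ x w = w := fun w => Iff.rfl
  have hB : ∀ w, w ∈ B ↔ y w = w := fun w => Iff.rfl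
  have invA : ∀ W : Subgroup U, A ≤ W → ∀ w ∈ W, x w ∈ W := by
    intro W hW w hw
    have h1 : x w * w⁻¹ ∈ W := hW ((hA _).2 (qx w))
    simpa using W.mul_mem h1 hw
  have invB : ∀ W : Subgroup U, B ≤ W → ∀ w ∈ W, y w ∈ W := by
    intro W hW w hw
    have h1 : y w * w⁻¹ ∈ W := hW ((hB _).2 (qy w))
    simpa using W.mul_mem h1 hw
  have htop : ∀ z : MulAut U, (∀ w ∈ (⊤ : Subgroup U), z w = w) → z = 1 := by
    intro z hz
    ext w
    exact hz w trivial
  rcases hirr (A ⊓ B) (fun w hw => by rw [(hA w).1 hw.1]; exact hw)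
    (fun w hw => by rw [(hB w).1 hw.2]; exact hw) with hAB | hAB
  swap
  · constructor
    · apply htop; intro w hw; rw [← hAB] at hw; exact hw.1
    · apply htop; intro w hw; rw [← hAB] at hw; exact hw.2
  exfalso
  have hsup : A ⊔ B = ⊤ := by
    rcases hirr (A ⊔ B) (invA _ le_sup_left) (invB _ le_sup_right) with h | h
    · exfalso
      have hA0 : A = ⊥ := le_bot_iff.1 (h ▸ le_sup_left)
      have : A = ⊤ := by
        rw [eq_top_iff]
        intro w _
        have h1 : x w * w⁻¹ ∈ A := (hA _).2 (qx w)
        rw [hA0, Subgroup.mem_bot, mul_inv_eq_one] at h1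
        exact h1
      rw [hA0] at this
      exact bot_ne_top this
    · exact h
  -- the involution
  let e₀ : A × B →* U := A.subtype.coprod B.subtype
  have he₀ : Function.Bijective e₀ := by
    constructor
    · rw [injective_iff_map_eq_one]
      rintro ⟨⟨a, ha⟩, ⟨b, hb⟩⟩ h
      have h1 : a * b = 1 := h
      have h2 : a = b⁻¹ := eq_inv_of_mul_eq_one_left h1
      have h3 : a ∈ A ⊓ B := ⟨ha, by rw [h2]; exact B.inv_mem hb⟩
      rw [hAB, Subgroup.mem_bot] at h3
      subst h3
      have : b = 1 := by simpa using h1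
      subst this
      rfl
    · intro u
      have : u ∈ A ⊔ B := by rw [hsup]; trivial
      obtain ⟨a, ha, b, hb, rfl⟩ := Subgroup.mem_sup.1 this
      exact ⟨(⟨a, ha⟩, ⟨b, hb⟩), rfl⟩
  let e : A × B ≃* U := MulEquiv.ofBijective e₀ he₀
  let t : MulAut U := e.symm.trans (((MulEquiv.inv A).prodCongr (MulEquiv.refl B)).trans e)
  have ht : ∀ a ∈ A, ∀ b ∈ B, t (a * b) = a⁻¹ * b := by
    intro a ha b hb
    have h1 : a * b = e (⟨a, ha⟩, ⟨b, hb⟩) := rfl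
    rw [h1]
    change e _ = _
    simp only [MulEquiv.toEquiv_eq_coe, EquivLike.coe_coe, MulEquiv.symm_apply_apply]
    rfl
  have htA : ∀ a ∈ A, t a = a⁻¹ := fun a ha => by simpa using ht a ha 1 B.one_mem
  have htB : ∀ b ∈ B, t b = b := fun b hb => by simpa using ht 1 A.one_mem b hb
  have ext2 : ∀ z z' : MulAut U, (∀ a ∈ A, z a = z' a) → (∀ b ∈ B, z b = z' b) → z = z' := by
    intro z z' h1 h2
    ext u
    have : u ∈ A ⊔ B := by rw [hsup]; trivial
    obtain ⟨a, ha, b, hb, rfl⟩ := Subgroup.mem_sup.1 this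
    rw [map_mul, map_mul, h1 a ha, h2 b hb]
  have htt : t * t = 1 := by
    apply ext2
    · intro a ha
      simp [htA a ha]
    · intro b hb
      simp [htB b hb]
  have htx : t * x * t * x = 1 := by
    apply ext2
    · intro a ha
      simp [(hA a).1 ha, htA a ha]
    · intro b hb
      have h1 : x b * b⁻¹ ∈ A := (hA _).2 (qx b)
      have h2 : x b = (x b * b⁻¹) * b := by simp
      have h3 : t (x b) = (x b * b⁻¹)⁻¹ * b := by
        rw [h2, ht _ h1 _ hb]; simp
      simp only [MulAut.mul_apply, MulAut.one_apply]
      rw [h3, map_mul, map_inv, (hA _).1 h1]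
      simp [htB b hb]
  have hty : t * y * t * y = 1 := by
    apply ext2
    · intro a ha
      have h1 : y a * a⁻¹ ∈ B := (hB _).2 (qy a)
      have h2 : y a = a * (y a * a⁻¹) := by rw [mul_comm a]; simp
      have h3 : t (y a) = a⁻¹ * (y a * a⁻¹) := by
        conv_lhs => rw [h2, ht _ ha _ h1]
      simp only [MulAut.mul_apply, MulAut.one_apply]
      rw [h3, map_mul, (hB _).1 h1, map_inv]
      simp [htA a ha]
    · intro b hb
      simp [(hB b).1 hb, htB b hb]
  have htinv : t⁻¹ = t := inv_eq_of_mul_eq_one_left htt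
  set Γ := Subgroup.closure {x, y} with hΓ
  have hxΓ : x ∈ Γ := Subgroup.subset_closure (by simp)
  have hyΓ : y ∈ Γ := Subgroup.subset_closure (by simp)
  have htΓ : ∀ g ∈ Γ, t * g * t ∈ Γ := by
    have : Γ ≤ Γ.comap (MulAut.conj t).toMonoidHom := by
      conv_lhs => rw [hΓ]
      rw [Subgroup.closure_le]
      rintro z (rfl | rfl)
      · change t * z * t⁻¹ ∈ Γ
        rw [htinv, eq_inv_of_mul_eq_one_left htx]
        exact Γ.inv_mem hxΓ
      · change t * z * t⁻¹ ∈ Γ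
        rw [htinv, eq_inv_of_mul_eq_one_left hty]
        exact Γ.inv_mem hyΓ
    intro g hg
    have := this hg
    change t * g * t⁻¹ ∈ Γ at this
    rwa [htinv] at this
  have hpz : ∀ z : MulAut U, (∃ k, z ^ p ^ k = 1) → IsPGroup p (Subgroup.zpowers z) := by
    rintro z ⟨k, hk⟩
    apply IsPGroup.of_card_dvd_pow (n := k)
    rw [Nat.card_zpowers]
    exact orderOf_dvd_of_pow_eq_one hk
  have : Finite (MulAut U) := inferInstance
  obtain ⟨Sx, hSx, hxS⟩ := (hpz x hx).exists_isSyl (X := Γ) (by simpa using hxΓ)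
  obtain ⟨Sy, hSy, hyS⟩ := (hpz y hy).exists_isSyl (X := Γ) (by simpa using hyΓ)
  obtain ⟨g, hg, hgS⟩ := hSx.conj_eq hSy
  -- fixed point
  obtain ⟨w, hw, hw1⟩ : ∃ w : U, (∀ s ∈ Sx, s w = w) ∧ w ≠ 1 := by
    have h1 : p ∣ Nat.card U := by
      rcases hU.card_eq_or_dvd with h | h
      · exact absurd h (by
          have := Finite.one_lt_card (α := U)
          omega)
      · exact h
    obtain ⟨w, hw, hw'⟩ := hSx.2.1.exists_fixed_point_of_prime_dvd_card_of_fixed_point U h1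
      (a := 1) (by intro s; exact map_one (s : MulAut U))
    exact ⟨w, fun s hs => hw ⟨s, hs⟩, fun h => hw' h.symm⟩
  have hwA : w ∈ A := (hA w).2 (hw x (hxS (Subgroup.mem_zpowers x)))
  have hgw : g⁻¹ w ∈ B := by
    rw [hB]
    have h1 := hw _ ((hgS y).1 (hyS (Subgroup.mem_zpowers y)))
    have h2 : (g * y * g⁻¹) w = g (y (g⁻¹ w)) := rfl
    rw [h2] at h1
    conv_rhs => rw [← h1]
    simp
  set r : MulAut U := t * (g * t * g⁻¹) with hr
  have hrw : r w = w⁻¹ := by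
    have h1 : r w = t (g (t (g⁻¹ w))) := rfl
    rw [h1, htB _ hgw]
    simp [htA w hwA]
  have hrΓ : r ∈ Γ := by
    rw [hr, show t * (g * t * g⁻¹) = (t * g * t) * g⁻¹ by group]
    exact Γ.mul_mem (htΓ g hg) (Γ.inv_mem hg)
  have hrn : r ^ Nat.card Γ = 1 := pow_card_of_mem hrΓ
  have hpow : ∀ n, (r ^ (2 * n)) w = w := by
    intro n
    induction n with
    | zero => simp
    | succ n ih =>
      rw [mul_add, mul_one, pow_add, MulAut.mul_apply]
      have : (r ^ 2) w = w := by
        rw [sq, MulAut.mul_apply, hrw, map_inv, hrw, inv_inv]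
      rw [this, ih]
  obtain ⟨m, hm⟩ := hodd
  have h2 : w = w⁻¹ := by
    have h3 : (r ^ Nat.card Γ) w = w⁻¹ := by
      rw [hm, pow_succ, MulAut.mul_apply, hrw, map_inv, hpow]
    rw [hrn] at h3
    exact h3
  have h4 : w ^ 2 = 1 := by
    rw [sq]
    nth_rewrite 2 [h2]
    simp
  obtain ⟨k, hk⟩ := hU w
  have h5 : orderOf w ∣ Nat.gcd 2 (p ^ k) :=
    Nat.dvd_gcd (orderOf_dvd_of_pow_eq_one h4) (orderOf_dvd_of_pow_eq_one hk)
  have hpp : p.Prime := Fact.out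
  have h6 : Nat.Coprime 2 (p ^ k) :=
    ((Nat.coprime_primes Nat.prime_two hpp).2 (Ne.symm hp2)).pow_right k
  rw [h6.gcd_eq_one, Nat.dvd_one, orderOf_eq_one_iff] at h5
  exact hw1 h5

theorem quad_pgroup {p : ℕ} [Fact p.Prime] (hp2 : p ≠ 2) {J : Type*} [Group J] [Finite J]
    (hodd : Odd (Nat.card J)) (x y : J) (hgen : Subgroup.closure {x, y} = ⊤)
    (hx : ∃ k, x ^ p ^ k = 1) (hy : ∃ k, y ^ p ^ k = 1) (n : ℕ) :
    ∀ (U : Type) [Group U] [Finite U] (hU : IsPGroup p U) (φ : J →* Monoid.End U)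
    (qx : ∀ u, φ x (φ x u * u⁻¹) = φ x u * u⁻¹) (qy : ∀ u, φ y (φ y u * u⁻¹) = φ y u * u⁻¹),
    Nat.card U = n → ∀ k : J, ∃ n, φ (k ^ p ^ n) = 1 := by
  induction n using Nat.strong_induction_on with
  | _ n ih =>
  intro U _ _ hU φ qx qy hn k
  by_cases hsub : Subsingleton U
  · exact ⟨0, by ext u; exact Subsingleton.elim _ _⟩
  rw [not_subsingleton_iff_nontrivial] at hsub
  by_cases hW : ∃ W : Subgroup U, W.Normal ∧ (∀ w ∈ W, φ x w ∈ W) ∧ (∀ w ∈ W, φ y w ∈ W) ∧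
      W ≠ ⊥ ∧ W ≠ ⊤
  · obtain ⟨W, hWn, hWx, hWy, hW0, hW1⟩ := hW
    have hinv : ∀ j : J, ∀ w ∈ W, φ j w ∈ W := by
      have hadd : ∀ j : J, (∀ w ∈ W, φ j w ∈ W) → (∀ w ∈ W, φ j⁻¹ w ∈ W) := by
        intro j hj
        have h1 : W.map (φ j) = W := by
          apply Subgroup.eq_of_le_of_card_ge
          · rintro _ ⟨w, hw, rfl⟩; exact hj w hw
          · refine (Nat.card_congr (W.equivMapOfInjective (φ j) ?_).toEquiv).le
            apply Function.LeftInverse.injective (g := φ j⁻¹)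
            intro u
            change (φ j⁻¹ * φ j) u = u
            rw [← map_mul]; simp
        intro w hw
        rw [← h1] at hw
        obtain ⟨w', hw', rfl⟩ := hw
        change (φ j⁻¹ * φ j) w' ∈ W
        rw [← map_mul]; simpa using hw'
      intro j
      have hj : j ∈ Subgroup.closure {x, y} := by rw [hgen]; trivial
      induction hj using Subgroup.closure_induction with
      | mem z hz =>
        rcases hz with rfl | rfl
        · exact hWx
        · exact hWy
      | one => intro w hw; simpa using hw
      | mul a b _ _ ha hb =>
        intro w hw
        rw [map_mul]; exact ha _ (hb w hw)
      | inv a _ ha => exact hadd a ha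
    -- restriction
    let φ₁ : J →* Monoid.End W :=
      { toFun := fun j => ((φ j).comp W.subtype).codRestrict W (fun w => hinv j w w.2)
        map_one' := by ext w; exact congrArg (fun f : Monoid.End U => f w) (map_one φ)
        map_mul' := fun a b => by
          ext w; exact congrArg (fun f : Monoid.End U => f w) (map_mul φ a b) }
    have h₁ : ∀ j w, ((φ₁ j w : W) : U) = φ j w := fun j w => rfl
    let φ₂ : J →* Monoid.End (U ⧸ W) :=
      { toFun := fun j => QuotientGroup.map W W (φ j) (fun w hw => hinv j w hw)
        map_one' := by
          apply QuotientGroup.monoidHom_ext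
          ext w
          exact congrArg (fun f : Monoid.End U => ((f w : U) : U ⧸ W)) (map_one φ)
        map_mul' := fun a b => by
          apply QuotientGroup.monoidHom_ext
          ext w
          exact congrArg (fun f : Monoid.End U => ((f w : U) : U ⧸ W)) (map_mul φ a b) }
    have h₂ : ∀ j (u : U), φ₂ j (u : U ⧸ W) = ((φ j u : U) : U ⧸ W) := fun j w => rfl
    have hc := W.card_mul_index
    have hWc : 1 < Nat.card W := by
      rw [Subgroup.one_lt_card_iff_ne_bot]; exact hW0
    have hWi : 1 < W.index := by
      have h0 : W.index ≠ 0 := Subgroup.index_ne_zero_of_finite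
      have h1 : W.index ≠ 1 := fun h => hW1 (Subgroup.index_eq_one.1 h)
      omega
    obtain ⟨n₁, hn₁⟩ := ih (Nat.card W) (by nlinarith) W (hU.to_subgroup W) φ₁
      (fun u => Subtype.ext (qx u)) (fun u => Subtype.ext (qy u)) rfl k
    obtain ⟨n₂, hn₂⟩ := ih (Nat.card (U ⧸ W)) (by
        change W.index < n
        nlinarith) (U ⧸ W) (hU.to_quotient W) φ₂
      (fun u => by
        induction u using QuotientGroup.induction_on with
        | H u =>
          have := congrArg (QuotientGroup.mk (s := W)) (qx u)
          exact this)
      (fun u => by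
        induction u using QuotientGroup.induction_on with
        | H u =>
          have := congrArg (QuotientGroup.mk (s := W)) (qy u)
          exact this) rfl k
    set k' := k ^ p ^ (n₁ + n₂) with hk'
    have e₁ : φ₁ k' = 1 := by
      rw [hk', pow_add, pow_mul, map_pow, hn₁, one_pow]
    have e₂ : φ₂ k' = 1 := by
      rw [hk', add_comm, pow_add, pow_mul, map_pow, hn₂, one_pow]
    have f₁ : ∀ w ∈ W, φ k' w = w := by
      intro w hw
      have := congrArg (fun f : Monoid.End W => ((f ⟨w, hw⟩ : W) : U)) e₁
      exact this
    have f₂ : ∀ u, φ k' u * u⁻¹ ∈ W := by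
      intro u
      have h1 : φ₂ k' (u : U ⧸ W) = u := by rw [e₂]; rfl
      rw [h₂] at h1
      have h2 := (QuotientGroup.eq (s := W)).1 h1
      have h3 : (φ k' u)⁻¹ * u ∈ W := h2
      have h4 := hWn.conj_mem _ (W.inv_mem h3) u
      simpa [mul_assoc] using h4
    have f₃ : ∀ u, ∀ j, φ (k' ^ j) u = (φ k' u * u⁻¹) ^ j * u := by
      intro u j
      induction j with
      | zero => simp
      | succ j ih =>
        rw [pow_succ', map_mul]
        change φ k' (φ (k' ^ j) u) = _
        rw [ih, map_mul, map_pow, f₁ _ (f₂ u), pow_succ]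
        simp [mul_assoc]
    obtain ⟨m, hm⟩ := (IsPGroup.iff_card (p := p) (G := W)).1 (hU.to_subgroup W)
    refine ⟨n₁ + n₂ + m, ?_⟩
    rw [pow_add, pow_mul, ← hk']
    ext u
    rw [f₃ u, ← hm]
    have h6 : (φ k' u * u⁻¹) ^ Nat.card W = 1 := pow_card_of_mem (f₂ u)
    rw [h6]; simp
  · push Not at hW
    have hcomm : ∀ a b : U, a * b = b * a := by
      have hinv : ∀ j : J, ∀ w ∈ commutator U, φ j w ∈ commutator U := by
        intro j w hw
        have h2 : ∀ f : U →* U, (commutator U).map f ≤ commutator U := by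
          intro f
          rw [commutator_def, Subgroup.map_commutator]
          exact Subgroup.commutator_mono le_top le_top
        exact h2 (φ j) ⟨w, hw, rfl⟩
      have h0 : commutator U = ⊥ := by
        by_contra hne
        have := hW (commutator U) inferInstance (hinv x) (hinv y) hne
        have hnil : Group.IsNilpotent U := hU.isNilpotent
        have hs : Group.IsSolvable U := inferInstance
        have := Group.IsSolvable.commutator_lt_top_of_nontrivial U
        exact absurd ‹commutator U = ⊤› this.ne
      intro a b
      have h1 := Subgroup.commutator_mem_commutator (Subgroup.mem_top a) (Subgroup.mem_top b)
      rw [← commutator_def, h0, Subgroup.mem_bot, commutatorElement_eq_one_iff_mul_comm] at h1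
      exact h1
    let : CommGroup U := { (inferInstance : Group U) with mul_comm := hcomm }
    let ψ : J →* MulAut U :=
      { toFun := fun j =>
          { toFun := φ j
            invFun := φ j⁻¹
            left_inv := fun u => by
              change (φ j⁻¹ * φ j) u = u
              rw [← map_mul]; simp
            right_inv := fun u => by
              change (φ j * φ j⁻¹) u = u
              rw [← map_mul]; simp
            map_mul' := map_mul (φ j) }
        map_one' := by ext u; change φ 1 u = u; simp
        map_mul' := fun a b => by
          ext u; change φ (a * b) u = φ a (φ b u)
          rw [map_mul]; rfl }
    have hψ : ∀ j u, ψ j u = φ j u := fun _ _ => rfl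
    have h1 : Subgroup.closure {ψ x, ψ y} = ψ.range := by
      rw [MonoidHom.range_eq_map, ← hgen, MonoidHom.map_closure, Set.image_pair]
    obtain ⟨hx1, hy1⟩ := quad_irred hU hp2 (ψ x) (ψ y) (by
        rw [h1]
        exact hodd.of_dvd_nat (Subgroup.card_range_dvd ψ))
      (by obtain ⟨k, hk⟩ := hx; exact ⟨k, by rw [← map_pow, hk, map_one]⟩)
      (by obtain ⟨k, hk⟩ := hy; exact ⟨k, by rw [← map_pow, hk, map_one]⟩) qx qy
      (by
        intro W h1 h2
        by_contra h3
        push Not at h3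
        exact h3.2 (hW W ⟨fun w hw g => by rw [hcomm g w]; simpa using hw⟩ h1 h2 h3.1))
    refine ⟨0, ?_⟩
    have h2 : ψ.range = ⊥ := by
      rw [← h1, hx1, hy1]; simp
    have h3 : ψ (k ^ p ^ 0) = 1 := by
      have : ψ (k ^ p ^ 0) ∈ ψ.range := ⟨_, rfl⟩
      rwa [h2, Subgroup.mem_bot] at this
    ext u
    rw [← hψ, h3]; rfl

/-- `p`-stability for groups of odd order -/
theorem stab {p : ℕ} [Fact p.Prime] (hp2 : p ≠ 2) {G : Type} [Group G] [Finite G]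
    (hodd : Odd (Nat.card G)) (U : Subgroup G) [hUn : U.Normal] (hU : IsPGroup p U) (a : G)
    (ha : ∃ k, a ^ p ^ k = 1) (hq : ∀ u ∈ U, a * (a * u * a⁻¹ * u⁻¹) = (a * u * a⁻¹ * u⁻¹) * a) :
    ∃ N : Subgroup G, N.Normal ∧ a ∈ N ∧ Subgroup.centralizer (U : Set G) ≤ N ∧
      ∀ n ∈ N, ∃ j, n ^ p ^ j ∈ Subgroup.centralizer (U : Set G) := by
  set C := Subgroup.centralizer (U : Set G) with hC
  have : C.Normal := inferInstance
  obtain ⟨N, hN, hNp, haN⟩ := baer_suzuki (p := p) (a : G ⧸ C) (by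
    intro g
    induction g using QuotientGroup.induction_on with
    | H g =>
    set J := Subgroup.closure {a, g * a * g⁻¹} with hJ
    have hmap : Subgroup.closure {(a : G ⧸ C), (g : G ⧸ C) * a * (g : G ⧸ C)⁻¹} =
        J.map (QuotientGroup.mk' C) := by
      rw [hJ, MonoidHom.map_closure, Set.image_pair]; rfl
    rw [hmap]
    have haJ : a ∈ J := Subgroup.subset_closure (by simp)
    have hgJ : g * a * g⁻¹ ∈ J := Subgroup.subset_closure (by simp)
    let φ : J →* Monoid.End U :=
      { toFun := fun j => ((MulAut.conjNormal (j : G) : MulAut U) : U →* U)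
        map_one' := by
          ext u
          change (1 : G) * u * (1 : G)⁻¹ = u
          simp
        map_mul' := fun a b => by
          ext u
          change ((a : G) * b) * u * ((a : G) * b)⁻¹ = a * (b * u * (b : G)⁻¹) * (a : G)⁻¹
          group }
    have hφ : ∀ (j : J) (u : U), ((φ j u : U) : G) = j * u * (j : G)⁻¹ := fun j u => rfl
    have key := quad_pgroup hp2 (J := J) (p := p)
      (hodd.of_dvd_nat (Subgroup.card_subgroup_dvd_card J))
      ⟨a, haJ⟩ ⟨g * a * g⁻¹, hgJ⟩ (by
        rw [← Subgroup.map_subtype_inj, MonoidHom.map_closure, Set.image_pair,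
          ← MonoidHom.range_eq_map, Subgroup.range_subtype]
        rfl)
      (by obtain ⟨k, hk⟩ := ha; exact ⟨k, Subtype.ext (by simpa using hk)⟩)
      (by obtain ⟨k, hk⟩ := ha; exact ⟨k, Subtype.ext (by simp [hk])⟩)
      (Nat.card U) U hU φ
      (by
        intro u
        apply Subtype.ext
        have h1 := hq u u.2
        simp only [hφ, Subgroup.coe_mul, Subgroup.coe_inv]
        rw [h1]; group)
      (by
        intro u
        apply Subtype.ext
        have h1 := hq (g⁻¹ * u * g) (by simpa using hUn.conj_mem u u.2 g⁻¹)
        simp only [hφ, Subgroup.coe_mul, Subgroup.coe_inv]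
        have h2 : g * (a * (a * (g⁻¹ * u * g) * a⁻¹ * (g⁻¹ * u * g)⁻¹)) * a⁻¹ * g⁻¹ =
          g * ((a * (g⁻¹ * u * g) * a⁻¹ * (g⁻¹ * u * g)⁻¹) * a) * a⁻¹ * g⁻¹ := by rw [h1]
        simp only [mul_assoc, mul_inv_rev, inv_inv, inv_mul_cancel_left,
          mul_inv_cancel, mul_one] at h2 ⊢
        exact h2) rfl
    rintro ⟨_, ⟨k, hk, rfl⟩⟩
    obtain ⟨n, hn⟩ := key ⟨k, hk⟩
    refine ⟨n, Subtype.ext ?_⟩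
    change (QuotientGroup.mk' C k) ^ p ^ n = 1
    rw [← map_pow, QuotientGroup.mk'_apply, QuotientGroup.eq_one_iff, hC,
      Subgroup.mem_centralizer_iff]
    intro u hu
    have h1 := congrArg (fun f : Monoid.End U => ((f ⟨u, hu⟩ : U) : G)) hn
    simp only [hφ] at h1
    have h2 : k ^ p ^ n * u * (k ^ p ^ n)⁻¹ = u := h1
    rw [mul_inv_eq_iff_eq_mul] at h2
    exact h2.symm)
  refine ⟨N.comap (QuotientGroup.mk' C), inferInstance, haN, ?_, ?_⟩
  · intro c hc
    have : QuotientGroup.mk' C c = 1 := (QuotientGroup.eq_one_iff c).2 hc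
    rw [Subgroup.mem_comap, this]; exact N.one_mem
  · intro n hn
    obtain ⟨j, hj⟩ := hNp ⟨_, hn⟩
    refine ⟨j, ?_⟩
    rw [← QuotientGroup.eq_one_iff]
    have := congrArg (Subtype.val) hj
    exact this

end quad

section puig

variable {G : Type*} [Group G]

/-- subgroup generated by abelian subgroups of `S` normalized by `Y` -/
def PL (S Y : Subgroup G) : Subgroup G :=
  sSup {A | A ≤ S ∧ (∀ a ∈ A, ∀ b ∈ A, a * b = b * a) ∧ Y ≤ Subgroup.normalizer (A : Set G)}

theorem PL_le (S Y : Subgroup G) : PL S Y ≤ S := sSup_le fun _ hA => hA.1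

theorem le_PL {S Y A : Subgroup G} (h1 : A ≤ S) (h2 : ∀ a ∈ A, ∀ b ∈ A, a * b = b * a)
    (h3 : Y ≤ Subgroup.normalizer (A : Set G)) : A ≤ PL S Y := le_sSup ⟨h1, h2, h3⟩

theorem PL_anti (S : Subgroup G) {Y Z : Subgroup G} (h : Y ≤ Z) : PL S Z ≤ PL S Y :=
  sSup_le fun _ hA => le_PL hA.1 hA.2.1 (h.trans hA.2.2)

theorem PL_mono {S T : Subgroup G} (h : S ≤ T) (Y : Subgroup G) : PL S Y ≤ PL T Y :=
  sSup_le fun _ hA => le_PL (hA.1.trans h) hA.2.1 hA.2.2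

/-- the least fixed point -/
def Pst (S : Subgroup G) : Subgroup G :=
  OrderHom.lfp ⟨fun Y => PL S (PL S Y), fun _ _ h => PL_anti S (PL_anti S h)⟩

/-- the Puig subgroup -/
def Pu (S : Subgroup G) : Subgroup G := PL S (Pst S)

/-- the centre of the Puig subgroup -/
def Wz (S : Subgroup G) : Subgroup G := Pu S ⊓ Subgroup.centralizer (Pu S : Set G)

theorem PL_Pu (S : Subgroup G) : PL S (Pu S) = Pst S :=
  OrderHom.map_lfp ⟨fun Y => PL S (PL S Y), fun _ _ h => PL_anti S (PL_anti S h)⟩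

theorem Pst_le_of {S Y : Subgroup G} (h : PL S (PL S Y) ≤ Y) : Pst S ≤ Y :=
  OrderHom.lfp_le ⟨fun Y => PL S (PL S Y), fun _ _ h => PL_anti S (PL_anti S h)⟩ h

theorem Pu_le (S : Subgroup G) : Pu S ≤ S := PL_le _ _
theorem Pst_le (S : Subgroup G) : Pst S ≤ S := by rw [← PL_Pu]; exact PL_le _ _
theorem Wz_le_Pu (S : Subgroup G) : Wz S ≤ Pu S := inf_le_left
theorem Wz_le (S : Subgroup G) : Wz S ≤ S := inf_le_left.trans (Pu_le S)

theorem Pst_le_Pu (S : Subgroup G) : Pst S ≤ Pu S := by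
  apply Pst_le_of
  rw [PL_Pu]; rfl

theorem le_Pst {S A : Subgroup G} (h1 : A ≤ S) (h2 : ∀ a ∈ A, ∀ b ∈ A, a * b = b * a)
    (h3 : S ≤ Subgroup.normalizer (A : Set G)) : A ≤ Pst S := by
  rw [← PL_Pu]
  exact le_PL h1 h2 ((Pu_le S).trans h3)

theorem le_Pu {S A : Subgroup G} (h1 : A ≤ S) (h2 : ∀ a ∈ A, ∀ b ∈ A, a * b = b * a)
    (h3 : S ≤ Subgroup.normalizer (A : Set G)) : A ≤ Pu S :=
  (le_Pst h1 h2 h3).trans (Pst_le_Pu S)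

/-- coherence -/
theorem Pu_eq_of_le {S X : Subgroup G} (h1 : Pu S ≤ X) (h2 : X ≤ S) : Pu X = Pu S := by
  have e1 : PL X (Pst S) = Pu S := by
    apply le_antisymm (PL_mono h2 _)
    apply sSup_le
    intro A hA
    exact le_PL ((le_PL hA.1 hA.2.1 hA.2.2 : A ≤ Pu S).trans h1) hA.2.1 hA.2.2
  have key : ∀ A : Subgroup G, A ≤ S → (∀ a ∈ A, ∀ b ∈ A, a * b = b * a) →
      Pu S ≤ Subgroup.normalizer (A : Set G) → A ≤ X := by
    intro A a1 a2 a3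
    have := le_PL a1 a2 a3
    rw [PL_Pu] at this
    exact this.trans ((Pst_le_Pu S).trans h1)
  have e2 : PL X (Pu S) = Pst S := by
    rw [← PL_Pu]
    apply le_antisymm (PL_mono h2 _)
    apply sSup_le
    intro A hA
    exact le_PL (key A hA.1 hA.2.1 hA.2.2) hA.2.1 hA.2.2
  have l1 : Pst X ≤ Pst S := Pst_le_of (by rw [e1, e2])
  have l0 : Pu S ≤ Pu X := by
    rw [← e1]; exact PL_anti X l1
  have l2 : Pst S ≤ Pst X := by
    apply Pst_le_of
    refine (PL_anti S (PL_mono h2 (Pst X))).trans ?_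
    change PL S (Pu X) ≤ _
    conv_rhs => rw [← PL_Pu]
    apply sSup_le
    intro A hA
    exact le_PL (key A hA.1 hA.2.1 (l0.trans hA.2.2)) hA.2.1 hA.2.2
  have : Pst X = Pst S := le_antisymm l1 l2
  rw [← e1, ← this]; rfl

section transport

variable {H : Type*} [Group H] [Finite G] [Finite H]

theorem map_inj_of_le {S A B : Subgroup G} (f : G →* H) (hf : Set.InjOn f S) (hA : A ≤ S)
    (hB : B ≤ S) (h : A.map f ≤ B.map f) : A ≤ B := by
  intro a ha
  obtain ⟨b, hb, hab⟩ := h ⟨a, ha, rfl⟩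
  have : b = a := hf (hB hb) (hA ha) hab
  exact this ▸ hb

theorem map_inf_comap_of_le {S : Subgroup G} {B : Subgroup H} (f : G →* H) (hB : B ≤ S.map f) :
    (S ⊓ B.comap f).map f = B := by
  apply le_antisymm
  · rintro _ ⟨a, ha, rfl⟩; exact ha.2
  · intro b hb
    obtain ⟨a, ha, rfl⟩ := hB hb
    exact ⟨a, ⟨ha, hb⟩, rfl⟩

theorem map_le_normalizer_iff {S A Y : Subgroup G} (f : G →* H) (hf : Set.InjOn f S) (hA : A ≤ S)
    (hY : Y ≤ S) : Y.map f ≤ Subgroup.normalizer (A.map f : Set H) ↔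
      Y ≤ Subgroup.normalizer (A : Set G) := by
  constructor
  · intro h y hy
    apply mem_normalizer_of_conj
    intro a ha
    obtain ⟨b, hb, hab⟩ := (Subgroup.mem_normalizer_iff.1 (h ⟨y, hy, rfl⟩) (f a)).1 ⟨a, ha, rfl⟩
    have : b = y * a * y⁻¹ := by
      apply hf (hA hb) (S.mul_mem (S.mul_mem (hY hy) (hA ha)) (S.inv_mem (hY hy)))
      simpa using hab
    exact this ▸ hb
  · rintro h _ ⟨y, hy, rfl⟩
    apply mem_normalizer_of_conj
    rintro _ ⟨a, ha, rfl⟩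
    exact ⟨y * a * y⁻¹, (Subgroup.mem_normalizer_iff.1 (h hy) a).1 ha, by simp⟩

theorem PL_map {S Y : Subgroup G} (f : G →* H) (hf : Set.InjOn f S) (hY : Y ≤ S) :
    (PL S Y).map f = PL (S.map f) (Y.map f) := by
  apply le_antisymm
  · rw [Subgroup.map_le_iff_le_comap]
    apply sSup_le
    intro A hA
    rw [← Subgroup.map_le_iff_le_comap]
    refine le_PL (Subgroup.map_mono hA.1) ?_ ((map_le_normalizer_iff f hf hA.1 hY).2 hA.2.2)
    rintro _ ⟨a, ha, rfl⟩ _ ⟨b, hb, rfl⟩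
    rw [← map_mul, ← map_mul, hA.2.1 a ha b hb]
  · apply sSup_le
    intro B hB
    rw [← map_inf_comap_of_le f hB.1]
    apply Subgroup.map_mono
    apply le_PL inf_le_left
    · intro a ha b hb
      apply hf (S.mul_mem ha.1 hb.1) (S.mul_mem hb.1 ha.1)
      rw [map_mul, map_mul]
      exact hB.2.1 _ ha.2 _ hb.2
    · rw [← map_le_normalizer_iff f hf inf_le_left hY, map_inf_comap_of_le f hB.1]
      exact hB.2.2

theorem Pst_map {S : Subgroup G} (f : G →* H) (hf : Set.InjOn f S) :
    (Pst S).map f = Pst (S.map f) := by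
  apply le_antisymm
  · have h1 : Pst S ≤ S ⊓ (Pst (S.map f)).comap f := by
      apply Pst_le_of
      apply map_inj_of_le f hf (PL_le _ _) inf_le_left
      rw [PL_map f hf (PL_le _ _), PL_map f hf inf_le_left, map_inf_comap_of_le f (Pst_le _)]
      change PL _ (Pu _) ≤ _
      rw [PL_Pu]
    refine (Subgroup.map_mono h1).trans ?_
    rw [map_inf_comap_of_le f (Pst_le _)]
  · apply Pst_le_of
    rw [← PL_map f hf (Pst_le S), ← PL_map f hf (PL_le _ _)]
    apply Subgroup.map_mono
    change PL _ (Pu _) ≤ _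
    rw [PL_Pu]

theorem Pu_map {S : Subgroup G} (f : G →* H) (hf : Set.InjOn f S) :
    (Pu S).map f = Pu (S.map f) := by
  unfold Pu
  rw [PL_map f hf (Pst_le S), Pst_map f hf]

theorem Wz_map {S : Subgroup G} (f : G →* H) (hf : Set.InjOn f S) :
    (Wz S).map f = Wz (S.map f) := by
  unfold Wz
  rw [← Pu_map f hf]
  ext y
  constructor
  · rintro ⟨x, ⟨hx, hx'⟩, rfl⟩
    refine ⟨⟨x, hx, rfl⟩, ?_⟩
    replace hx' := Subgroup.mem_centralizer_iff.1 hx'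
    apply Subgroup.mem_centralizer_iff.2
    rintro _ ⟨a, ha, rfl⟩
    rw [← map_mul, ← map_mul, hx' a ha]
  · rintro ⟨⟨x, hx, rfl⟩, hx'⟩
    refine ⟨x, ⟨hx, ?_⟩, rfl⟩
    replace hx' := Subgroup.mem_centralizer_iff.1 hx'
    apply Subgroup.mem_centralizer_iff.2
    intro a ha
    have := hx' (f a) ⟨a, ha, rfl⟩
    rw [← map_mul, ← map_mul] at this
    exact hf (S.mul_mem (Pu_le S ha) (Pu_le S hx)) (S.mul_mem (Pu_le S hx) (Pu_le S ha)) this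

theorem map_conj_eq_iff {S : Subgroup G} {g : G} :
    S.map (MulAut.conj g).toMonoidHom = S ↔ g ∈ Subgroup.normalizer (S : Set G) := by
  constructor
  · intro h
    apply mem_normalizer_of_conj
    intro s hs
    conv => rw [← h]
    exact ⟨s, hs, rfl⟩
  · intro h
    apply Subgroup.eq_of_le_of_card_ge
    · rintro _ ⟨s, hs, rfl⟩
      exact (Subgroup.mem_normalizer_iff.1 h s).1 hs
    · exact (Nat.card_congr (S.equivMapOfInjective _ (MulAut.conj g).injective).toEquiv).le

theorem Pu_normalizer (S : Subgroup G) :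
    Subgroup.normalizer (S : Set G) ≤ Subgroup.normalizer (Pu S : Set G) := by
  intro g hg
  rw [← map_conj_eq_iff] at hg ⊢
  rw [Pu_map _ (MulAut.conj g).injective.injOn, hg]

theorem Wz_normalizer (S : Subgroup G) :
    Subgroup.normalizer (S : Set G) ≤ Subgroup.normalizer (Wz S : Set G) := by
  intro g hg
  rw [← map_conj_eq_iff] at hg ⊢
  rw [Wz_map _ (MulAut.conj g).injective.injOn, hg]

end transport

theorem Wz_comm (S : Subgroup G) : ∀ a ∈ Wz S, ∀ b ∈ Wz S, a * b = b * a := by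
  intro a ha b hb
  exact Subgroup.mem_centralizer_iff.1 hb.2 a ha.1

variable [Finite G] {p : ℕ} [Fact p.Prime]

/-- nontrivial normalized subgroup of `p`-group meets the centre, mod a normal subgroup -/
theorem exists_central_mod {S A C : Subgroup G} (hS : IsPGroup p S) (hAC : A < C) (hCS : C ≤ S)
    (hA : S ≤ Subgroup.normalizer (A : Set G)) (hC : S ≤ Subgroup.normalizer (C : Set G)) :
    ∃ x ∈ C, x ∉ A ∧ ∀ s ∈ S, s * x * s⁻¹ * x⁻¹ ∈ A := by
  -- consider the quotient of `S` by `A`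
  have hAn : (A.subgroupOf S).Normal := Subgroup.normal_subgroupOf_iff_le_normalizer
    (hAC.le.trans hCS) |>.2 hA
  have hCn : (C.subgroupOf S).Normal := Subgroup.normal_subgroupOf_iff_le_normalizer hCS |>.2 hC
  set A' := A.subgroupOf S
  let π := QuotientGroup.mk' A'
  set N := (C.subgroupOf S).map π with hN
  have hNn : N.Normal := hCn.map π (QuotientGroup.mk'_surjective _)
  obtain ⟨c, hc, hcA⟩ := SetLike.exists_of_lt hAC
  have hNnt : Nontrivial N := by
    refine ⟨⟨π ⟨c, hCS hc⟩, ⟨_, hc, rfl⟩⟩, 1, ?_⟩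
    intro h
    have h1 : π ⟨c, hCS hc⟩ = 1 := congrArg Subtype.val h
    exact hcA (Subgroup.mem_subgroupOf.1 ((QuotientGroup.eq_one_iff (N := A') (⟨c, hCS hc⟩ : S)).1 h1))
  have hQ : IsPGroup p (S ⧸ A') := hS.to_quotient A'
  have hQ' : IsPGroup p (ConjAct (S ⧸ A')) := hQ
  have h1 : p ∣ Nat.card N := by
    rcases (hQ.to_subgroup N).card_eq_or_dvd with h | h
    · exact absurd h (by
        have := Finite.one_lt_card (α := N)
        omega)
    · exact h
  obtain ⟨w, hw, hw'⟩ := hQ'.exists_fixed_point_of_prime_dvd_card_of_fixed_point N h1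
      (a := 1) (by intro s; exact smul_one s)
  obtain ⟨⟨x, hxS⟩, hxC, hxw⟩ := w.2
  refine ⟨x, hxC, ?_, ?_⟩
  · intro hxA
    apply hw'
    apply Subtype.ext
    rw [← hxw]
    exact ((QuotientGroup.eq_one_iff (N := A') (⟨x, hxS⟩ : S)).2 (Subgroup.mem_subgroupOf.2 hxA)).symm
  · intro s hs
    have h2 := congrArg Subtype.val (hw (ConjAct.toConjAct (π ⟨s, hs⟩)))
    have h3 : π ⟨s, hs⟩ * w * (π ⟨s, hs⟩)⁻¹ = w := h2
    rw [← hxw] at h3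
    have h4 : π ((⟨s, hs⟩ : S) * (⟨x, hxS⟩ : S) * (⟨s, hs⟩ : S)⁻¹ * (⟨x, hxS⟩ : S)⁻¹) = 1 := by
      rw [map_mul, map_mul, map_mul, map_inv, map_inv, h3, mul_inv_cancel]
    exact Subgroup.mem_subgroupOf.1 ((QuotientGroup.eq_one_iff (N := A') ((⟨s, hs⟩ : S) * (⟨x, hxS⟩ : S) * (⟨s, hs⟩ : S)⁻¹ * (⟨x, hxS⟩ : S)⁻¹)).1 h4)

/-- self-centralizing abelian normal subgroup in the Puig subgroup -/
theorem centralizer_Pu_le {S : Subgroup G} (hS : IsPGroup p S) :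
    S ⊓ Subgroup.centralizer (Pu S : Set G) ≤ Pu S := by
  obtain ⟨A, hA⟩ := (Set.toFinite {A : Subgroup G | A ≤ S ∧ (∀ a ∈ A, ∀ b ∈ A, a * b = b * a) ∧
    S ≤ Subgroup.normalizer (A : Set G)}).exists_maximal ⟨⊥, bot_le, by simp, by
      intro s _
      apply mem_normalizer_of_conj
      simp⟩
  have hAP : A ≤ Pu S := le_Pu hA.1.1 hA.1.2.1 hA.1.2.2
  by_contra hcon
  set C := S ⊓ Subgroup.centralizer (A : Set G) with hCdef
  have h1 : S ⊓ Subgroup.centralizer (Pu S : Set G) ≤ C :=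
    inf_le_inf_left _ (Subgroup.centralizer_le hAP)
  have hAC : A < C := by
    refine lt_of_le_of_ne (le_inf hA.1.1 ?_) ?_
    · intro a ha
      rw [Subgroup.mem_centralizer_iff]
      intro b hb
      exact hA.1.2.1 b hb a ha
    · intro h2
      exact hcon ((h1.trans h2.ge).trans hAP)
  have hCn : S ≤ Subgroup.normalizer (C : Set G) := by
    intro s hs
    apply mem_normalizer_of_conj
    rintro c ⟨hc, hc'⟩
    refine ⟨S.mul_mem (S.mul_mem hs hc) (S.inv_mem hs), ?_⟩
    replace hc' := Subgroup.mem_centralizer_iff.1 hc'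
    apply Subgroup.mem_centralizer_iff.2
    intro a ha
    have h3 : s⁻¹ * a * s ∈ A := by
      have := (Subgroup.mem_normalizer_iff.1 (hA.1.2.2 (S.inv_mem hs)) a).1 ha
      simpa using this
    have h4 := hc' _ h3
    calc a * (s * c * s⁻¹) = s * (s⁻¹ * a * s * c) * s⁻¹ := by group
      _ = s * (c * (s⁻¹ * a * s)) * s⁻¹ := by rw [h4]
      _ = _ := by group
  obtain ⟨x, hxC, hxA, hx⟩ := exists_central_mod hS hAC inf_le_left hA.1.2.2 hCn
  have hxc : ∀ a ∈ A, a * x = x * a := Subgroup.mem_centralizer_iff.1 hxC.2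
  have hcomm : ∀ a ∈ A ⊔ Subgroup.zpowers x, ∀ b ∈ A ⊔ Subgroup.zpowers x, a * b = b * a := by
    have h5 : A ⊔ Subgroup.zpowers x = Subgroup.closure (A ∪ {x} : Set G) := by
      rw [Subgroup.closure_union, Subgroup.closure_eq, Subgroup.zpowers_eq_closure]
    intro a ha b hb
    rw [h5] at ha hb
    have h6 : ∀ u ∈ (A ∪ {x} : Set G), ∀ v ∈ (A ∪ {x} : Set G), u * v = v * u := by
      rintro u (hu | rfl) v (hv | rfl)
      · exact hA.1.2.1 u hu v hv
      · exact hxc u hu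
      · exact (hxc v hv).symm
      · rfl
    have := Subgroup.isMulCommutative_closure (k := (A ∪ {x} : Set G)) h6
    have h7 := this.is_comm.comm ⟨a, ha⟩ ⟨b, hb⟩
    exact congrArg Subtype.val h7
  have hnorm : S ≤ Subgroup.normalizer ((A ⊔ Subgroup.zpowers x : Subgroup G) : Set G) := by
    intro s hs
    apply mem_normalizer_of_conj
    have : A ⊔ Subgroup.zpowers x ≤
        (A ⊔ Subgroup.zpowers x).comap (MulAut.conj s).toMonoidHom := by
      rw [sup_le_iff]
      constructor
      · intro a ha
        exact Subgroup.mem_sup_left ((Subgroup.mem_normalizer_iff.1 (hA.1.2.2 hs) a).1 ha)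
      · rw [Subgroup.zpowers_le]
        change s * x * s⁻¹ ∈ A ⊔ Subgroup.zpowers x
        rw [show s * x * s⁻¹ = (s * x * s⁻¹ * x⁻¹) * x by group]
        exact Subgroup.mul_mem_sup (hx s hs) (Subgroup.mem_zpowers x)
    exact fun t ht => this ht
  have h8 : A ⊔ Subgroup.zpowers x ≤ A := hA.2 ⟨sup_le hA.1.1 (by
    rw [Subgroup.zpowers_le]; exact hxC.1), hcomm, hnorm⟩ le_sup_left
  exact hxA (h8 (Subgroup.mem_sup_right (Subgroup.mem_zpowers x)))

theorem Wz_ne_bot {S : Subgroup G} (hS : IsPGroup p S) (h : S ≠ ⊥) : Wz S ≠ ⊥ := by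
  intro hW
  obtain ⟨x, hxS, hx1, hx⟩ := exists_central_mod (A := ⊥) (C := S) hS (bot_lt_iff_ne_bot.2 h) le_rfl
    (by intro s _; apply mem_normalizer_of_conj; simp) Subgroup.le_normalizer
  have hxc : ∀ s ∈ S, s * x = x * s := by
    intro s hs
    have := hx s hs
    rw [Subgroup.mem_bot, mul_inv_eq_one, mul_inv_eq_iff_eq_mul] at this
    exact this
  have hz : Subgroup.zpowers x ≤ S ⊓ Subgroup.centralizer (S : Set G) := by
    rw [Subgroup.zpowers_le]
    exact ⟨hxS, Subgroup.mem_centralizer_iff.2 hxc⟩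
  have h1 : Subgroup.zpowers x ≤ Pu S := by
    apply le_Pu (hz.trans inf_le_left)
    · intro a ha b hb
      exact Subgroup.mem_centralizer_iff.1 (hz hb).2 a (hz ha).1
    · intro s hs
      apply mem_normalizer_of_conj
      intro a ha
      have := Subgroup.mem_centralizer_iff.1 (hz ha).2 s hs
      rw [this]; simpa using ha
  have h2 : x ∈ Wz S := by
    refine ⟨h1 (Subgroup.mem_zpowers x), ?_⟩
    apply Subgroup.mem_centralizer_iff.2
    exact fun s hs => hxc s (Pu_le S hs)
  rw [hW] at h2
  exact hx1 h2

end puig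

section zl

variable {p : ℕ} [Fact p.Prime]

theorem exists_pp (p : ℕ) [Fact p.Prime] {G : Type*} [Group G] [Finite G] (g : G) :
    ∃ i j : ℕ, (∃ k, (g ^ i) ^ p ^ k = 1) ∧ (∃ m : ℕ, m.Coprime p ∧ (g ^ j) ^ m = 1) ∧
      g ^ i * g ^ j = g := by
  have hp : p.Prime := Fact.out
  have hn : orderOf g ≠ 0 := (orderOf_pos g).ne'
  obtain ⟨k, m, hm, hk⟩ := Nat.exists_eq_pow_mul_and_not_dvd hn p hp.ne_one
  have hcop : (p ^ k).Coprime m := Nat.Coprime.pow_left _ ((Nat.Prime.coprime_iff_not_dvd hp).2 hm)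
  obtain ⟨i, hi1, hi2⟩ := Nat.chineseRemainder hcop 1 0
  obtain ⟨j, hj1, hj2⟩ := Nat.chineseRemainder hcop 0 1
  refine ⟨i, j, ⟨k, ?_⟩, ⟨m, ((Nat.Prime.coprime_iff_not_dvd hp).2 hm).symm, ?_⟩, ?_⟩
  · rw [← pow_mul]
    apply orderOf_dvd_iff_pow_eq_one.1
    rw [hk, mul_comm]
    exact Nat.mul_dvd_mul (Nat.modEq_zero_iff_dvd.1 hi2) dvd_rfl
  · rw [← pow_mul]
    apply orderOf_dvd_iff_pow_eq_one.1
    rw [hk]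
    exact Nat.mul_dvd_mul (Nat.modEq_zero_iff_dvd.1 hj1) dvd_rfl
  · rw [← pow_add]
    conv_rhs => rw [← pow_one g]
    rw [pow_eq_pow_iff_modEq, hk]
    rw [← Nat.modEq_and_modEq_iff_modEq_mul hcop]
    exact ⟨by simpa using hi1.add hj1, by simpa using hi2.add hj2⟩

theorem eq_one_of_coprime_pow {G : Type*} [Group G] {z : G} {m n : ℕ} (h : m.Coprime n)
    (h1 : z ^ m = 1) (h2 : z ^ n = 1) : z = 1 := by
  have := Nat.dvd_gcd (orderOf_dvd_of_pow_eq_one h1) (orderOf_dvd_of_pow_eq_one h2)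
  rw [h.gcd_eq_one, Nat.dvd_one, orderOf_eq_one_iff] at this
  exact this

theorem coprime_stab {G : Type*} [Group G] {c t : G} {m : ℕ} (hc : c ^ m = 1)
    (hm : m.Coprime p) (hz : c * (c * t * c⁻¹ * t⁻¹) = (c * t * c⁻¹ * t⁻¹) * c)
    (hzp : ∃ k, (c * t * c⁻¹ * t⁻¹) ^ p ^ k = 1) : c * t = t * c := by
  set z := c * t * c⁻¹ * t⁻¹ with hzd
  have h1 : ∀ j : ℕ, c ^ j * t * (c ^ j)⁻¹ = z ^ j * t := by
    intro j
    induction j with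
    | zero => simp
    | succ j ih =>
      have h2 : c * z ^ j = z ^ j * c := (Commute.pow_right (show Commute c z from hz) j).eq
      calc c ^ (j+1) * t * (c ^ (j+1))⁻¹ = c * (c ^ j * t * (c ^ j)⁻¹) * c⁻¹ := by
            rw [pow_succ']; group
        _ = c * z ^ j * t * c⁻¹ := by rw [ih]; group
        _ = z ^ j * (z * t) := by rw [h2, hzd]; group
        _ = z ^ (j+1) * t := by rw [pow_succ]; group
  have h3 := h1 m
  rw [hc] at h3
  have h4 : z ^ m = 1 := by simpa using h3
  obtain ⟨k, hk⟩ := hzp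
  have h5 : z = 1 := eq_one_of_coprime_pow (hm.pow_right k) h4 hk
  rw [hzd, mul_inv_eq_one, mul_inv_eq_iff_eq_mul] at h5
  exact h5

theorem sup_syl {G : Type*} [Group G] [Finite G] {C D S : Subgroup G} (hCD : C ≤ D)
    (hDC : D ≤ Subgroup.normalizer (C : Set G))
    (hpow : ∀ d ∈ D, ∃ k, d ^ p ^ k ∈ C) (hS : IsSyl p S D) : D ≤ C ⊔ S := by
  obtain ⟨P, hP⟩ := hS.exists_sylow
  have hN : (C.subgroupOf D).Normal := Subgroup.normal_subgroupOf_iff_le_normalizer hCD |>.2 hDC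
  have hQ : IsPGroup p (D ⧸ C.subgroupOf D) := by
    intro q
    obtain ⟨d, rfl⟩ := QuotientGroup.mk_surjective q
    obtain ⟨k, hk⟩ := hpow d d.2
    refine ⟨k, ?_⟩
    rw [← QuotientGroup.mk_pow]
    exact (QuotientGroup.eq_one_iff (N := C.subgroupOf D) (d ^ p ^ k)).2 hk
  obtain ⟨n, hn⟩ := IsPGroup.iff_card.1 hQ
  have h1 : ((C ⊔ S).subgroupOf D).index ∣ p ^ n := by
    rw [← hn]
    exact Subgroup.index_dvd_of_le (Subgroup.comap_mono le_sup_left)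
  have h2 : ¬ p ∣ ((C ⊔ S).subgroupOf D).index := by
    intro h3
    apply P.not_dvd_index
    refine h3.trans (Subgroup.index_dvd_of_le ?_)
    rw [hP]
    exact Subgroup.comap_mono le_sup_right
  obtain ⟨k, _, hk⟩ := (Nat.dvd_prime_pow Fact.out).1 h1
  have h4 : ((C ⊔ S).subgroupOf D).index = 1 := by
    rcases Nat.eq_zero_or_pos k with h0 | h0
    · simpa [h0] using hk
    · exact absurd (hk ▸ dvd_pow_self p h0.ne') h2
  rw [Subgroup.index_eq_one] at h4
  exact Subgroup.subgroupOf_eq_top.1 h4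

theorem exists_pCore (p : ℕ) [Fact p.Prime] (G : Type*) [Group G] [Finite G] :
    ∃ T : Subgroup G, T.Normal ∧ IsPGroup p T ∧ ∀ N : Subgroup G, N.Normal → IsPGroup p N → N ≤ T := by
  obtain ⟨T, hT⟩ := (Set.toFinite {T : Subgroup G | T.Normal ∧ IsPGroup p T}).exists_maximal
    ⟨⊥, inferInstance, IsPGroup.of_bot⟩
  refine ⟨T, hT.1.1, hT.1.2, fun N hN hNp => ?_⟩
  have := hT.1.1
  have h := hT.2 (y := T ⊔ N) ⟨inferInstance, IsPGroup.to_sup_of_normal_right hT.1.2 hNp⟩ le_sup_left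
  exact le_sup_right.trans h

theorem isPGroup_of_pow_mem {G : Type*} [Group G] {C N : Subgroup G} (hC : IsPGroup p C)
    (h : ∀ n ∈ N, ∃ j, n ^ p ^ j ∈ C) : IsPGroup p N := by
  rintro ⟨n, hn⟩
  obtain ⟨j, hj⟩ := h n hn
  obtain ⟨k, hk⟩ := hC ⟨_, hj⟩
  refine ⟨j + k, ?_⟩
  apply Subtype.ext
  have := congrArg Subtype.val hk
  simpa [pow_add, pow_mul] using this

theorem IsPGroup.exists_pow {G : Type*} [Group G] {P : Subgroup G} (h : IsPGroup p P) {x : G}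
    (hx : x ∈ P) : ∃ k, x ^ p ^ k = 1 := by
  obtain ⟨k, hk⟩ := h ⟨x, hx⟩
  exact ⟨k, by simpa using congrArg Subtype.val hk⟩

/-- if all `p'`-elements are trivial, it is a `p`-group. -/
theorem isPGroup_of_coprime {G : Type*} [Group G] [Finite G] {C : Subgroup G}
    (h : ∀ c ∈ C, ∀ m : ℕ, m.Coprime p → c ^ m = 1 → c = 1) : IsPGroup p C := by
  rintro ⟨c, hc⟩
  obtain ⟨i, j, ⟨k, hk⟩, ⟨m, hm, hm'⟩, h1⟩ := exists_pp p c
  rw [h _ (C.pow_mem hc j) m hm hm', mul_one] at h1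
  rw [h1] at hk
  exact ⟨k, Subtype.ext (by simpa using hk)⟩

theorem zl (hp2 : p ≠ 2) {G : Type} [Group G] [Finite G] (hodd : Odd (Nat.card G))
    (T : Subgroup G) [hTn : T.Normal] (hT : IsPGroup p T)
    (hmax : ∀ N : Subgroup G, N.Normal → IsPGroup p N → N ≤ T)
    (hC : Subgroup.centralizer (T : Set G) ≤ T) (S : Subgroup G) (hS : IsSyl p S ⊤) :
    (Wz S).Normal := by
  have hTS : T ≤ S := by
    obtain ⟨R, hR, hTR⟩ := hT.exists_isSyl le_top
    obtain ⟨x, _, hx⟩ := hS.conj_eq hR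
    intro t ht
    have := (hx (x⁻¹ * t * x)).1 (hTR (by simpa using hTn.conj_mem t ht x⁻¹))
    simpa [mul_assoc] using this
  have hUn : (Pu T).Normal := by
    rw [← Subgroup.normalizer_eq_top_iff, eq_top_iff]
    refine le_trans ?_ (Pu_normalizer T)
    rw [Subgroup.normalizer_eq_top_iff.2 hTn]
  have hZn : (Wz T).Normal := by
    rw [← Subgroup.normalizer_eq_top_iff, eq_top_iff]
    refine le_trans ?_ (Wz_normalizer T)
    rw [Subgroup.normalizer_eq_top_iff.2 hTn]
  have hUp : IsPGroup p (Pu T) := hT.to_le (Pu_le T)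
  have hZp : IsPGroup p (Wz T) := hT.to_le (Wz_le T)
  -- (i)
  have hCUp : IsPGroup p (Subgroup.centralizer (Pu T : Set G)) := by
    apply isPGroup_of_coprime
    intro c hc m hm hcm
    have hcT : c ∈ Subgroup.centralizer (T : Set G) := by
      rw [Subgroup.mem_centralizer_iff]
      intro t ht
      have h1 : c * t * c⁻¹ * t⁻¹ ∈ T :=
        T.mul_mem (hTn.conj_mem t ht c) (T.inv_mem ht)
      have h2 : c * t * c⁻¹ * t⁻¹ ∈ Subgroup.centralizer (Pu T : Set G) := by
        have : (Subgroup.centralizer (Pu T : Set G)).Normal := inferInstance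
        have h3 := this.conj_mem c⁻¹ (inv_mem hc) t
        have h4 := mul_mem hc h3
        convert h4 using 1; group
      have h3 : c * t * c⁻¹ * t⁻¹ ∈ Pu T := centralizer_Pu_le hT ⟨h1, h2⟩
      exact (coprime_stab hcm hm (Subgroup.mem_centralizer_iff.1 hc _ h3).symm
        (hT.exists_pow h1)).symm
    obtain ⟨k, hk⟩ := hT.exists_pow (hC hcT)
    exact eq_one_of_coprime_pow (hm.pow_right k) hcm hk
  have hCU : Subgroup.centralizer (Pu T : Set G) ≤ Pu T := by
    have h1 : Subgroup.centralizer (Pu T : Set G) ≤ T := hmax _ inferInstance hCUp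
    exact fun c hc => centralizer_Pu_le hT ⟨h1 hc, hc⟩
  -- quadratic action
  have hquad : ∀ (U A : Subgroup G), U ≤ Subgroup.normalizer (A : Set G) →
      (∀ a ∈ A, ∀ b ∈ A, a * b = b * a) → ∀ a ∈ A, ∀ u ∈ U,
      a * (a * u * a⁻¹ * u⁻¹) = (a * u * a⁻¹ * u⁻¹) * a := by
    intro U A hUA hA a ha u hu
    apply hA a ha
    have := (Subgroup.mem_normalizer_iff.1 (hUA hu) a⁻¹).1 (A.inv_mem ha)
    have := A.mul_mem ha this
    convert this using 1; group
  -- (ii)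
  have h2 : ∀ A : Subgroup G, A ≤ S → (∀ a ∈ A, ∀ b ∈ A, a * b = b * a) →
      Pu T ≤ Subgroup.normalizer (A : Set G) → A ≤ T := by
    intro A hAS hA hUA a ha
    obtain ⟨N, hN, haN, _, hNp⟩ := stab hp2 hodd (Pu T) hUp a (hS.2.1.exists_pow (hAS ha))
      (hquad _ A hUA hA a ha)
    exact hmax N hN (isPGroup_of_pow_mem hCUp hNp) haN
  -- (iii)
  have h3 : PL S (Pu T) ≤ Pst T := by
    rw [← PL_Pu]
    apply sSup_le
    intro A hA
    exact le_PL (h2 A hA.1 hA.2.1 hA.2.2) hA.2.1 hA.2.2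
  have h4 : Pst S ≤ Pst T := by
    apply Pst_le_of
    exact (PL_anti S (PL_mono hTS (Pst T))).trans h3
  have h5 : Pu T ≤ Pu S := (PL_mono hTS _).trans (PL_anti S h4)
  -- (iv)
  have hVZ : Wz S ≤ Wz T := by
    intro v hv
    have h6 : v ∈ Subgroup.centralizer (Pu T : Set G) := Subgroup.centralizer_le h5 hv.2
    exact ⟨hCU h6, h6⟩
  -- (v)
  have hZS : Wz T ≤ Pst S := le_Pst ((Wz_le T).trans hTS) (Wz_comm T)
    (by rw [Subgroup.normalizer_eq_top_iff.2 hZn]; exact le_top)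
  set C := Subgroup.centralizer (Wz T : Set G) with hCdef
  have hCn : C.Normal := inferInstance
  obtain ⟨E, hEn, hEp, hEmax⟩ := exists_pCore p (G ⧸ C)
  set D := E.comap (QuotientGroup.mk' C) with hD
  have hDn : D.Normal := hEn.comap _
  have hCD : C ≤ D := by
    intro c hc
    change QuotientGroup.mk' C c ∈ E
    rw [show QuotientGroup.mk' C c = 1 from (QuotientGroup.eq_one_iff c).2 hc]
    exact one_mem E
  have hDp : ∀ d ∈ D, ∃ k, d ^ p ^ k ∈ C := by
    intro d hd
    obtain ⟨k, hk⟩ := hEp.exists_pow hd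
    refine ⟨k, (QuotientGroup.eq_one_iff _).1 ?_⟩
    rw [← map_pow] at hk
    exact hk
  have hPD : Pu S ≤ D := by
    apply sSup_le
    intro A hA a ha
    obtain ⟨N, hN, haN, _, hNp⟩ := stab hp2 hodd (Wz T) hZp a (hS.2.1.exists_pow (hA.1 ha))
      (hquad _ A (hZS.trans hA.2.2) hA.2.1 a ha)
    apply hEmax (N.map (QuotientGroup.mk' C)) (hN.map _ (QuotientGroup.mk'_surjective C)) ?_
      ⟨a, haN, rfl⟩
    rintro ⟨_, n, hn, rfl⟩
    obtain ⟨j, hj⟩ := hNp n hn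
    refine ⟨j, Subtype.ext ?_⟩
    change QuotientGroup.mk' C n ^ p ^ j = 1
    rw [← map_pow]
    exact (QuotientGroup.eq_one_iff _).2 hj
  have hS1 : IsSyl p (S ⊓ D) D := hS.inf_normal le_top
    (by rw [Subgroup.normalizer_eq_top_iff.2 hDn])
  have hDle := sup_syl hCD (by rw [Subgroup.normalizer_eq_top_iff.2 hCn]; exact le_top) hDp hS1
  have hPu : Pu (S ⊓ D) = Pu S := Pu_eq_of_le (le_inf (Pu_le S) hPD) inf_le_left
  have hWz : Wz (S ⊓ D) = Wz S := by unfold Wz; rw [hPu]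
  have hN1 : Subgroup.normalizer ((S ⊓ D : Subgroup G) : Set G) ≤
      Subgroup.normalizer (Wz S : Set G) := by
    rw [← hWz]; exact Wz_normalizer _
  have hDV : D ≤ Subgroup.normalizer (Wz S : Set G) := by
    refine hDle.trans (sup_le ?_ (Subgroup.le_normalizer.trans hN1))
    intro c hc
    apply mem_normalizer_of_conj
    intro v hv
    have := Subgroup.mem_centralizer_iff.1 hc v (hVZ hv)
    rw [← this]; simpa using hv
  rw [← Subgroup.normalizer_eq_top_iff, eq_top_iff]
  intro g _
  obtain ⟨n, hn, hng⟩ := hS1.frattini (g := g) (by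
    rw [Subgroup.normalizer_eq_top_iff.2 hDn]; trivial)
  have := mul_mem (inv_mem (hDV hn)) (hN1 hng)
  simpa using this

end zl

section cj

variable {G : Type*} [Group G]

/-- conjugate subgroup -/
def cj (g : G) (A : Subgroup G) : Subgroup G := A.map (MulAut.conj g).toMonoidHom

theorem mem_cj {g x : G} {A : Subgroup G} : x ∈ cj g A ↔ g⁻¹ * x * g ∈ A := by
  constructor
  · rintro ⟨a, ha, rfl⟩
    simpa [mul_assoc] using ha
  · intro h
    exact ⟨_, h, by simp [mul_assoc]⟩

theorem conj_mem_cj {g a : G} {A : Subgroup G} : g * a * g⁻¹ ∈ cj g A ↔ a ∈ A := by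
  rw [mem_cj]; simp [mul_assoc]

theorem cj_le {g : G} {A B : Subgroup G} : cj g A ≤ B ↔ ∀ a ∈ A, g * a * g⁻¹ ∈ B := by
  constructor
  · intro h a ha; exact h ⟨a, ha, rfl⟩
  · rintro h _ ⟨a, ha, rfl⟩; exact h a ha

theorem cj_mul (g h : G) (A : Subgroup G) : cj (g * h) A = cj g (cj h A) := by
  ext x; simp [mem_cj, mul_assoc]

theorem cj_one (A : Subgroup G) : cj 1 A = A := by
  ext x; simp [mem_cj]

theorem cj_inv_cj (g : G) (A : Subgroup G) : cj g⁻¹ (cj g A) = A := by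
  rw [← cj_mul, inv_mul_cancel, cj_one]

theorem cj_mono {g : G} {A B : Subgroup G} (h : A ≤ B) : cj g A ≤ cj g B := Subgroup.map_mono h

theorem card_cj (g : G) (A : Subgroup G) : Nat.card (cj g A) = Nat.card A :=
  (Nat.card_congr (A.equivMapOfInjective _ (MulAut.conj g).injective).toEquiv).symm

theorem cj_normalizer (g : G) (A : Subgroup G) :
    Subgroup.normalizer (cj g A : Set G) = cj g (Subgroup.normalizer (A : Set G)) := by
  ext x
  rw [mem_cj, Subgroup.mem_normalizer_iff, Subgroup.mem_normalizer_iff]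
  constructor
  · intro h a
    have := h (g * a * g⁻¹)
    rw [conj_mem_cj, mem_cj] at this
    rw [this]
    simp [mul_assoc]
  · intro h a
    have := h (g⁻¹ * a * g)
    rw [mem_cj, this, mem_cj]
    simp [mul_assoc]

variable [Finite G]

theorem cj_eq_iff {g : G} {A : Subgroup G} :
    cj g A = A ↔ g ∈ Subgroup.normalizer (A : Set G) := map_conj_eq_iff

theorem cj_eq_of_le {g : G} {A B : Subgroup G} (h : cj g A ≤ B) (h' : Nat.card A = Nat.card B) :
    cj g A = B :=
  Subgroup.eq_of_le_of_card_ge h (by rw [card_cj, h'])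

theorem Wz_cj (g : G) (A : Subgroup G) : cj g (Wz A) = Wz (cj g A) :=
  Wz_map _ (MulAut.conj g).injective.injOn

theorem IsSyl.cj {p : ℕ} {S X : Subgroup G} (h : IsSyl p S X) (g : G) :
    IsSyl p (cj g S) (cj g X) := by
  refine ⟨cj_mono h.1, h.2.1.map _, ?_⟩
  intro Q hQ hQX hSQ
  have h1 := h.2.2 (_root_.cj g⁻¹ Q) (hQ.map _) (by
    have := cj_mono (g := g⁻¹) hQX
    rwa [cj_inv_cj] at this) (by
    have := cj_mono (g := g⁻¹) hSQ
    rwa [cj_inv_cj] at this)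
  have := cj_mono (g := g) h1
  rwa [← cj_mul, mul_inv_cancel, cj_one] at this

/-- `g` acts on `A` like some element of `M` -/
def Good (M A : Subgroup G) (g : G) : Prop := ∃ m ∈ M, ∀ a ∈ A, m * a * m⁻¹ = g * a * g⁻¹

end cj

section cj2

variable {G : Type*} [Group G]

theorem Good.mono {M A B : Subgroup G} {g : G} (h : Good M A g) (hB : B ≤ A) : Good M B g := by
  obtain ⟨m, hm, h⟩ := h
  exact ⟨m, hm, fun a ha => h a (hB ha)⟩

theorem Good.monoM {M M' A : Subgroup G} {g : G} (h : Good M A g) (hB : M ≤ M') : Good M' A g := by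
  obtain ⟨m, hm, h⟩ := h
  exact ⟨m, hB hm, h⟩

theorem Good.of_mem {M : Subgroup G} (A : Subgroup G) {g : G} (h : g ∈ M) : Good M A g :=
  ⟨g, h, fun _ _ => rfl⟩

theorem Good.congr {M A : Subgroup G} {g g' : G} (h : Good M A g)
    (h' : ∀ a ∈ A, g * a * g⁻¹ = g' * a * g'⁻¹) : Good M A g' := by
  obtain ⟨m, hm, h⟩ := h
  exact ⟨m, hm, fun a ha => (h a ha).trans (h' a ha)⟩

theorem Good.comp {M A : Subgroup G} {g h : G} (h1 : Good M A g) (h2 : Good M (cj g A) h) :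
    Good M A (h * g) := by
  obtain ⟨m, hm, h1⟩ := h1
  obtain ⟨m', hm', h2⟩ := h2
  refine ⟨m' * m, M.mul_mem hm' hm, fun a ha => ?_⟩
  calc m' * m * a * (m' * m)⁻¹ = m' * (m * a * m⁻¹) * m'⁻¹ := by group
    _ = m' * (g * a * g⁻¹) * m'⁻¹ := by rw [h1 a ha]
    _ = h * (g * a * g⁻¹) * h⁻¹ := h2 _ (conj_mem_cj.2 ha)
    _ = _ := by group

theorem Good.inv {M A : Subgroup G} {g : G} (h1 : Good M A g) : Good M (cj g A) g⁻¹ := by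
  obtain ⟨m, hm, h1⟩ := h1
  refine ⟨m⁻¹, M.inv_mem hm, ?_⟩
  rintro _ ⟨a, ha, rfl⟩
  change m⁻¹ * (g * a * g⁻¹) * m⁻¹⁻¹ = g⁻¹ * (g * a * g⁻¹) * g⁻¹⁻¹
  calc m⁻¹ * (g * a * g⁻¹) * m⁻¹⁻¹ = m⁻¹ * (m * a * m⁻¹) * m⁻¹⁻¹ := by rw [h1 a ha]
    _ = _ := by group

/-- the subgroup of good elements -/
def GoodSub [Finite G] (M A : Subgroup G) : Subgroup G where
  carrier := {g | g ∈ Subgroup.normalizer (A : Set G) ∧ Good M A g}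
  one_mem' := ⟨one_mem _, Good.of_mem A (one_mem M)⟩
  mul_mem' := by
    rintro a b ⟨ha, ha'⟩ ⟨hb, hb'⟩
    refine ⟨mul_mem ha hb, hb'.comp ?_⟩
    rwa [cj_eq_iff.2 hb]
  inv_mem' := by
    rintro a ⟨ha, ha'⟩
    refine ⟨inv_mem ha, ?_⟩
    have := ha'.inv
    rwa [cj_eq_iff.2 ha] at this

theorem Good.sub {M A : Subgroup G} [Finite G] {g : G} (h : Good M A g)
    (h' : g ∈ Subgroup.normalizer (A : Set G)) : g ∈ GoodSub M A := ⟨h', h⟩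

end cj2

section cf

variable {p : ℕ} [Fact p.Prime] {G : Type} [Group G] [Finite G]

theorem alp {P : Subgroup G} (hP : IsSyl p P ⊤) (M : Subgroup G)
    (H : ∀ A ≤ P, IsSyl p (P ⊓ Subgroup.normalizer (A : Set G)) (Subgroup.normalizer (A : Set G)) →
      (∀ B ≤ P, Nat.card A < Nat.card B → ∀ g, cj g B ≤ P → Good M B g) →
      ∀ n ∈ Subgroup.normalizer (A : Set G), Good M A n) :
    ∀ A ≤ P, ∀ g, cj g A ≤ P → Good M A g := by
  suffices h : ∀ d : ℕ, ∀ A ≤ P, Nat.card P ≤ Nat.card A + d → ∀ g, cj g A ≤ P → Good M A g from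
    fun A hA => h (Nat.card P) A hA (by omega)
  intro d
  induction d with
  | zero =>
    intro A hA hc g hg
    have hAP : A = P := Subgroup.eq_of_le_of_card_ge hA hc
    subst hAP
    have hg' : g ∈ Subgroup.normalizer (A : Set G) := mem_normalizer_of_conj (cj_le.1 hg)
    refine H A le_rfl ?_ ?_ g hg'
    · rw [inf_eq_left.2 Subgroup.le_normalizer]
      exact hP.mono le_top Subgroup.le_normalizer
    · intro B hB hB'
      have := Subgroup.card_le_of_le hB
      omega
  | succ d ih =>
    intro A hA hc g hg
    by_cases hAd : Nat.card P ≤ Nat.card A + d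
    · exact ih A hA hAd g hg
    have hbig : ∀ B ≤ P, Nat.card A < Nat.card B → ∀ g, cj g B ≤ P → Good M B g := by
      intro B hB hB'
      exact ih B hB (by omega)
    have hAp : IsPGroup p A := hP.2.1.to_le hA
    obtain ⟨R, hR, hAR⟩ := hAp.exists_isSyl (Subgroup.le_normalizer (H := A))
    obtain ⟨h, _, hh⟩ := hP.conj_le hR.2.1 le_top
    have hRP : cj h R ≤ P := cj_le.2 hh
    set A' := cj h A with hA'
    have hA'P : A' ≤ P := (cj_mono hAR).trans hRP
    have hcA' : Nat.card A' = Nat.card A := card_cj _ _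
    have hfn : IsSyl p (P ⊓ Subgroup.normalizer (A' : Set G)) (Subgroup.normalizer (A' : Set G)) := by
      have h1 := hR.cj h
      rw [← cj_normalizer] at h1
      have h2 : cj h R ≤ P ⊓ Subgroup.normalizer (A' : Set G) := le_inf hRP h1.1
      have h3 := h1.2.2 _ hP.2.1.to_inf_left inf_le_right h2
      rwa [le_antisymm h2 h3] at h1
    have hA'good := H A' hA'P hfn (by rw [hcA']; exact hbig)
    -- claim
    have claim : ∀ B ≤ P, Nat.card B = Nat.card A → ∀ c, cj c B = A' → ∃ k, cj k B = A' ∧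
        Good M B k := by
      intro B hB hBc c hc
      have hBP : B < P := lt_of_le_of_ne hB (by rintro rfl; omega)
      have hlt := exists_mem_normalizer_of_lt hP.2.1 hBP
      set Q := P ⊓ Subgroup.normalizer (B : Set G) with hQ
      have hQp : IsPGroup p Q := hP.2.1.to_inf_left
      obtain ⟨x, hx, hx'⟩ := hfn.conj_le (Q := cj c Q) (hQp.map _) (by
        rw [← hc, cj_normalizer]; exact cj_mono inf_le_right)
      refine ⟨x * c, ?_, ?_⟩
      · rw [cj_mul, hc, cj_eq_iff]; exact hx
      · refine (hbig Q inf_le_left ?_ (x * c) ?_).mono hlt.le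
        · have := Set.ncard_lt_ncard (SetLike.coe_ssubset_coe.2 hlt)
          rw [← Nat.card_coe_set_eq, ← Nat.card_coe_set_eq] at this
          rw [← hBc]; exact this
        · rw [cj_mul]
          exact (cj_le.2 hx').trans inf_le_left
    obtain ⟨k1, hk1, hg1⟩ := claim A hA rfl h rfl
    obtain ⟨k2, hk2, hg2⟩ := claim (cj g A) hg (card_cj _ _) (h * g⁻¹) (by rw [cj_mul, cj_inv_cj])
    have hn : k2 * g * k1⁻¹ ∈ Subgroup.normalizer (A' : Set G) := by
      rw [← cj_eq_iff, cj_mul, ← hk1, cj_inv_cj, cj_mul, hk2, hk1]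
    have hgn := hA'good _ hn
    have e1 : Good M A (k2 * g * k1⁻¹ * k1) := hg1.comp (by rwa [hk1])
    have e2 : Good M A (k2⁻¹ * (k2 * g * k1⁻¹ * k1)) := by
      apply e1.comp
      have := hg2.inv
      rw [← cj_mul] at this
      simpa using this
    simpa [mul_assoc] using e2

/-- control of fusion by normalizer of `Wz` -/
def CF (p : ℕ) (X : Subgroup G) : Prop := ∀ S A : Subgroup G, ∀ g : G, IsSyl p S X → A ≤ S →
  g ∈ X → cj g A ≤ S → Good (X ⊓ Subgroup.normalizer (Wz S : Set G)) A g

theorem CF_of_top (X : Subgroup G) (h : CF p (⊤ : Subgroup X)) : CF p X := by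
  intro S A g hS hA hg hgA
  obtain ⟨P, hP⟩ := hS.exists_sylow
  have h1 := P.isSyl
  rw [hP] at h1
  obtain ⟨m, hm, hm'⟩ := h (S.subgroupOf X) (A.subgroupOf X) ⟨g, hg⟩ h1 (Subgroup.comap_mono hA)
    trivial (by
      rw [cj_le]
      intro a ha
      exact (cj_le.1 hgA) a ha)
  have hW : (Wz (S.subgroupOf X)).map X.subtype = Wz S := by
    rw [Wz_map _ X.subtype_injective.injOn, Subgroup.map_subgroupOf_eq_of_le hS.1]
  refine ⟨m, ⟨m.2, ?_⟩, ?_⟩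
  · rw [← hW]
    apply mem_normalizer_of_conj
    rintro _ ⟨w, hw, rfl⟩
    exact ⟨m * w * m⁻¹, (Subgroup.mem_normalizer_iff.1 hm.2 w).1 hw, rfl⟩
  · intro a ha
    have := hm' ⟨a, hS.1 (hA ha)⟩ ha
    exact congrArg Subtype.val this

end cf

section cf

open scoped Pointwise

variable {p : ℕ} [Fact p.Prime] {G : Type} [Group G] [Finite G]

theorem card_lt_of_lt' {A B : Subgroup G} (h : A < B) : Nat.card A < Nat.card B := by
  have := Set.ncard_lt_ncard (SetLike.coe_ssubset_coe.2 h)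
  rwa [← Nat.card_coe_set_eq, ← Nat.card_coe_set_eq] at this

theorem cf_case1 (hcore : ∀ N : Subgroup G, N.Normal → IsPGroup p N → N = ⊥)
    (IH : ∀ X : Subgroup G, X < ⊤ → CF p X) : CF p (⊤ : Subgroup G) := by
  intro P A0 g0 hP hA0 _ hg0
  refine alp hP _ ?_ A0 hA0 g0 hg0
  intro A hA hfn hbig n hn
  by_cases hA1 : A = ⊥
  · refine ⟨1, one_mem _, ?_⟩
    intro a ha
    rw [hA1, Subgroup.mem_bot] at ha
    simp [ha]
  have hlt : ∀ B : Subgroup G, IsPGroup p B → B ≠ ⊥ → Subgroup.normalizer (B : Set G) < ⊤ := by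
    intro B hB hB1
    rw [lt_top_iff_ne_top, Ne, Subgroup.normalizer_eq_top_iff]
    exact fun h => hB1 (hcore B h hB)
  have claim : ∀ d : ℕ, ∀ S ≤ P, Nat.card P ≤ Nat.card S + d → ∀ B ≤ S, Nat.card B = Nat.card A →
      ∀ m ∈ Subgroup.normalizer (Wz S : Set G), cj m B ≤ S →
      Good (⊤ ⊓ Subgroup.normalizer (Wz P : Set G)) B m := by
    intro d
    induction d with
    | zero =>
      intro S hS hc B hB hBA m hm hmB
      have : S = P := Subgroup.eq_of_le_of_card_ge hS hc
      subst this
      exact Good.of_mem _ ⟨trivial, hm⟩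
    | succ d ih =>
      intro S hS hc B hB hBA m hm hmB
      by_cases hd : Nat.card P ≤ Nat.card S + d
      · exact ih S hS hd B hB hBA m hm hmB
      have hSP : S < P := lt_of_le_of_ne hS (by rintro rfl; omega)
      have hSp : IsPGroup p S := hP.2.1.to_le hS
      have hS1 : S ≠ ⊥ := by
        rintro rfl
        apply hA1
        have : B = ⊥ := le_bot_iff.1 hB
        rw [← Subgroup.card_eq_one, ← hBA, this, Subgroup.card_bot]
      have hG1 := IH _ (hlt (Wz S) (hSp.to_le (Wz_le S)) (Wz_ne_bot hSp hS1))
      set G1 := Subgroup.normalizer (Wz S : Set G) with hG1d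
      have hR := exists_mem_normalizer_of_lt hP.2.1 hSP
      set R := P ⊓ Subgroup.normalizer (S : Set G) with hRd
      have hRp : IsPGroup p R := hP.2.1.to_inf_left
      have hRG : R ≤ G1 := inf_le_right.trans (Wz_normalizer S)
      obtain ⟨P1, hP1, hRP1⟩ := hRp.exists_isSyl hRG
      obtain ⟨m', ⟨hm'1, hm'2⟩, hm'⟩ := hG1 P1 B m hP1 ((hB.trans hR.le).trans hRP1) hm
        ((hmB.trans hR.le).trans hRP1)
      have hcj : cj m' B = cj m B := by
        apply le_antisymm
        · rw [cj_le]; intro b hb; rw [hm' b hb]; exact conj_mem_cj.2 hb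
        · rw [cj_le]; intro b hb; rw [← hm' b hb]; exact conj_mem_cj.2 hb
      refine Good.congr (g := m') ?_ hm'
      obtain ⟨h, _, hh⟩ := hP.conj_le hP1.2.1 le_top
      have hhP : cj h P1 ≤ P := cj_le.2 hh
      have hgR := hbig R inf_le_left (by
        have := Subgroup.card_le_of_le hB
        have := card_lt_of_lt' hR
        omega) h ((cj_mono hRP1).trans hhP)
      have hBR : B ≤ R := hB.trans hR.le
      have hn3 := ih (cj h P1) hhP (by
        have := card_lt_of_lt' hR
        have := Subgroup.card_le_of_le hRP1
        rw [card_cj]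
        omega) (cj h B) (cj_mono (hBR.trans hRP1)) (by rw [card_cj, hBA]) (h * m' * h⁻¹) (by
          rw [← Wz_cj, cj_normalizer, mem_cj]
          simpa [mul_assoc] using hm'2) (by
          rw [cj_mul, cj_inv_cj, cj_mul, hcj]
          exact cj_mono ((hmB.trans hR.le).trans hRP1))
      have e1 := (hgR.mono hBR).comp hn3
      have e2 : Good (⊤ ⊓ Subgroup.normalizer (Wz P : Set G)) B (h⁻¹ * (h * m' * h⁻¹ * h)) := by
        apply e1.comp
        have := (hgR.mono (hmB.trans hR.le)).inv
        rw [← hcj, ← cj_mul] at this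
        simpa [mul_assoc] using this
      simpa [mul_assoc] using e2
  have hX := IH _ (hlt A (hP.2.1.to_le hA) hA1)
  have hAS : A ≤ P ⊓ Subgroup.normalizer (A : Set G) := le_inf hA Subgroup.le_normalizer
  obtain ⟨n1, hn1, hn1'⟩ := hX _ A n hfn hAS hn (by rw [cj_eq_iff.2 hn]; exact hAS)
  refine Good.congr (g := n1) ?_ hn1'
  refine claim (Nat.card P) _ inf_le_left (by omega) A hAS rfl n1 hn1.2 ?_
  rw [cj_eq_iff.2 hn1.1]; exact hAS

theorem IsSyl.map_mk {P Y : Subgroup G} [Y.Normal] (hP : IsSyl p P ⊤) :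
    IsSyl p (P.map (QuotientGroup.mk' Y)) ⊤ := by
  obtain ⟨P', rfl⟩ := hP.exists_sylow_top
  exact (P'.mapSurjective (QuotientGroup.mk'_surjective Y)).isSyl

theorem mk_eq_iff {Y : Subgroup G} [Y.Normal] {a b : G} :
    QuotientGroup.mk' Y a = QuotientGroup.mk' Y b ↔ a⁻¹ * b ∈ Y := QuotientGroup.eq

theorem isPGroup_coprime_inf {A Y : Subgroup G} (hA : IsPGroup p A)
    (hY : (Nat.card Y).Coprime p) {x : G} (hx : x ∈ A) (hxY : x ∈ Y) : x = 1 := by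
  obtain ⟨k, hk⟩ := hA.exists_pow hx
  exact eq_one_of_coprime_pow (hY.pow_right k) (pow_card_of_mem hxY) hk

/-- a `p`-subgroup `B` is Sylow in `B ⊔ Y` -/
theorem isSyl_sup {B Y : Subgroup G} (hB : IsPGroup p B) (hY : (Nat.card Y).Coprime p)
    (hBY : B ≤ Subgroup.normalizer (Y : Set G)) : IsSyl p B (B ⊔ Y) := by
  refine ⟨le_sup_left, hB, ?_⟩
  intro Q hQ hQX hBQ q hq
  have h1 := hQX hq
  have h2 : (↑(B ⊔ Y) : Set G) = (B : Set G) * (Y : Set G) := Subgroup.coe_mul_of_left_le_normalizer_right B Y hBY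
  have h3 : q ∈ ((B : Set G) * (Y : Set G)) := by rw [← h2]; exact h1
  obtain ⟨b, hb, y, hy, rfl⟩ := h3
  have h4 : y ∈ Q := by
    have := mul_mem (inv_mem (hBQ hb)) hq
    simpa using this
  have := isPGroup_coprime_inf hQ hY h4 hy
  subst this
  simpa using hb

theorem cf_case2 (Y : Subgroup G) [hYn : Y.Normal] (hY : (Nat.card Y).Coprime p)
    (IH : CF p (⊤ : Subgroup (G ⧸ Y))) : CF p (⊤ : Subgroup G) := by
  intro P A g hP hA _ hg
  set π := QuotientGroup.mk' Y with hπ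
  have hinj : Set.InjOn π P := by
    intro a ha b hb hab
    have h1 := isPGroup_coprime_inf hP.2.1 hY (mul_mem (inv_mem ha) hb) (mk_eq_iff.1 hab)
    exact inv_mul_eq_one.1 h1
  have hW := Wz_map π hinj
  obtain ⟨n', ⟨_, hn'⟩, hn''⟩ := IH (P.map π) (A.map π) (π g) hP.map_mk (Subgroup.map_mono hA) trivial
    (by
      rw [cj_le]
      rintro _ ⟨a, ha, rfl⟩
      exact ⟨_, cj_le.1 hg a ha, by simp⟩)
  obtain ⟨n0, rfl⟩ := QuotientGroup.mk'_surjective Y n'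
  set W := Wz P with hWd
  have hWp : IsPGroup p W := hP.2.1.to_le (Wz_le P)
  have hWs : IsSyl p W (W ⊔ Y) := isSyl_sup hWp hY (by
    rw [Subgroup.normalizer_eq_top_iff.2 hYn]; exact le_top)
  have hn0 : n0 ∈ Subgroup.normalizer ((W ⊔ Y : Subgroup G) : Set G) := by
    have e : W ⊔ Y = (W.map π).comap π := by
      rw [Subgroup.comap_map_eq, QuotientGroup.ker_mk']
    rw [e]
    apply mem_normalizer_of_conj
    intro x hx
    change π (n0 * x * n0⁻¹) ∈ W.map π
    rw [map_mul, map_mul, map_inv, hW]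
    rw [Subgroup.mem_comap, hW] at hx
    exact (Subgroup.mem_normalizer_iff.1 hn' _).1 hx
  obtain ⟨x, hx, hxn⟩ := hWs.frattini hn0
  have hx' : x ∈ ((W : Set G) * (Y : Set G)) := by
    rw [← Subgroup.mul_normal W Y]; exact hx
  obtain ⟨w, hw, y, hy, rfl⟩ := hx'
  set N := Subgroup.normalizer (W : Set G) with hN
  have hn1 : y * n0 ∈ N := by
    have := mul_mem (inv_mem (Subgroup.le_normalizer (H := W) hw)) hxn
    simpa [mul_assoc] using this
  set n1 := y * n0 with hn1d
  have hπn1 : π n1 = π n0 := by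
    rw [hn1d, map_mul, show π y = 1 from (QuotientGroup.eq_one_iff y).2 hy, one_mul]
  have hagree : ∀ a ∈ A, π (n1 * a * n1⁻¹) = π (g * a * g⁻¹) := by
    intro a ha
    have := hn'' (π a) ⟨a, ha, rfl⟩
    rw [map_mul, map_mul, map_inv, hπn1, map_mul, map_mul, map_inv]
    exact this
  have hPN : P ≤ N := Subgroup.le_normalizer.trans (Wz_normalizer P)
  have hBp : IsPGroup p (cj g A) := hP.2.1.to_le hg
  have hcop : (Nat.card ↥(Y ⊓ N)).Coprime p :=
    hY.coprime_dvd_left (Subgroup.card_dvd_of_le inf_le_left)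
  have hBN : cj g A ≤ Subgroup.normalizer ((Y ⊓ N : Subgroup G) : Set G) := by
    intro b hb
    apply mem_normalizer_of_conj
    rintro z ⟨hz, hz'⟩
    exact ⟨hYn.conj_mem z hz b, N.mul_mem (N.mul_mem (hPN (hg hb)) hz') (N.inv_mem (hPN (hg hb)))⟩
  have hBs : IsSyl p (cj g A) (cj g A ⊔ (Y ⊓ N)) := isSyl_sup hBp hcop hBN
  obtain ⟨v, hv, hv'⟩ := hBs.conj_le (Q := cj n1 A) ((hP.2.1.to_le hA).map _) (by
    rw [cj_le]
    intro a ha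
    have h1 := mk_eq_iff.1 (hagree a ha).symm
    have h2 : n1 * a * n1⁻¹ = (g * a * g⁻¹) * ((g * a * g⁻¹)⁻¹ * (n1 * a * n1⁻¹)) := by group
    rw [h2]
    refine Subgroup.mul_mem_sup (conj_mem_cj.2 ha) ⟨h1, ?_⟩
    exact N.mul_mem (N.inv_mem (hPN (cj_le.1 hg a ha)))
      (N.mul_mem (N.mul_mem hn1 (hPN (hA ha))) (N.inv_mem hn1)))
  have hvm : v ∈ ((cj g A : Set G) * ((Y ⊓ N : Subgroup G) : Set G)) := by
    rw [← Subgroup.coe_mul_of_left_le_normalizer_right _ _ hBN]; exact hv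
  obtain ⟨b, hb, y', hy', rfl⟩ := hvm
  refine ⟨y' * n1, ⟨trivial, mul_mem hy'.2 hn1⟩, ?_⟩
  intro a ha
  have h1 : y' * (n1 * a * n1⁻¹) * y'⁻¹ ∈ cj g A := by
    have := hv' _ (conj_mem_cj.2 ha)
    have := mul_mem (mul_mem (inv_mem hb) this) hb
    simpa [mul_assoc] using this
  have h2 : y' * n1 * a * (y' * n1)⁻¹ = y' * (n1 * a * n1⁻¹) * y'⁻¹ := by group
  rw [h2]
  apply hinj (hg h1) (cj_le.1 hg a ha)
  rw [← hagree a ha, map_mul, map_mul, map_inv,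
    show π y' = 1 from (QuotientGroup.eq_one_iff y').2 hy'.1]
  simp

end cf

section cf3

open scoped Pointwise

variable {p : ℕ} [Fact p.Prime] {G : Type} [Group G] [Finite G]

theorem le_syl_of_normal {P T : Subgroup G} (hP : IsSyl p P ⊤) (hTn : T.Normal)
    (hT : IsPGroup p T) : T ≤ P := by
  have h := hP.2.2 (P ⊔ T) (IsPGroup.to_sup_of_normal_right hP.2.1 hT) le_top le_sup_left
  exact le_sup_right.trans h

theorem mem_of_coprime_pow {H : Subgroup G} {x : G} {m n : ℕ} (hmn : m.Coprime n)
    (h1 : x ^ m ∈ H) (h2 : x ^ n ∈ H) : x ∈ H := by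
  have h3 := Nat.gcd_eq_gcd_ab m n
  rw [hmn.gcd_eq_one] at h3
  have h4 : x = (x ^ m) ^ (m.gcdA n) * (x ^ n) ^ (m.gcdB n) := by
    rw [← zpow_natCast, ← zpow_natCast, ← zpow_mul, ← zpow_mul, ← zpow_add, ← h3]
    simp
  rw [h4]
  exact H.mul_mem (H.zpow_mem h1 _) (H.zpow_mem h2 _)

theorem cf_case3a (T : Subgroup G) [hTn : T.Normal] (hT : IsPGroup p T)
    (hmax : ∀ N : Subgroup G, N.Normal → IsPGroup p N → N ≤ T)
    (IH : ∀ X : Subgroup G, X < ⊤ → CF p X) (IHT : CF p (⊤ : Subgroup (G ⧸ T)))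
    (P : Subgroup G) (hP : IsSyl p P ⊤) (hCP : Subgroup.centralizer (T : Set G) ⊔ P = ⊤) :
    ∀ A ≤ P, ∀ g, cj g A ≤ P → Good (⊤ ⊓ Subgroup.normalizer (Wz P : Set G)) A g := by
  have hTP : T ≤ P := le_syl_of_normal hP hTn hT
  by_cases hPT : P = T
  · subst hPT
    intro A _ g _
    apply Good.of_mem
    refine ⟨trivial, Wz_normalizer P ?_⟩
    rw [Subgroup.normalizer_eq_top_iff.2 hTn]; trivial
  set π := QuotientGroup.mk' T with hπ
  have hker : ∀ t, t ∈ T ↔ π t = 1 := fun t => (QuotientGroup.eq_one_iff t).symm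
  have hPbar := hP.map_mk (Y := T)
  set R := (Wz (P.map π)).comap π with hR
  have hcm : (P.map π).comap π = P := by
    rw [Subgroup.comap_map_eq, QuotientGroup.ker_mk', sup_eq_left]; exact hTP
  have hRP : R ≤ P := by
    rw [← hcm]; exact Subgroup.comap_mono (Wz_le _)
  have hRp : IsPGroup p R := hP.2.1.to_le hRP
  have hPb1 : P.map π ≠ ⊥ := by
    intro h
    apply hPT
    rw [← hcm, h]
    ext t; exact (hker t).symm
  have hRn : ¬ R.Normal := by
    intro hRn
    have h1 := hmax R hRn hRp
    apply Wz_ne_bot hPbar.2.1 hPb1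
    rw [eq_bot_iff]
    intro x hx
    obtain ⟨r, rfl⟩ := QuotientGroup.mk'_surjective T x
    rw [Subgroup.mem_bot, ← hker]
    exact h1 hx
  set M := Subgroup.normalizer (R : Set G) with hM
  have hMlt : M < ⊤ := by
    rw [lt_top_iff_ne_top, Ne, Subgroup.normalizer_eq_top_iff]; exact hRn
  have hMmem : ∀ m : G, π m ∈ Subgroup.normalizer (Wz (P.map π) : Set (G ⧸ T)) → m ∈ M := by
    intro m hm
    apply mem_normalizer_of_conj
    intro r hr
    change π (m * r * m⁻¹) ∈ Wz (P.map π)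
    rw [map_mul, map_mul, map_inv]
    exact (Subgroup.mem_normalizer_iff.1 hm _).1 hr
  have hPM : P ≤ M := by
    intro x hx
    apply hMmem
    exact Wz_normalizer _ (Subgroup.le_normalizer ⟨x, hx, rfl⟩)
  have hPs : IsSyl p P M := hP.mono le_top hPM
  set C := Subgroup.centralizer (T : Set G) with hCd
  have hCn : C.Normal := inferInstance
  have hpelt : ∀ c : G, ∀ m : ℕ, m.Coprime p → c ^ m = 1 → c ∈ C := by
    intro c m hm hcm
    have h1 : c ∈ C ⊔ P := by rw [hCP]; trivial
    have h2 : c ∈ ((C : Set G) * (P : Set G)) := by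
      rw [← Subgroup.normal_mul C P]; exact h1
    obtain ⟨x, hx, y, hy, rfl⟩ := h2
    obtain ⟨k, hk⟩ := hP.2.1.exists_pow hy
    apply mem_of_coprime_pow (hm.pow_right k) (by rw [hcm]; exact one_mem C)
    apply (QuotientGroup.eq_one_iff (N := C) _).1
    rw [QuotientGroup.mk_pow, QuotientGroup.mk_mul, (QuotientGroup.eq_one_iff (N := C) x).2 hx, one_mul,
      ← QuotientGroup.mk_pow, hk, QuotientGroup.mk_one]
  -- all good in `M`
  have key : ∀ A ≤ P, ∀ g, cj g A ≤ P → Good M A g := by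
    apply alp hP
    intro A hA hfn hbig n hn
    by_cases hTA : T ≤ A
    swap
    · have h1 : A < A ⊔ T := by
        rw [left_lt_sup]; exact hTA
      have h2 : n ∈ Subgroup.normalizer ((A ⊔ T : Subgroup G) : Set G) := by
        rw [← cj_eq_iff]
        unfold cj
        rw [Subgroup.map_sup]
        change cj n A ⊔ cj n T = _
        rw [cj_eq_iff.2 hn, cj_eq_iff.2 (by rw [Subgroup.normalizer_eq_top_iff.2 hTn]; trivial)]
      refine (hbig (A ⊔ T) (sup_le hA hTP) (card_lt_of_lt' h1) n ?_).mono le_sup_left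
      rw [cj_eq_iff.2 h2]; exact sup_le hA hTP
    obtain ⟨m', ⟨_, hm'⟩, hm''⟩ := IHT (P.map π) (A.map π) (π n) hPbar (Subgroup.map_mono hA) trivial
      (by
        rw [cj_le]
        rintro _ ⟨a, ha, rfl⟩
        refine ⟨n * a * n⁻¹, hA ((Subgroup.mem_normalizer_iff.1 hn a).1 ha), by simp⟩)
    obtain ⟨m, rfl⟩ := QuotientGroup.mk'_surjective T m'
    have hmM : m ∈ M := hMmem m hm'
    set Y := (Subgroup.centralizer (A.map π : Set (G ⧸ T))).comap π with hY
    have hYmem : ∀ h, h ∈ Y ↔ ∀ a ∈ A, h * a * h⁻¹ * a⁻¹ ∈ T := by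
      intro h
      rw [hY, Subgroup.mem_comap, Subgroup.mem_centralizer_iff]
      constructor
      · intro h1 a ha
        have h2 := h1 (π a) ⟨a, ha, rfl⟩
        rw [hker]
        rw [map_mul, map_mul, map_mul, map_inv, map_inv, ← h2]; simp
      · rintro h1 _ ⟨a, ha, rfl⟩
        have h2 := (hker _).1 (h1 a ha)
        rw [map_mul, map_mul, map_mul, map_inv, map_inv, mul_inv_eq_one,
          mul_inv_eq_iff_eq_mul] at h2
        exact h2.symm
    have hYN : Y ≤ Subgroup.normalizer (A : Set G) := by
      intro h hh
      apply mem_normalizer_of_conj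
      intro a ha
      have := A.mul_mem (hTA ((hYmem h).1 hh a ha)) ha
      simpa using this
    have hNY : Subgroup.normalizer (A : Set G) ≤ Subgroup.normalizer (Y : Set G) := by
      intro x hx
      apply mem_normalizer_of_conj
      intro h hh
      rw [hYmem]
      intro a ha
      have h1 : x⁻¹ * a * x ∈ A := by
        have := (Subgroup.mem_normalizer_iff.1 (inv_mem hx) a).1 ha
        simpa using this
      have h2 := hTn.conj_mem _ ((hYmem h).1 hh _ h1) x
      convert h2 using 1; group
    have hYs : IsSyl p (P ⊓ Subgroup.normalizer (A : Set G) ⊓ Y) Y := hfn.inf_normal hYN hNY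
    have hle := sup_syl (C := Y ⊓ Subgroup.centralizer (A : Set G)) inf_le_left (by
      intro x hx
      apply mem_normalizer_of_conj
      rintro c ⟨hc, hc'⟩
      refine ⟨Y.mul_mem (Y.mul_mem hx hc) (Y.inv_mem hx), Subgroup.mem_centralizer_iff.2 ?_⟩
      intro a ha
      have h1 : x⁻¹ * a * x ∈ A := by
        have := (Subgroup.mem_normalizer_iff.1 (inv_mem (hYN hx)) a).1 ha
        simpa using this
      have h2 := Subgroup.mem_centralizer_iff.1 hc' _ h1
      calc a * (x * c * x⁻¹) = x * (x⁻¹ * a * x * c) * x⁻¹ := by group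
        _ = x * (c * (x⁻¹ * a * x)) * x⁻¹ := by rw [h2]
        _ = _ := by group) (by
      intro d hd
      obtain ⟨i, j, ⟨k, hk⟩, ⟨q, hq, hq'⟩, h1⟩ := exists_pp p d
      refine ⟨k, ?_⟩
      have hcom : ∀ c ∈ Y, c ^ q = 1 → c ∈ Y ⊓ Subgroup.centralizer (A : Set G) := by
        intro c hc hcq
        refine ⟨hc, Subgroup.mem_centralizer_iff.2 ?_⟩
        intro a ha
        have h2 := (hYmem c).1 hc a ha
        have h3 := Subgroup.mem_centralizer_iff.1 (hpelt c q hq hcq) _ h2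
        exact (coprime_stab hcq hq h3.symm (hT.exists_pow h2)).symm
      have h2 : d ^ p ^ k = (d ^ j) ^ p ^ k := by
        conv_lhs => rw [← h1]
        rw [(Commute.refl d).pow_pow i j |>.mul_pow, hk, one_mul]
      rw [h2]
      exact pow_mem (hcom _ (Y.pow_mem hd j) hq') _) hYs
    have hYG : Y ≤ GoodSub M A := by
      refine hle.trans (sup_le ?_ ?_)
      · rintro c ⟨hc, hc'⟩
        refine ⟨hYN hc, 1, one_mem _, ?_⟩
        intro a ha
        have := Subgroup.mem_centralizer_iff.1 hc' a ha
        rw [← this]; simp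
      · rintro c ⟨⟨hc, _⟩, hc'⟩
        exact ⟨hYN hc', Good.of_mem _ (hPM hc)⟩
    have hh : m⁻¹ * n ∈ Y := by
      rw [hY, Subgroup.mem_comap, Subgroup.mem_centralizer_iff]
      rintro _ ⟨a, ha, rfl⟩
      have h1 : π m * π a * (π m)⁻¹ = π n * π a * (π n)⁻¹ := hm'' _ ⟨a, ha, rfl⟩
      have h2 : π n * π a = π m * π a * (π m)⁻¹ * π n := by rw [h1]; group
      rw [map_mul, map_inv, mul_assoc _ (π n), h2]; group
    have h3 := (hYG hh).2.comp (h := m) (Good.of_mem _ hmM)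
    simpa using h3
  intro A hA g hg
  obtain ⟨m, hm, hm'⟩ := key A hA g hg
  have h1 := IH M hMlt P A m hPs hA hm (by
    rw [cj_le]; intro a ha; rw [hm' a ha]; exact cj_le.1 hg a ha)
  exact (h1.monoM (inf_le_inf_right _ le_top)).congr hm'

end cf3

section cf4

open scoped Pointwise

variable {p : ℕ} [Fact p.Prime] {G : Type} [Group G] [Finite G]

theorem centralizer_le_of_syl (T : Subgroup G) [hTn : T.Normal] (hT : IsPGroup p T)
    (hOp : ∀ Y : Subgroup G, Y.Normal → (Nat.card Y).Coprime p → Y = ⊥)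
    (hs : IsSyl p T (T ⊔ Subgroup.centralizer (T : Set G))) :
    Subgroup.centralizer (T : Set G) ≤ T := by
  set C := Subgroup.centralizer (T : Set G) with hC
  have hCn : C.Normal := inferInstance
  have h1 : IsSyl p (T ⊓ C) C := hs.inf_normal le_sup_right
    (by rw [Subgroup.normalizer_eq_top_iff.2 hCn]; exact le_top)
  obtain ⟨P, hP⟩ := h1.exists_sylow
  have hPn : (P : Subgroup C).Normal := by
    rw [hP]
    have : (T ⊓ C).Normal := inferInstance
    exact this.subgroupOf C
  have hcop : Nat.Coprime (Nat.card (P : Subgroup C)) (P : Subgroup C).index := by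
    obtain ⟨n, hn⟩ := IsPGroup.iff_card.1 P.2
    rw [hn]
    exact Nat.Coprime.pow_left _ ((Nat.Prime.coprime_iff_not_dvd Fact.out).2 P.not_dvd_index)
  obtain ⟨K, hK⟩ := Subgroup.exists_right_complement'_of_coprime hcop
  have hKc : (Nat.card K).Coprime p := by
    have := hK.symm.index_eq_card
    rw [← this]
    exact ((Nat.Prime.coprime_iff_not_dvd Fact.out).2 P.not_dvd_index).symm
  have hcard : Nat.card (K.map C.subtype) = Nat.card K :=
    (Nat.card_congr (K.equivMapOfInjective _ C.subtype_injective).toEquiv).symm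
  have hdec : ∀ c ∈ C, ∃ z ∈ T, z ∈ C ∧ ∃ k ∈ K.map C.subtype, c = z * k := by
    intro c hc
    have h2 : (⟨c, hc⟩ : C) ∈ (P : Subgroup C) ⊔ K := by rw [hK.sup_eq_top]; trivial
    have h3 : (⟨c, hc⟩ : C) ∈ (((P : Subgroup C) : Set C) * (K : Set C)) := by
      rw [← Subgroup.normal_mul]; exact h2
    obtain ⟨z, hz, k, hk, hzk⟩ := h3
    rw [hP] at hz
    exact ⟨z, hz.1, z.2, k, ⟨k, hk, rfl⟩, (congrArg Subtype.val hzk).symm⟩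
  have hKC : K.map C.subtype ≤ C := Subgroup.map_subtype_le K
  have hKn : (K.map C.subtype).Normal := by
    constructor
    intro x hx g
    obtain ⟨z, hz, hzC, k, hk, e⟩ := hdec _ (hCn.conj_mem x (hKC hx) g)
    have hzk : Commute z k := Subgroup.mem_centralizer_iff.1 (hKC hk) z hz
    have h4 : (g * x * g⁻¹) ^ Nat.card K = 1 := by
      rw [conj_pow, ← hcard, pow_card_of_mem hx]; simp
    have h5 : z ^ Nat.card K = 1 := by
      rw [e, hzk.mul_pow, ← hcard, pow_card_of_mem hk, mul_one] at h4
      rw [← hcard, h4]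
    obtain ⟨j, hj⟩ := hT.exists_pow hz
    have h6 := eq_one_of_coprime_pow (hKc.pow_right j) h5 hj
    rw [e, h6, one_mul]; exact hk
  have hKb := hOp _ hKn (by rw [hcard]; exact hKc)
  intro c hc
  obtain ⟨z, hz, _, k, hk, rfl⟩ := hdec c hc
  rw [hKb, Subgroup.mem_bot] at hk
  rw [hk, mul_one]; exact hz

theorem cf_case3 (hp2 : p ≠ 2) (hodd : Odd (Nat.card G)) (T : Subgroup G) [hTn : T.Normal]
    (hT : IsPGroup p T)
    (hmax : ∀ N : Subgroup G, N.Normal → IsPGroup p N → N ≤ T)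
    (hOp : ∀ Y : Subgroup G, Y.Normal → (Nat.card Y).Coprime p → Y = ⊥)
    (IH : ∀ X : Subgroup G, X < ⊤ → CF p X) (IHT : CF p (⊤ : Subgroup (G ⧸ T))) :
    CF p (⊤ : Subgroup G) := by
  intro P A0 g0 hP hA0 _ hg0
  set C := Subgroup.centralizer (T : Set G) with hC
  have hCn : C.Normal := inferInstance
  by_cases hCP : C ⊔ P = ⊤
  · exact cf_case3a T hT hmax IH IHT P hP hCP A0 hA0 g0 hg0
  have hTP : T ≤ P := le_syl_of_normal hP hTn hT
  have hTCn : (T ⊔ C).Normal := inferInstance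
  have hTCtop := Subgroup.normalizer_eq_top_iff.2 hTCn
  have hQs : IsSyl p (P ⊓ (T ⊔ C)) (T ⊔ C) := hP.inf_normal le_top (by rw [hTCtop])
  set Q := P ⊓ (T ⊔ C) with hQ
  have hTQ : T ≤ Q := le_inf hTP le_sup_left
  by_cases hQT : Q = T
  · rw [hQT] at hQs
    have hCT := centralizer_le_of_syl T hT hOp hQs
    have := zl hp2 hodd T hT hmax hCT P hP
    apply Good.of_mem
    refine ⟨trivial, ?_⟩
    rw [Subgroup.normalizer_eq_top_iff.2 this]; trivial
  have hNQ : Subgroup.normalizer (Q : Set G) < ⊤ := by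
    rw [lt_top_iff_ne_top, Ne, Subgroup.normalizer_eq_top_iff]
    intro h
    exact hQT (le_antisymm (hmax Q h hQs.2.1) hTQ)
  have hPNQ : P ≤ Subgroup.normalizer (Q : Set G) := by
    intro x hx
    apply mem_normalizer_of_conj
    rintro q ⟨hq, hq'⟩
    exact ⟨P.mul_mem (P.mul_mem hx hq) (P.inv_mem hx), hTCn.conj_mem q hq' x⟩
  have IH1 := IH _ hNQ
  have IH2 := IH _ (lt_top_iff_ne_top.2 hCP)
  refine alp hP _ ?_ A0 hA0 g0 hg0
  intro A hA hfn hbig n hn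
  by_cases hQA : Q ≤ A
  · have hnQ : n ∈ Subgroup.normalizer (Q : Set G) := by
      apply mem_normalizer_of_conj
      intro q hq
      exact ⟨hA ((Subgroup.mem_normalizer_iff.1 hn q).1 (hQA hq)), hTCn.conj_mem q hq.2 n⟩
    exact (IH1 P A n (hP.mono le_top hPNQ) hA hnQ (by rw [cj_eq_iff.2 hn]; exact hA)).monoM
      (inf_le_inf_right _ le_top)
  set NA := Subgroup.normalizer (A : Set G) with hNA
  have hN0n : NA ≤ Subgroup.normalizer ((NA ⊓ (T ⊔ C) : Subgroup G) : Set G) := by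
    intro x hx
    apply mem_normalizer_of_conj
    rintro q ⟨hq, hq'⟩
    exact ⟨NA.mul_mem (NA.mul_mem hx hq) (NA.inv_mem hx), hTCn.conj_mem q hq' x⟩
  have hS0 := hfn.inf_normal (N := NA ⊓ (T ⊔ C)) inf_le_left hN0n
  set S0 := P ⊓ NA ⊓ (NA ⊓ (T ⊔ C)) with hS0d
  obtain ⟨c, hc, hm⟩ := hS0.frattini (hN0n hn)
  have hmN : c * n ∈ NA := NA.mul_mem hc.1 hn
  suffices h : n ∈ GoodSub (⊤ ⊓ Subgroup.normalizer (Wz P : Set G)) A from h.2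
  have hcg : c ∈ GoodSub (⊤ ⊓ Subgroup.normalizer (Wz P : Set G)) A := by
    refine ⟨hc.1, ?_⟩
    refine (IH2 P A c (hP.mono le_top le_sup_right) hA ?_ (by
      rw [cj_eq_iff.2 hc.1]; exact hA)).monoM (inf_le_inf_right _ le_top)
    have : T ⊔ C ≤ C ⊔ P := sup_le (hTP.trans le_sup_right) le_sup_left
    exact this hc.2
  have hmg : c * n ∈ GoodSub (⊤ ⊓ Subgroup.normalizer (Wz P : Set G)) A := by
    refine ⟨hmN, ?_⟩
    have hS0P : S0 ≤ P := inf_le_left.trans inf_le_left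
    have hlt : A < A ⊔ S0 := by
      rw [left_lt_sup]
      intro hle
      -- `A < A ⊔ Q`
      have h1 : A < A ⊔ Q := by rw [left_lt_sup]; exact hQA
      have h2 := exists_mem_normalizer_of_lt (hP.2.1.to_le (sup_le hA inf_le_left)) h1
      obtain ⟨x, ⟨hx1, hx2⟩, hx3⟩ := SetLike.exists_of_lt h2
      have h3 : x ∈ ((A : Set G) * (Q : Set G)) := by
        rw [← Subgroup.coe_mul_of_left_le_normalizer_right A Q (hA.trans hPNQ)]; exact hx1
      obtain ⟨a, ha, q, hq, rfl⟩ := h3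
      have hqN : q ∈ NA := by
        have := NA.mul_mem (NA.inv_mem (Subgroup.le_normalizer (H := A) ha)) hx2
        simpa using this
      exact hx3 (A.mul_mem ha (hle ⟨⟨hq.1, hqN⟩, ⟨hqN, hq.2⟩⟩))
    have h2 : cj (c * n) (A ⊔ S0) = A ⊔ S0 := by
      unfold cj
      rw [Subgroup.map_sup]
      change cj (c * n) A ⊔ cj (c * n) S0 = _
      rw [cj_eq_iff.2 hmN, cj_eq_iff.2 hm]
    refine (hbig (A ⊔ S0) (sup_le hA hS0P) (card_lt_of_lt' hlt) _ ?_).mono le_sup_left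
    rw [h2]; exact sup_le hA hS0P
  have := mul_mem (inv_mem hcg) hmg
  simpa using this

theorem cf_main (hp2 : p ≠ 2) : ∀ n : ℕ, ∀ (G : Type) [Group G] [Finite G], Nat.card G = n →
    Odd (Nat.card G) → CF p (⊤ : Subgroup G) := by
  intro n
  induction n using Nat.strong_induction_on with
  | _ n ih =>
  intro G _ _ hn hodd
  have IH : ∀ X : Subgroup G, X < ⊤ → CF p X := by
    intro X hX
    apply CF_of_top
    have h1 : Nat.card X < n := by
      have := card_lt_of_lt' hX
      rwa [Subgroup.card_top, hn] at this
    exact ih _ h1 X rfl (hodd.of_dvd_nat (Subgroup.card_subgroup_dvd_card X))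
  have IHQ : ∀ Y : Subgroup G, ∀ [Y.Normal], Y ≠ ⊥ → CF p (⊤ : Subgroup (G ⧸ Y)) := by
    intro Y _ hY
    have h1 := Y.card_eq_card_quotient_mul_card_subgroup
    have h2 : 1 < Nat.card Y := by
      rw [← Subgroup.one_lt_card_iff_ne_bot] at hY; exact hY
    have h3 : 0 < Nat.card (G ⧸ Y) := Nat.card_pos
    refine ih _ ?_ (G ⧸ Y) rfl (hodd.of_dvd_nat (Subgroup.card_quotient_dvd_card Y))
    rw [← hn, h1]
    exact lt_mul_of_one_lt_right h3 h2
  by_cases hOp : ∀ Y : Subgroup G, Y.Normal → (Nat.card Y).Coprime p → Y = ⊥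
  swap
  · push Not at hOp
    obtain ⟨Y, hYn, hYc, hY⟩ := hOp
    exact cf_case2 Y hYc (IHQ Y hY)
  obtain ⟨T, hTn, hT, hmax⟩ := exists_pCore p G
  by_cases hT1 : T = ⊥
  · subst hT1
    exact cf_case1 (fun N hN hNp => le_bot_iff.1 (hmax N hN hNp)) IH
  · exact cf_case3 hp2 hodd T hT hmax hOp IH (IHQ T hT1)

end cf4

section chars

/-- Characters of matrix representations. -/
def IsChar {G : Type} [Group G] (f : G → ℂ) : Prop :=
  ∃ (n : ℕ) (ρ : G →* Matrix (Fin n) (Fin n) ℂ), ∀ g, f g = (ρ g).trace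

variable {G : Type} [Group G] [Fintype G]

theorem isChar_of_rep {V : Type*} [AddCommGroup V] [Module ℂ V] [FiniteDimensional ℂ V]
    (ρ : Representation ℂ G V) : IsChar ρ.character := by
  let b := Module.finBasis ℂ V
  refine ⟨_, ((LinearMap.toMatrixAlgEquiv b).toAlgHom : (V →ₗ[ℂ] V) →* Matrix (Fin (Module.finrank ℂ V)) (Fin (Module.finrank ℂ V)) ℂ).comp ρ, fun g => ?_⟩
  rw [Representation.character, LinearMap.trace_eq_matrix_trace ℂ b]
  rfl

theorem isChar_fdrep (V : FDRep ℂ G) : IsChar V.character := isChar_of_rep V.ρ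

theorem IsChar.exists_fdrep {f : G → ℂ} (h : IsChar f) : ∃ V : FDRep ℂ G, V.character = f := by
  obtain ⟨n, ρ, h⟩ := h
  let σ : Representation ℂ G (Fin n → ℂ) :=
    ((Matrix.toLinAlgEquiv' (R := ℂ) (n := Fin n)).toAlgHom : _ →* _).comp ρ
  refine ⟨FDRep.of σ, ?_⟩
  funext g
  rw [h]
  change LinearMap.trace ℂ _ (Matrix.toLin' (ρ g)) = _
  rw [Matrix.trace_toLin'_eq]

theorem mem_Irr_iff {f : G → ℂ} :
    f ∈ Irr G ↔ IsChar f ∧ ∑ g, f g * f g⁻¹ = Nat.card G := by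
  constructor
  · rintro ⟨V, hV, rfl⟩
    exact ⟨isChar_fdrep V, (FDRep.simple_iff_char_is_norm_one V).1 hV⟩
  · rintro ⟨h, hn⟩
    obtain ⟨V, rfl⟩ := h.exists_fdrep
    exact ⟨V, (FDRep.simple_iff_char_is_norm_one V).2 hn, rfl⟩

theorem Irr.orth {f f' : G → ℂ} (h : f ∈ Irr G) (h' : f' ∈ Irr G) (hne : f ≠ f') :
    ∑ g, f g * f' g⁻¹ = 0 := by
  obtain ⟨V, hV, rfl⟩ := h
  obtain ⟨W, hW, rfl⟩ := h'
  have hc : (Nat.card G : ℂ) ≠ 0 := Nat.cast_ne_zero.2 Nat.card_pos.ne'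
  have := invertibleOfNonzero hc
  have h := FDRep.char_orthonormal V W
  rw [if_neg] at h
  · simpa [hc] using h
  · rintro ⟨i⟩
    exact hne (FDRep.char_iso i)

theorem Irr.norm {f : G → ℂ} (h : f ∈ Irr G) : ∑ g, f g * f g⁻¹ = Nat.card G :=
  (mem_Irr_iff.1 h).2

theorem Irr.linearIndependent : LinearIndependent ℂ (fun f : Irr G => (f : G → ℂ)) := by
  rw [linearIndependent_iff']
  intro s c hc i hi
  have h1 : ∑ g, (∑ j ∈ s, c j • (j : G → ℂ)) g * (i : G → ℂ) g⁻¹ = 0 := by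
    rw [hc]; simp
  simp only [Finset.sum_apply, Pi.smul_apply, smul_eq_mul, Finset.sum_mul] at h1
  rw [Finset.sum_comm, Finset.sum_eq_single i] at h1
  · simp only [mul_assoc, ← Finset.mul_sum] at h1
    rw [Irr.norm i.2] at h1
    exact (mul_eq_zero.1 h1).resolve_right (Nat.cast_ne_zero.2 Nat.card_pos.ne')
  · intro j hj hji
    simp only [mul_assoc, ← Finset.mul_sum]
    rw [Irr.orth j.2 i.2 (fun h => hji (Subtype.ext h)), mul_zero]
  · exact fun h => absurd hi h

theorem Irr.finite : (Irr G).Finite := by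
  have := (Irr.linearIndependent (G := G)).finite
  exact Set.toFinite _

theorem IsChar.conj {f : G → ℂ} (h : IsChar f) (g x : G) : f (x * g * x⁻¹) = f g := by
  obtain ⟨V, rfl⟩ := h.exists_fdrep
  exact FDRep.char_conj V g x

theorem Irr.isChar {f : G → ℂ} (h : f ∈ Irr G) : IsChar f := (mem_Irr_iff.1 h).1

theorem Irr.of_irreducible {V : Type*} [AddCommGroup V] [Module ℂ V] [FiniteDimensional ℂ V]
    (ρ : Representation ℂ G V) [ρ.IsIrreducible] : ρ.character ∈ Irr G := by
  classical
  have hc : (Nat.card G : ℂ) ≠ 0 := Nat.cast_ne_zero.2 Nat.card_pos.ne'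
  have := invertibleOfNonzero hc
  have h := Representation.char_orthonormal ρ ρ
  rw [if_pos ⟨Representation.Equiv.refl ρ⟩] at h
  refine mem_Irr_iff.2 ⟨isChar_of_rep ρ, ?_⟩
  rw [inv_mul_eq_one₀ hc] at h
  exact h.symm

theorem sum_rep_eq_zero {V : Type*} [AddCommGroup V] [Module ℂ V] [FiniteDimensional ℂ V]
    (ρ : Representation ℂ G V) [ρ.IsIrreducible] (c : G → ℂ)
    (hc : ∀ g x, c (x * g * x⁻¹) = c g) (h0 : ∀ f ∈ Irr G, ∑ g, c g * f g = 0) :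
    ∑ g, c g • ρ g = 0 := by
  let T : V →ₗ[ℂ] V := ∑ g, c g • ρ g
  have hT : ∀ x, T ∘ₗ ρ x = ρ x ∘ₗ T := by
    intro x
    change (∑ g, c g • ρ g) * ρ x = ρ x * (∑ g, c g • ρ g)
    rw [Finset.sum_mul, Finset.mul_sum]
    refine Fintype.sum_equiv (MulAut.conj x⁻¹).toEquiv _ _ (fun g => ?_)
    simp only [MulEquiv.toEquiv_eq_coe, EquivLike.coe_coe, MulAut.conj_apply]
    rw [hc g x⁻¹, smul_mul_assoc, mul_smul_comm, ← map_mul, ← map_mul]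
    congr 2
    group
  let φ : Representation.IntertwiningMap ρ ρ := ⟨T, hT⟩
  obtain ⟨a, ha⟩ := (Representation.IsIrreducible.algebraMap_intertwiningMap_bijective_of_isAlgClosed
    (ρ := ρ)).2 φ
  have hTa : T = a • LinearMap.id := by
    have : φ.toLinearMap = T := rfl
    rw [← this, ← ha]
    rfl
  have h1 := h0 _ (Irr.of_irreducible ρ)
  have h2 : LinearMap.trace ℂ V T = 0 := by
    rw [← h1]
    simp [T, Representation.character]
  rw [hTa, map_smul, LinearMap.trace_id, smul_eq_mul, mul_eq_zero] at h2
  change T = 0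
  rw [hTa]
  rcases h2 with h2 | h2
  · rw [h2, zero_smul]
  · have : Subsingleton V := Module.finrank_zero_iff.1 (Nat.cast_eq_zero.1 h2)
    exact Subsingleton.elim _ _

theorem ofModule'_asAlgebraHom {M : Type*} [AddCommGroup M] [Module ℂ M]
    [Module (MonoidAlgebra ℂ G) M] [IsScalarTower ℂ (MonoidAlgebra ℂ G) M]
    (r : MonoidAlgebra ℂ G) (x : M) :
    (Representation.ofModule' (k := ℂ) (G := G) M).asAlgebraHom r x = r • x := by
  have : (Representation.ofModule' (k := ℂ) (G := G) M).asAlgebraHom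
      = Algebra.lsmul ℂ ℂ M := by
    unfold Representation.ofModule' Representation.asAlgebraHom
    exact Equiv.apply_symm_apply _ _
  rw [this]
  rfl

theorem ofModule'_irreducible (M : Type*) [AddCommGroup M] [Module ℂ M]
    [Module (MonoidAlgebra ℂ G) M] [IsScalarTower ℂ (MonoidAlgebra ℂ G) M]
    [hM : IsSimpleModule (MonoidAlgebra ℂ G) M] :
    (Representation.ofModule' (k := ℂ) (G := G) M).IsIrreducible := by
  rw [Representation.irreducible_iff_isSimpleModule_asModule]
  let e : (Representation.ofModule' (k := ℂ) (G := G) M).asModule ≃ₗ[MonoidAlgebra ℂ G] M :=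
    { (Representation.ofModule' (k := ℂ) (G := G) M).asModuleEquiv.toAddEquiv with
      map_smul' := fun r x => by
        have := Representation.asModuleEquiv_map_smul
          (Representation.ofModule' (k := ℂ) (G := G) M) r x
        rw [ofModule'_asAlgebraHom] at this
        exact this }
  exact IsSimpleModule.congr e

theorem Irr.complete (c : G → ℂ)
    (hc : ∀ g x, c (x * g * x⁻¹) = c g) (h0 : ∀ f ∈ Irr G, ∑ g, c g * f g = 0) : c = 0 := by
  let z : (MonoidAlgebra ℂ G) := ∑ g, MonoidAlgebra.single g (c g)
  have hz : ∀ r : (MonoidAlgebra ℂ G), z * r = r * z := by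
    intro r
    induction r using MonoidAlgebra.induction_on with
    | of x =>
      rw [Finset.sum_mul, Finset.mul_sum]
      simp only [MonoidAlgebra.of_apply, MonoidAlgebra.single_mul_single]
      refine Fintype.sum_equiv (MulAut.conj x⁻¹).toEquiv _ _ (fun g => ?_)
      simp only [MulEquiv.toEquiv_eq_coe, EquivLike.coe_coe, MulAut.conj_apply]
      rw [hc g x⁻¹]
      simp [mul_assoc]
    | add f g hf hg => rw [mul_add, add_mul, hf, hg]
    | smul r f hf => rw [mul_smul_comm, smul_mul_assoc, hf]
  let φ : (MonoidAlgebra ℂ G) →ₗ[(MonoidAlgebra ℂ G)] (MonoidAlgebra ℂ G) :=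
    { toFun := fun x => z * x
      map_add' := fun x y => mul_add _ _ _
      map_smul' := fun r x => by simp only [smul_eq_mul, RingHom.id_apply, ← mul_assoc, hz] }
  have hφ : LinearMap.ker φ = ⊤ := by
    rw [eq_top_iff, ← IsSemisimpleModule.sSup_simples_eq_top (MonoidAlgebra ℂ G) (MonoidAlgebra ℂ G)]
    refine sSup_le ?_
    intro S hS x hx
    have hS' : IsSimpleModule (MonoidAlgebra ℂ G) S := hS
    have hirr := ofModule'_irreducible (G := G) S
    have hfin : Module.Finite ℂ S := by
      have : Module.Finite (MonoidAlgebra ℂ G) S := inferInstance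
      exact Module.Finite.trans (MonoidAlgebra ℂ G) _
    have h1 := sum_rep_eq_zero (Representation.ofModule' (k := ℂ) (G := G) S) c hc h0
    have h2 : (Representation.ofModule' (k := ℂ) (G := G) S).asAlgebraHom z = 0 := by
      rw [← h1]
      simp [z, Representation.asAlgebraHom_single]
    have h4 : z • (⟨x, hx⟩ : S) = 0 := by
      have h6 := ofModule'_asAlgebraHom z (⟨x, hx⟩ : S)
      rw [h2] at h6
      exact h6.symm
    exact congrArg Subtype.val h4
  have hz0 : z = 0 := by
    have : (1 : (MonoidAlgebra ℂ G)) ∈ LinearMap.ker φ := hφ ▸ trivial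
    have h : z * 1 = 0 := this
    rwa [mul_one] at h
  funext g
  have h5 := congrArg (fun r : MonoidAlgebra ℂ G => MonoidAlgebra.coeff r g) hz0
  simp only [z, MonoidAlgebra.coeff_sum, MonoidAlgebra.coeff_single] at h5
  rw [Finset.sum_apply'] at h5
  rw [Finset.sum_eq_single g (fun b _ hb => Finsupp.single_eq_of_ne' hb) (by simp)] at h5
  simpa using h5

end chars

section chars2

variable {G : Type} [Group G] [Fintype G]

open scoped Classical in
theorem Irr.orth2 (g h : G) :
    ((Finset.univ.filter (fun x => IsConj x h)).card : ℂ) *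
      ∑ f ∈ (Irr.finite (G := G)).toFinset, f h * f g⁻¹ =
      if IsConj g h then (Nat.card G : ℂ) else 0 := by
  set k := (Finset.univ.filter (fun x => IsConj x h)).card with hk
  let c : G → ℂ := fun g => k * ∑ f ∈ (Irr.finite (G := G)).toFinset, f h * f g⁻¹ -
    if IsConj g h then (Nat.card G : ℂ) else 0
  have hc : c = 0 := by
    apply Irr.complete
    · intro g x
      have h1 : IsConj (x * g * x⁻¹) h ↔ IsConj g h := by
        have : IsConj g (x * g * x⁻¹) := isConj_iff.2 ⟨x, rfl⟩
        exact ⟨fun h => this.trans h, fun h => this.symm.trans h⟩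
      simp only [c, h1]
      congr 2
      refine Finset.sum_congr rfl (fun f hf => ?_)
      have := (Irr.isChar ((Set.Finite.mem_toFinset _).1 hf)).conj g⁻¹ x
      rw [← this]
      congr 2
      group
    · intro f hf
      simp only [c, sub_mul, Finset.sum_sub_distrib, Finset.mul_sum, Finset.sum_mul]
      rw [Finset.sum_comm, Finset.sum_eq_single f]
      · have h1 : ∑ x, (k : ℂ) * (f h * f x⁻¹) * f x = k * f h * Nat.card G := by
          rw [← Irr.norm hf, Finset.mul_sum]
          exact Finset.sum_congr rfl (fun x _ => by ring)
        have h2 : ∑ x, (if IsConj x h then (Nat.card G : ℂ) else 0) * f x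
            = k * f h * Nat.card G := by
          simp only [ite_mul, zero_mul]
          rw [← Finset.sum_filter]
          rw [Finset.sum_congr rfl (g := fun _ => (Nat.card G : ℂ) * f h)]
          · rw [Finset.sum_const, nsmul_eq_mul]; ring
          · intro x hx
            obtain ⟨y, hy⟩ := isConj_iff.1 (Finset.mem_filter.1 hx).2
            rw [← hy, (Irr.isChar hf).conj]
        rw [h1, h2, sub_self]
      · intro f' hf' hne
        have h3 := Irr.orth hf ((Set.Finite.mem_toFinset _).1 hf') hne.symm
        have : ∑ x, (k : ℂ) * (f' h * f' x⁻¹) * f x = k * f' h * ∑ x, f x * f' x⁻¹ := by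
          rw [Finset.mul_sum]
          exact Finset.sum_congr rfl (fun x _ => by ring)
        rw [this, h3, mul_zero]
      · intro h; exact absurd ((Set.Finite.mem_toFinset _).2 hf) h
  have := congrFun hc g
  exact sub_eq_zero.1 this

open scoped Classical in
theorem ncard_classes (s : Set G) (hs : ∀ x y, IsConj x y → x ∈ s → y ∈ s) :
    ∑ g ∈ Finset.univ.filter (· ∈ s),
      ((Finset.univ.filter (fun x => IsConj x g)).card : ℂ)⁻¹ =
      ((ConjClasses.mk '' s).ncard : ℂ) := by
  have h1 : ConjClasses.mk '' s =
      ((Finset.univ.filter (· ∈ s)).image (ConjClasses.mk (α := G)) : Finset _) := by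
    ext; simp
  rw [h1, Set.ncard_coe_finset]
  rw [← Finset.sum_fiberwise_of_maps_to (t := (Finset.univ.filter (· ∈ s)).image
    (ConjClasses.mk (α := G))) (g := ConjClasses.mk)
    (fun x hx => Finset.mem_image_of_mem _ hx)]
  rw [Finset.card_eq_sum_ones, Nat.cast_sum]
  refine Finset.sum_congr rfl (fun c hc => ?_)
  obtain ⟨g, hg, rfl⟩ := Finset.mem_image.1 hc
  have h2 : Finset.filter (fun i => ConjClasses.mk i = ConjClasses.mk g)
      (Finset.univ.filter (· ∈ s)) = Finset.univ.filter (fun x => IsConj x g) := by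
    ext x
    simp only [Finset.mem_filter, Finset.mem_univ, true_and, ConjClasses.mk_eq_mk_iff_isConj]
    exact ⟨fun h => h.2, fun h => ⟨hs g x h.symm (by simpa using hg), h⟩⟩
  rw [h2]
  rw [Finset.sum_congr rfl (g := fun _ =>
    ((Finset.univ.filter (fun x => IsConj x g)).card : ℂ)⁻¹)]
  · rw [Finset.sum_const, nsmul_eq_mul, mul_inv_cancel₀]
    · simp
    · exact Nat.cast_ne_zero.2 (Finset.card_pos.2 ⟨g, by
        simp only [Finset.mem_filter, Finset.mem_univ, true_and]; exact IsConj.refl _⟩).ne'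
  · intro x hx
    congr 3
    ext y
    simp only [Finset.mem_filter, Finset.mem_univ, true_and] at hx ⊢
    exact ⟨fun h => h.trans hx, fun h => h.trans hx.symm⟩

theorem count_fixed (m : ℕ) (hm : ∀ f ∈ Irr G, (fun g => f (g ^ m)) ∈ Irr G) :
    {f ∈ Irr G | ∀ g, f (g ^ m) = f g}.ncard =
      (ConjClasses.mk '' {g : G | IsConj g (g ^ m)}).ncard := by
  classical
  have hc0 : (Nat.card G : ℂ) ≠ 0 := Nat.cast_ne_zero.2 Nat.card_pos.ne'
  have key : ∑ f ∈ (Irr.finite (G := G)).toFinset, ∑ g, f (g ^ m) * f g⁻¹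
      = Nat.card G * ({f ∈ Irr G | ∀ g, f (g ^ m) = f g}.ncard : ℂ) := by
    have h1 : {f ∈ Irr G | ∀ g, f (g ^ m) = f g} =
        ((Irr.finite (G := G)).toFinset.filter (fun f => ∀ g, f (g ^ m) = f g) : Finset _) := by
      ext; simp
    rw [h1, Set.ncard_coe_finset, Finset.card_eq_sum_ones, Finset.sum_filter, Nat.cast_sum,
      Finset.mul_sum]
    refine Finset.sum_congr rfl (fun f hf => ?_)
    have hf' := (Set.Finite.mem_toFinset _).1 hf
    split_ifs with h
    · simp only [h]
      rw [Irr.norm hf']; simp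
    · rw [Irr.orth (hm f hf') hf' (fun h' => h (fun g => congrFun h' g))]; simp
  have key2 : ∑ f ∈ (Irr.finite (G := G)).toFinset, ∑ g, f (g ^ m) * f g⁻¹
      = Nat.card G * ((ConjClasses.mk '' {g : G | IsConj g (g ^ m)}).ncard : ℂ) := by
    rw [← ncard_classes, Finset.sum_comm, Finset.sum_filter, Finset.mul_sum]
    · refine Finset.sum_congr rfl (fun g _ => ?_)
      have := Irr.orth2 g (g ^ m)
      have hpos : ((Finset.univ.filter (fun x => IsConj x (g ^ m))).card : ℂ) ≠ 0 :=
        Nat.cast_ne_zero.2 (Finset.card_pos.2 ⟨g ^ m, by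
        simp only [Finset.mem_filter, Finset.mem_univ, true_and]; exact IsConj.refl _⟩).ne'
      rw [← eq_inv_mul_iff_mul_eq₀ hpos] at this
      rw [this]
      by_cases h : IsConj g (g ^ m)
      · have h' : g ∈ {g : G | IsConj g (g ^ m)} := h
        rw [if_pos h, if_pos h', mul_comm]
        congr 4
        ext x
        simp only [Finset.mem_filter, Finset.mem_univ, true_and]
        exact ⟨fun h1 => h1.trans h.symm, fun h1 => h1.trans h⟩
      · have h' : g ∉ {g : G | IsConj g (g ^ m)} := h
        rw [if_neg h, if_neg h', mul_zero, mul_zero]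
    · intro x y hxy hx
      have hx' : IsConj x (x ^ m) := hx
      have : IsConj (x ^ m) (y ^ m) := by
        obtain ⟨z, hz⟩ := isConj_iff.1 hxy
        exact isConj_iff.2 ⟨z, by rw [← hz, conj_pow]⟩
      exact (hxy.symm.trans hx').trans this
  rw [key] at key2
  exact_mod_cast mul_left_cancel₀ hc0 key2

end chars2

section chars3

theorem matrix_idem_trace {k : ℕ} (E : Matrix (Fin k) (Fin k) ℂ) (h : E * E = E) :
    ∃ d : ℕ, E.trace = d := by
  have h1 : IsIdempotentElem (Matrix.toLin' E) := by
    change Matrix.toLin' E * Matrix.toLin' E = _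
    rw [Module.End.mul_eq_comp, ← Matrix.toLin'_mul, h]
  refine ⟨Module.finrank ℂ (LinearMap.range (Matrix.toLin' E)), ?_⟩
  rw [← Matrix.trace_toLin'_eq]
  exact (LinearMap.IsIdempotentElem.isProj_range _ h1).trace

theorem matrix_power_formula {k N : ℕ} (hN : 0 < N) (ω : ℂ) (hω : IsPrimitiveRoot ω N)
    (M : Matrix (Fin k) (Fin k) ℂ) (hM : M ^ N = 1) :
    ∃ d : ℕ → ℕ, ∀ m, (M ^ m).trace = ∑ j ∈ Finset.range N, d j * ω ^ (j * m) := by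
  have hω0 : ω ≠ 0 := hω.ne_zero hN.ne'
  have hN0 : (N : ℂ) ≠ 0 := Nat.cast_ne_zero.2 hN.ne'
  let E : ℕ → Matrix (Fin k) (Fin k) ℂ := fun j =>
    (N : ℂ)⁻¹ • ∑ i ∈ Finset.range N, (ω⁻¹ ^ j) ^ i • M ^ i
  have hME : ∀ j, M * E j = ω ^ j • E j := by
    intro j
    have h1 : ∑ i ∈ Finset.range N, (ω⁻¹ ^ j) ^ (i + 1) • M ^ (i + 1) =
        ∑ i ∈ Finset.range N, (ω⁻¹ ^ j) ^ i • M ^ i := by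
      have h2 := Finset.sum_range_succ (fun i => (ω⁻¹ ^ j) ^ i • M ^ i) N
      rw [Finset.sum_range_succ'] at h2
      have h3 : (ω⁻¹ ^ j) ^ N = 1 := by
        rw [← pow_mul, mul_comm, pow_mul, inv_pow, hω.pow_eq_one]; simp
      rw [h3, hM] at h2
      simpa using h2
    simp only [E]
    rw [mul_smul_comm, smul_comm, Finset.mul_sum]
    congr 1
    rw [← h1, Finset.smul_sum]
    refine Finset.sum_congr rfl (fun i _ => ?_)
    rw [mul_smul_comm, smul_smul, pow_succ (ω⁻¹ ^ j), pow_succ' M]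
    congr 1
    rw [mul_comm, mul_assoc, ← mul_pow, inv_mul_cancel₀ hω0]; simp
  have hME2 : ∀ j m, M ^ m * E j = ω ^ (j * m) • E j := by
    intro j m
    induction m with
    | zero => simp
    | succ m ih =>
      rw [pow_succ, mul_assoc, hME, mul_smul_comm, ih, smul_smul]
      congr 1; ring
  have hEE : ∀ j, E j * E j = E j := by
    intro j
    conv_lhs => arg 1; simp only [E]
    rw [smul_mul_assoc, Finset.sum_mul]
    have : ∀ i ∈ Finset.range N, (ω⁻¹ ^ j) ^ i • M ^ i * E j = E j := by
      intro i _
      rw [smul_mul_assoc, hME2, smul_smul, ← pow_mul, ← mul_pow, inv_mul_cancel₀ hω0]; simp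
    rw [Finset.sum_congr rfl this, Finset.sum_const, Finset.card_range,
      ← Nat.cast_smul_eq_nsmul ℂ, smul_smul, inv_mul_cancel₀ hN0, one_smul]
  have hsum : ∑ j ∈ Finset.range N, E j = 1 := by
    simp only [E]
    rw [← Finset.smul_sum, Finset.sum_comm, Finset.sum_eq_single 0]
    · simp only [pow_zero, one_smul, Finset.sum_const, Finset.card_range]
      rw [← Nat.cast_smul_eq_nsmul ℂ, smul_smul, inv_mul_cancel₀ hN0, one_smul]
    · intro i hi hi0
      rw [← Finset.sum_smul]
      have h1 : ω⁻¹ ^ i ≠ 1 := by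
        rw [inv_pow, ne_eq, inv_eq_one]
        exact hω.pow_ne_one_of_pos_of_lt hi0 (Finset.mem_range.1 hi)
      have h2 : ∑ j ∈ Finset.range N, (ω⁻¹ ^ j) ^ i = 0 := by
        have h3 := mul_geom_sum (ω⁻¹ ^ i) N
        have h4 : (ω⁻¹ ^ i) ^ N = 1 := by
          rw [← pow_mul, mul_comm, pow_mul, inv_pow, hω.pow_eq_one]; simp
        rw [h4, sub_self] at h3
        have h5 := (mul_eq_zero.1 h3).resolve_left (sub_ne_zero.2 h1)
        rw [← h5]
        exact Finset.sum_congr rfl (fun j _ => by rw [← pow_mul, ← pow_mul, mul_comm])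
      rw [h2, zero_smul]
    · intro h; exact absurd (Finset.mem_range.2 hN) h
  choose d hd using fun j => matrix_idem_trace (E j) (hEE j)
  refine ⟨d, fun m => ?_⟩
  have : M ^ m = ∑ j ∈ Finset.range N, ω ^ (j * m) • E j := by
    calc M ^ m = M ^ m * ∑ j ∈ Finset.range N, E j := by rw [hsum, mul_one]
      _ = _ := by
        rw [Finset.mul_sum]
        exact Finset.sum_congr rfl (fun j _ => hME2 j m)
  rw [this, Matrix.trace_sum]
  refine Finset.sum_congr rfl (fun j _ => ?_)
  rw [Matrix.trace_smul, hd, smul_eq_mul, mul_comm]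

theorem IsChar.power_formula {G : Type} [Group G] {f : G → ℂ} (hf : IsChar f) {N : ℕ}
    (hN : 0 < N) (ω : ℂ) (hω : IsPrimitiveRoot ω N) (g : G) (hg : g ^ N = 1) :
    ∃ d : ℕ → ℕ, ∀ m, f (g ^ m) = ∑ j ∈ Finset.range N, d j * ω ^ (j * m) := by
  obtain ⟨k, ρ, h⟩ := hf
  obtain ⟨d, hd⟩ := matrix_power_formula hN ω hω (ρ g) (by rw [← map_pow, hg, map_one])
  exact ⟨d, fun m => by rw [h, map_pow, hd]⟩

theorem alg_ext (F K L : Type) [Field F] [Field K] [Field L] [Algebra F K] [Algebra F L]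
    [IsAlgClosed K] [IsAlgClosed L] (hF : Cardinal.mk F ≤ Cardinal.aleph0)
    (hK : Cardinal.aleph0 < Cardinal.mk K) (hKL : Cardinal.mk K = Cardinal.mk L) :
    ∃ τ : K →+* L, ∀ a : F, τ (algebraMap F K a) = algebraMap F L a := by
  obtain ⟨s, hs⟩ := exists_isTranscendenceBasis F K
  obtain ⟨t, ht⟩ := exists_isTranscendenceBasis F L
  have h1 := IsAlgClosed.cardinal_eq_cardinal_transcendence_basis_of_aleph0_lt' _ hs hF hK
  have h2 := IsAlgClosed.cardinal_eq_cardinal_transcendence_basis_of_aleph0_lt' _ ht hF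
    (hKL ▸ hK)
  obtain ⟨e⟩ := Cardinal.eq.1 (h1.symm.trans (hKL.trans h2))
  have i1 := IsAlgClosed.isAlgClosure_of_transcendence_basis _ hs
  have i2 := IsAlgClosed.isAlgClosure_of_transcendence_basis _ ht
  let e' := (hs.1.aevalEquiv.symm.trans (MvPolynomial.renameEquiv F e)).trans ht.1.aevalEquiv
  refine ⟨(IsAlgClosure.equivOfEquiv K L e'.toRingEquiv : K ≃+* L).toRingHom, fun a => ?_⟩
  have h3 := IsAlgClosure.equivOfEquiv_algebraMap K L e'.toRingEquiv
    (algebraMap F (Algebra.adjoin F (Set.range ((↑) : s → K))) a)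
  have h4 : e'.toRingEquiv (algebraMap F (Algebra.adjoin F (Set.range ((↑) : s → K))) a) =
      algebraMap F _ a := e'.commutes a
  rw [h4] at h3
  exact h3

theorem exists_cyclo (n : ℕ) : ∃ (F : Type) (_ : Field F) (_ : Algebra ℚ F),
    IsCyclotomicExtension {n} ℚ F :=
  ⟨CyclotomicField n ℚ, inferInstance, CyclotomicField.algebra n ℚ, inferInstance⟩

theorem exists_tau {n m : ℕ} (hn : 0 < n) (hm : m.Coprime n) (ω : ℂ) (hω : IsPrimitiveRoot ω n) :
    ∃ τ : ℂ →+* ℂ, τ ω = ω ^ m := by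
  have : NeZero n := ⟨hn.ne'⟩
  obtain ⟨F, _, _, _⟩ := exists_cyclo n
  have hz := IsCyclotomicExtension.zeta_spec n ℚ F
  have hirr := Polynomial.cyclotomic.irreducible_rat hn
  let e := hz.embeddingsEquivPrimitiveRoots ℂ hirr
  let φ := e.symm ⟨ω, (mem_primitiveRoots hn).2 hω⟩
  let ψ := e.symm ⟨ω ^ m, (mem_primitiveRoots hn).2 (hω.pow_of_coprime m hm)⟩
  have hφ : φ (IsCyclotomicExtension.zeta n ℚ F) = ω := by
    rw [← hz.embeddingsEquivPrimitiveRoots_apply_coe ℂ hirr φ]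
    simp [φ, e]
  have hψ : ψ (IsCyclotomicExtension.zeta n ℚ F) = ω ^ m := by
    rw [← hz.embeddingsEquivPrimitiveRoots_apply_coe ℂ hirr ψ]
    simp [ψ, e]
  have hF : Cardinal.mk F ≤ Cardinal.aleph0 := by
    have : FiniteDimensional ℚ F := IsCyclotomicExtension.finiteDimensional {n} ℚ F
    have h1 := Algebra.IsAlgebraic.cardinalMk_le_max ℚ F
    simpa using h1
  have hC : Cardinal.aleph0 < Cardinal.mk ℂ := by
    rw [Cardinal.mk_complex]; exact Cardinal.aleph0_lt_continuum
  obtain ⟨τ, hτ⟩ := @alg_ext F ℂ ℂ _ _ _ φ.toRingHom.toAlgebra ψ.toRingHom.toAlgebra _ _ hF hC rfl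
  refine ⟨τ, ?_⟩
  have := hτ (IsCyclotomicExtension.zeta n ℚ F)
  rw [← hφ, ← hψ.trans (congrArg (· ^ m) hφ.symm)]
  exact this

theorem IsChar.tau {G : Type} [Group G] [Fintype G] {f : G → ℂ} (hf : IsChar f) {n m : ℕ}
    (hn : 0 < n) (hGn : Nat.card G ∣ n) {ω : ℂ} (hω : IsPrimitiveRoot ω n)
    {τ : ℂ →+* ℂ} (hτ : τ ω = ω ^ m) (g : G) : τ (f g) = f (g ^ m) := by
  have hg : g ^ n = 1 := by
    obtain ⟨c, rfl⟩ := hGn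
    rw [pow_mul, pow_card_eq_one', one_pow]
  obtain ⟨d, hd⟩ := hf.power_formula hn ω hω g hg
  rw [hd m]
  have := hd 1
  rw [pow_one] at this
  rw [this, map_sum]
  refine Finset.sum_congr rfl (fun j _ => ?_)
  rw [map_mul, map_pow, hτ, map_natCast, ← pow_mul]
  congr 2; ring

theorem Irr.pow {G : Type} [Group G] [Fintype G] {f : G → ℂ} (hf : f ∈ Irr G) {m : ℕ}
    (hm : m.Coprime (Nat.card G)) : (fun g => f (g ^ m)) ∈ Irr G := by
  have hn : 0 < Nat.card G := Nat.card_pos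
  have hω := Complex.isPrimitiveRoot_exp (Nat.card G) hn.ne'
  obtain ⟨τ, hτ⟩ := exists_tau hn hm _ hω
  have h := fun g => (Irr.isChar hf).tau hn dvd_rfl hω hτ g
  refine mem_Irr_iff.2 ⟨?_, ?_⟩
  · obtain ⟨k, ρ, hρ⟩ := Irr.isChar hf
    refine ⟨k, ((τ.mapMatrix : Matrix (Fin k) (Fin k) ℂ →+* Matrix (Fin k) (Fin k) ℂ) :
      Matrix (Fin k) (Fin k) ℂ →* Matrix (Fin k) (Fin k) ℂ).comp ρ,
      fun g => ?_⟩
    simp only [← h, hρ]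
    simp [Matrix.trace]
  · have := congrArg τ (Irr.norm hf)
    simp only [map_sum, map_mul, map_natCast, h] at this
    exact this

theorem IsChar.isIntegral {G : Type} [Group G] [Fintype G] {f : G → ℂ} (hf : IsChar f) (g : G) :
    IsIntegral ℤ (f g) := by
  have hn : 0 < Nat.card G := Nat.card_pos
  have hω := Complex.isPrimitiveRoot_exp (Nat.card G) hn.ne'
  obtain ⟨d, hd⟩ := hf.power_formula hn _ hω g pow_card_eq_one'
  have := hd 1
  rw [pow_one] at this
  rw [this]
  refine IsIntegral.sum _ (fun j _ => IsIntegral.mul ?_ ((hω.isIntegral hn).pow _))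
  exact_mod_cast isIntegral_algebraMap (R := ℤ) (A := ℂ) (x := (d j : ℤ))

theorem galois_descend {n p : ℕ} (hn : 0 < n) (hpn : p ∣ n) {ω ζ : ℂ} (hω : IsPrimitiveRoot ω n)
    (hζ : IsPrimitiveRoot ζ p) (d : ℕ → ℕ)
    (h : ∀ k : ℕ, k.Coprime n → k ≡ 1 [MOD p] →
      ∑ j ∈ Finset.range n, (d j : ℂ) * ω ^ (j * k) = ∑ j ∈ Finset.range n, (d j : ℂ) * ω ^ j) :
    ∑ j ∈ Finset.range n, (d j : ℂ) * ω ^ j ∈ Subfield.closure {ζ} := by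
  have : NeZero n := ⟨hn.ne'⟩
  obtain ⟨F, _, _, _⟩ := exists_cyclo n
  obtain ⟨c, hc⟩ := hpn
  have hp0 : 0 < p := Nat.pos_of_mul_pos_right (hc ▸ hn)
  have : NeZero p := ⟨hp0.ne'⟩
  have hc0 : 0 < c := Nat.pos_of_mul_pos_left (hc ▸ hn)
  have hz := IsCyclotomicExtension.zeta_spec n ℚ F
  set z := IsCyclotomicExtension.zeta n ℚ F with hzdef
  have hirr := Polynomial.cyclotomic.irreducible_rat hn
  let e := hz.embeddingsEquivPrimitiveRoots ℂ hirr
  let φ := e.symm ⟨ω, (mem_primitiveRoots hn).2 hω⟩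
  have hφ : φ z = ω := by
    rw [← hz.embeddingsEquivPrimitiveRoots_apply_coe ℂ hirr φ]
    simp [φ, e]
  let y : F := ∑ j ∈ Finset.range n, (d j : F) * z ^ j
  have hy : φ y = ∑ j ∈ Finset.range n, (d j : ℂ) * ω ^ j := by
    simp [y, hφ]
  let K0 := IntermediateField.adjoin ℚ {z ^ c}
  have hgal : IsGalois ℚ F := IsCyclotomicExtension.isGalois {n} ℚ F
  have hfd : FiniteDimensional ℚ F := IsCyclotomicExtension.finiteDimensional {n} ℚ F
  have hyK : y ∈ K0 := by
    rw [← IsGalois.fixedField_fixingSubgroup K0, IntermediateField.mem_fixedField_iff]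
    intro σ hσ
    have h1 : IsPrimitiveRoot (σ z) n := hz.map_of_injective σ.injective
    obtain ⟨k, -, hk, hkz⟩ := hz.isPrimitiveRoot_iff.1 h1
    have h2 : σ (z ^ c) = z ^ c :=
      (IntermediateField.mem_fixingSubgroup_iff _ _).1 hσ _
        (IntermediateField.mem_adjoin_simple_self ℚ _)
    have hzc : IsPrimitiveRoot (z ^ c) p := hz.pow hn (by rw [hc, mul_comm])
    have h3 : k ≡ 1 [MOD p] := by
      rw [hzc.eq_orderOf, 
        ← (isOfFinOrder_iff_pow_eq_one.2 ⟨p, hp0, hzc.pow_eq_one⟩).pow_eq_pow_iff_modEq, pow_one]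
      rw [map_pow, ← hkz, ← pow_mul, mul_comm, pow_mul] at h2
      exact h2
    have h4 := h k hk h3
    apply φ.injective
    change φ (σ y) = φ y
    rw [hy, ← h4]
    simp only [y, map_sum, map_mul, map_pow, map_natCast, ← hkz, hφ]
    refine Finset.sum_congr rfl (fun j _ => ?_)
    rw [← pow_mul]; congr 2; ring
  rw [← hy]
  let S : IntermediateField ℚ ℂ := (Subfield.closure {ζ}).toIntermediateField (fun q => by
    rw [eq_ratCast]; exact SubfieldClass.ratCast_mem _ q)
  have h5 : φ y ∈ K0.map φ := ⟨y, hyK, rfl⟩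
  have h6 : K0.map φ ≤ S := by
    rw [IntermediateField.adjoin_map, IntermediateField.adjoin_le_iff, Set.image_singleton,
      Set.singleton_subset_iff]
    have h7 : IsPrimitiveRoot (φ (z ^ c)) p :=
      (hz.pow hn (by rw [hc, mul_comm])).map_of_injective φ.injective
    obtain ⟨i, -, hi⟩ := hζ.eq_pow_of_pow_eq_one h7.pow_eq_one
    change φ (z ^ c) ∈ Subfield.closure {ζ}
    have h8 : ζ ∈ Subfield.closure {ζ} := Subfield.subset_closure (Set.mem_singleton _)
    have h9 : ζ ^ i ∈ Subfield.closure {ζ} := pow_mem h8 i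
    rwa [hi] at h9
  exact h6 h5

end chars3

section nt

theorem exists_pow_one_add {p a : ℕ} [Fact p.Prime] (hp2 : p ≠ 2) (k : ℕ) (hk : k ≡ 1 [MOD p]) :
    ∃ j, (1 + p) ^ j ≡ k [MOD p ^ (a + 1)] := by
  have hp := Fact.out (p := p.Prime)
  have hpn : p ∣ p ^ (a + 1) := dvd_pow_self p (Nat.succ_ne_zero a)
  have : NeZero (p ^ (a + 1)) := ⟨pow_ne_zero _ hp.ne_zero⟩
  let φ := ZMod.unitsMap hpn
  have hsurj : Function.Surjective φ := ZMod.unitsMap_surjective hpn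
  have hcard : Nat.card φ.ker = p ^ a := by
    have h1 := Subgroup.card_mul_index φ.ker
    rw [Subgroup.index_ker, MonoidHom.range_eq_top.2 hsurj, Subgroup.card_top] at h1
    rw [Nat.card_eq_fintype_card (α := (ZMod p)ˣ), Nat.card_eq_fintype_card (α := (ZMod (p ^ (a+1)))ˣ),
      ZMod.card_units_eq_totient, ZMod.card_units_eq_totient, Nat.totient_prime hp,
      Nat.totient_prime_pow_succ hp] at h1
    exact Nat.eq_of_mul_eq_mul_right (Nat.sub_pos_of_lt hp.one_lt) h1
  have hcop : ∀ x : ℕ, x ≡ 1 [MOD p] → x.Coprime (p ^ (a + 1)) := by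
    intro x hx
    apply Nat.Coprime.pow_right
    rw [Nat.coprime_comm, hp.coprime_iff_not_dvd]
    intro hd
    have h1 : 0 ≡ 1 [MOD p] := ((Nat.modEq_zero_iff_dvd.2 hd).symm).trans hx
    have h2 := (Nat.modEq_zero_iff_dvd.1 h1.symm)
    exact hp.one_lt.ne' (Nat.dvd_one.1 h2)
  have hker : ∀ x : ℕ, ∀ hx : x ≡ 1 [MOD p], ZMod.unitOfCoprime x (hcop x hx) ∈ φ.ker := by
    intro x hx
    rw [MonoidHom.mem_ker]
    apply Units.ext
    rw [ZMod.unitsMap_val, ZMod.coe_unitOfCoprime, ZMod.cast_natCast hpn, Units.val_one]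
    have := (ZMod.natCast_eq_natCast_iff x 1 p).2 hx
    simpa using this
  have h1p : 1 + p ≡ 1 [MOD p] := by simp [Nat.ModEq]
  set u := ZMod.unitOfCoprime (1 + p) (hcop _ h1p) with hu
  have hord : orderOf u = p ^ a := by
    rw [← orderOf_units, hu, ZMod.coe_unitOfCoprime]
    have := ZMod.orderOf_one_add_prime hp hp2 a
    simpa using this
  have hle : Subgroup.zpowers u ≤ φ.ker := by
    rw [Subgroup.zpowers_le]; exact hker _ h1p
  have heq : Subgroup.zpowers u = φ.ker := by
    apply Subgroup.eq_of_le_of_card_ge hle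
    rw [hcard, Nat.card_zpowers, hord]
  have hkm := hker k hk
  rw [← heq] at hkm
  obtain ⟨j, hj⟩ := (isOfFinOrder_of_finite u).mem_powers_iff_mem_zpowers.2 hkm
  refine ⟨j, ?_⟩
  rw [← ZMod.natCast_eq_natCast_iff]
  have := congrArg Units.val hj
  simp only [Units.val_pow_eq_pow_val, hu, ZMod.coe_unitOfCoprime] at this
  push_cast at this ⊢
  exact this

end nt

section even

/-- parity of integral sums with an involution -/
theorem even_sum {G : Type} [Fintype G] (F : G → ℂ) (hF : ∀ g, IsIntegral ℤ (F g))
    (i : G → G) (hi : ∀ g, i (i g) = g) (hFi : ∀ g, F (i g) = F g)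
    (h0 : ∀ g, i g = g → F g = 0) (k : ℤ) (hk : ∑ g, F g = k) : Even k := by
  classical
  let A := integralClosure ℤ ℂ
  let f : G → A := fun g => ⟨F g, hF g⟩
  have hsum : ∑ g, f g = (k : A) := by
    apply Subtype.ext
    push_cast
    exact hk
  let I : Ideal A := Ideal.span {(2 : A)}
  have h2 : ∀ x : A ⧸ I, x + x = 0 := by
    intro x
    obtain ⟨y, rfl⟩ := Ideal.Quotient.mk_surjective x
    rw [← map_add, Ideal.Quotient.eq_zero_iff_mem, ← two_mul]
    exact Ideal.mul_mem_right _ _ (Ideal.subset_span rfl)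
  have hz : ∑ g, Ideal.Quotient.mk I (f g) = 0 := by
    apply Finset.sum_involution (fun g _ => i g)
    · intro g _
      have : f (i g) = f g := Subtype.ext (hFi g)
      rw [this]; exact h2 _
    · intro g _ hne hig
      apply hne
      have : f g = 0 := Subtype.ext (h0 g hig)
      rw [this, map_zero]
    · intro g _; exact Finset.mem_univ _
    · intro g _; exact hi g
  rw [← map_sum, hsum, Ideal.Quotient.eq_zero_iff_mem, Ideal.mem_span_singleton] at hz
  obtain ⟨y, hy⟩ := hz
  have hy' : (k : ℂ) = 2 * (y : ℂ) := by
    have := congrArg (Subtype.val) hy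
    push_cast at this
    exact this
  have hyi : IsIntegral ℤ (algebraMap ℚ ℂ ((k : ℚ) / 2)) := by
    have h3 : algebraMap ℚ ℂ ((k : ℚ) / 2) = (y : ℂ) := by
      rw [map_div₀]; simp [hy']
    rw [h3]; exact y.2
  have h4 : IsIntegral ℤ ((k : ℚ) / 2) :=
    (isIntegral_algebraMap_iff (algebraMap ℚ ℂ).injective).1 hyi
  obtain ⟨z, hz⟩ := IsIntegrallyClosed.isIntegral_iff.1 h4
  have : (k : ℚ) = z + z := by
    have : (z : ℚ) = k / 2 := by simpa using hz
    rw [this]; ring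
  exact ⟨z, by exact_mod_cast this⟩

variable {G : Type} [Group G] [Fintype G]

theorem eq_one_of_inv_eq (hodd : Odd (Nat.card G)) {g : G} (h : g⁻¹ = g) : g = 1 := by
  have h2 : g ^ 2 = 1 := by rw [pow_two]; nth_rewrite 1 [← h]; exact inv_mul_cancel g
  have h1 : orderOf g ∣ 2 := orderOf_dvd_of_pow_eq_one h2
  have h3 : orderOf g ∣ Nat.card G := orderOf_dvd_natCard g
  have h4 : orderOf g ∣ 1 := by
    rw [← (Nat.coprime_two_left.2 hodd).gcd_eq_one]; exact Nat.dvd_gcd h1 h3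
  exact orderOf_eq_one_iff.1 (Nat.dvd_one.1 h4)

theorem IsChar.one_nat {f : G → ℂ} (hf : IsChar f) : ∃ n : ℕ, f 1 = n := by
  obtain ⟨n, ρ, h⟩ := hf
  exact ⟨n, by rw [h, map_one, Matrix.trace_one]; simp⟩

theorem Irr.odd_deg (hodd : Odd (Nat.card G)) {f : G → ℂ} (hf : f ∈ Irr G) :
    ∃ n : ℕ, f 1 = n ∧ Odd n := by
  classical
  obtain ⟨n, hn⟩ := (Irr.isChar hf).one_nat
  refine ⟨n, hn, ?_⟩
  have h1 := (mem_Irr_iff.1 hf).2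
  have h2 : Even ((Nat.card G : ℤ) - n ^ 2) := by
    apply even_sum (fun g : G => if g = 1 then 0 else f g * f g⁻¹) _ (fun g => g⁻¹)
    · intro g; exact inv_inv g
    · intro g; simp [mul_comm]
    · intro g hg; simp [eq_one_of_inv_eq hodd hg]
    · push_cast
      rw [← h1, ← hn]
      rw [← Finset.add_sum_erase _ _ (Finset.mem_univ (1 : G)), ← Finset.add_sum_erase _ (fun g => f g * f g⁻¹) (Finset.mem_univ (1 : G))]
      rw [Finset.sum_congr rfl (g := fun g => f g * f g⁻¹)]
      · simp; ring
      · intro x hx; simp [Finset.ne_of_mem_erase hx]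
    · intro g
      by_cases hg : g = 1
      · simp [hg, isIntegral_zero]
      · simp only [hg, if_false]
        exact ((Irr.isChar hf).isIntegral g).mul ((Irr.isChar hf).isIntegral _)
  rw [Int.even_sub] at h2
  by_contra hne
  rw [Nat.not_odd_iff_even] at hne
  have h3 : Even ((n : ℤ)^2) := by
    have : Even (n : ℤ) := by exact_mod_cast hne
    exact this.pow_of_ne_zero two_ne_zero
  have h4 := h2.2 h3
  have h5 : Even (Nat.card G) := by exact_mod_cast h4
  exact (Nat.not_even_iff_odd.2 hodd) h5

end even

section count

theorem num_data {p N : ℕ} [Fact p.Prime] (hp2 : p ≠ 2) (hN : Odd N) :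
    ∃ a r m : ℕ, p * N = p ^ (a + 1) * r ∧ r.Coprime p ∧ m ≡ 1 + p [MOD p ^ (a + 1)] ∧ r ∣ m + 1 ∧
      m ^ (p ^ a) ≡ 1 [MOD p ^ (a + 1)] ∧ r ∣ m ^ (p ^ a) + 1 ∧ m.Coprime (p * N) ∧ 0 < r := by
  have hp := Fact.out (p := p.Prime)
  have hN0 : N ≠ 0 := by rintro rfl; simp at hN
  obtain ⟨a, r, hr, hNr⟩ := Nat.exists_eq_pow_mul_and_not_dvd hN0 p hp.ne_one
  have hr0 : 0 < r := Nat.pos_of_ne_zero (by rintro rfl; simp at hr)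
  have hrp : r.Coprime p := ((hp.coprime_iff_not_dvd).2 hr).symm
  have hcop : (p ^ (a + 1)).Coprime r := (hrp.pow_right _).symm
  obtain ⟨m, hm1, hm2⟩ := Nat.chineseRemainder hcop (1 + p) (r - 1)
  have hrm : r ∣ m + 1 := by
    have := hm2.add_right 1
    rw [Nat.sub_add_cancel hr0] at this
    exact (Nat.modEq_zero_iff_dvd).1 (this.trans (by simp [Nat.ModEq]))
  have hpow : (1 + p) ^ (p ^ a) ≡ 1 [MOD p ^ (a + 1)] := by
    have := ZMod.orderOf_one_add_prime hp hp2 a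
    have h2 := pow_orderOf_eq_one (1 + p : ZMod (p ^ (a + 1)))
    rw [this] at h2
    rw [← ZMod.natCast_eq_natCast_iff]
    push_cast
    exact_mod_cast h2
  have hodd : Odd (p ^ a) := (hp.odd_of_ne_two hp2).pow
  refine ⟨a, r, m, ?_, hrp, hm1, hrm, (hm1.pow _).trans hpow, ?_, ?_, hr0⟩
  · rw [hNr]; ring
  · have := hodd.nat_add_dvd_pow_add_pow m 1
    rw [one_pow] at this
    exact hrm.trans this
  · have : p * N = p ^ (a + 1) * r := by rw [hNr]; ring
    rw [this]
    apply Nat.Coprime.mul_right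
    · apply Nat.Coprime.pow_right
      rw [Nat.coprime_comm, hp.coprime_iff_not_dvd]
      intro hd
      have h1 : m ≡ 1 + p [MOD p] := hm1.of_dvd (dvd_pow_self p (Nat.succ_ne_zero a))
      have h2 : 1 + p ≡ 0 [MOD p] := h1.symm.trans (Nat.modEq_zero_iff_dvd.2 hd)
      have h3 := Nat.modEq_zero_iff_dvd.1 h2
      have h4 : p ∣ 1 := (Nat.dvd_add_left (dvd_refl p)).1 h3
      exact hp.one_lt.ne' (Nat.dvd_one.1 h4)
    · have : m.Coprime (m + 1) := by simp
      exact this.coprime_dvd_right hrm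

variable {G : Type} [Group G] [Fintype G]

theorem pow_eq_pow_of_modEq' {n x y : ℕ} (hn : Nat.card G ∣ n) (h : x ≡ y [MOD n]) (g : G) :
    g ^ x = g ^ y :=
  pow_eq_pow_iff_modEq.2 (h.of_dvd ((orderOf_dvd_natCard g).trans hn))

theorem pel_pow {p a r : ℕ} [Fact p.Prime] (hpN : p * Nat.card G = p ^ (a + 1) * r) (hr : r.Coprime p)
    {g : G} (hg : ∃ k, g ^ p ^ k = 1) : g ^ p ^ (a + 1) = 1 := by
  obtain ⟨k, hk⟩ := hg
  have h1 := orderOf_dvd_of_pow_eq_one hk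
  have h2 : orderOf g ∣ p ^ (a + 1) * r := by
    rw [← hpN]; exact (orderOf_dvd_natCard g).mul_left p
  apply orderOf_dvd_iff_pow_eq_one.1
  have h3 : (orderOf g).Coprime r := (Nat.Coprime.pow_right k hr).symm.coprime_dvd_left h1
  exact h3.dvd_of_dvd_mul_right h2

theorem conj_inv_eq_one (hodd : Odd (Nat.card G)) {h : G} (hc : IsConj h h⁻¹) : h = 1 := by
  obtain ⟨x, hx⟩ := isConj_iff.1 hc
  have h2 : Commute (x ^ 2) h := by
    have : x ^ 2 * h * (x ^ 2)⁻¹ = h := by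
      have e : x ^ 2 * h * (x ^ 2)⁻¹ = x * (x * h * x⁻¹) * x⁻¹ := by rw [pow_two]; group
      rw [e, hx]
      have e2 : x * h⁻¹ * x⁻¹ = (x * h * x⁻¹)⁻¹ := by group
      rw [e2, hx, inv_inv]
    exact mul_inv_eq_iff_eq_mul.1 this
  obtain ⟨t, ht⟩ := hodd
  have hx2 : (x ^ 2) ^ (t + 1) = x := by
    rw [← pow_mul, show 2 * (t + 1) = Nat.card G + 1 by omega, pow_succ, pow_card_eq_one', one_mul]
  have h3 : Commute x h := by
    have := h2.pow_left (t + 1)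
    rwa [hx2] at this
  apply eq_one_of_inv_eq ⟨t, ht⟩
  rw [← hx, h3.eq]; group

theorem isConj_pow_iff {p a r m : ℕ} [Fact p.Prime] (hodd : Odd (Nat.card G))
    (hpN : p * Nat.card G = p ^ (a + 1) * r) (hr : r.Coprime p) (hm1 : m ≡ 1 + p [MOD p ^ (a + 1)])
    (hσ2 : r ∣ m ^ (p ^ a) + 1) (g : G) :
    IsConj g (g ^ m) ↔ (∃ k, g ^ p ^ k = 1) ∧ IsConj g (g ^ (1 + p)) := by
  constructor
  · intro h
    have hj : ∀ j, IsConj g (g ^ (m ^ j)) := by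
      intro j
      induction j with
      | zero => rw [pow_zero, pow_one]
      | succ j ih =>
        refine ih.trans ?_
        obtain ⟨x, hx⟩ := isConj_iff.1 h
        refine isConj_iff.2 ⟨x, ?_⟩
        rw [← conj_pow, hx, ← pow_mul, pow_succ, mul_comm]
    have h1 : g ^ p ^ (a + 1) = 1 := by
      apply conj_inv_eq_one hodd
      obtain ⟨x, hx⟩ := isConj_iff.1 (hj (p ^ a))
      refine isConj_iff.2 ⟨x, ?_⟩
      rw [← conj_pow, hx, ← pow_mul, eq_inv_iff_mul_eq_one, ← pow_add]
      obtain ⟨t, ht⟩ := hσ2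
      have : m ^ p ^ a * p ^ (a + 1) + p ^ (a + 1) = Nat.card G * (p * t) := by
        calc _ = (m ^ p ^ a + 1) * p ^ (a + 1) := by ring
          _ = (p ^ (a + 1) * r) * t := by rw [ht]; ring
          _ = _ := by rw [← hpN]; ring
      rw [this, pow_mul, pow_card_eq_one', one_pow]
    refine ⟨⟨_, h1⟩, ?_⟩
    have : g ^ m = g ^ (1 + p) :=
      pow_eq_pow_iff_modEq.2 (hm1.of_dvd (orderOf_dvd_of_pow_eq_one h1))
    rwa [this] at h
  · rintro ⟨hk, h⟩
    have h1 := pel_pow hpN hr hk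
    have : g ^ m = g ^ (1 + p) :=
      pow_eq_pow_iff_modEq.2 (hm1.of_dvd (orderOf_dvd_of_pow_eq_one h1))
    rwa [this]

theorem mem_Sp_iff {p a r m : ℕ} [Fact p.Prime] (hp2 : p ≠ 2) (hodd : Odd (Nat.card G))
    (hpN : p * Nat.card G = p ^ (a + 1) * r) (hr : r.Coprime p) (hm1 : m ≡ 1 + p [MOD p ^ (a + 1)])
    (hσ1 : m ^ (p ^ a) ≡ 1 [MOD p ^ (a + 1)])
    (hσ2 : r ∣ m ^ (p ^ a) + 1) (hm : m.Coprime (p * Nat.card G)) {ζ : ℂ} (hζ : IsPrimitiveRoot ζ p)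
    {f : G → ℂ} (hf : f ∈ Irr G) :
    (∀ g, f g ∈ Subfield.closure {ζ}) ↔ ∀ g, f (g ^ m) = f g := by
  have hp := Fact.out (p := p.Prime)
  set n := p * Nat.card G with hn
  have hn0 : 0 < n := Nat.mul_pos hp.pos Nat.card_pos
  have hne : NeZero n := ⟨hn0.ne'⟩
  have hω := Complex.isPrimitiveRoot_exp n hn0.ne'
  set ω := Complex.exp (2 * Real.pi * Complex.I / n) with hωd
  have hGn : Nat.card G ∣ n := Dvd.intro_left p rfl
  have hpm : m ≡ 1 [MOD p] := by
    have h1 : m ≡ 1 + p [MOD p] := hm1.of_dvd (dvd_pow_self p (Nat.succ_ne_zero a))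
    exact h1.trans (by simp [Nat.ModEq])
  constructor
  · intro h g
    obtain ⟨τ, hτ⟩ := exists_tau hn0 hm ω hω
    rw [← IsChar.tau (Irr.isChar hf) hn0 hGn hω hτ g]
    have hζn : ζ ^ n = 1 := by rw [hn, pow_mul, hζ.pow_eq_one, one_pow]
    obtain ⟨i, hi, hiω⟩ := hω.eq_pow_of_pow_eq_one hζn
    have hτζ : τ ζ = ζ := by
      have h1 : ζ ^ m = ζ ^ 1 := (((isOfFinOrder_iff_pow_eq_one.2 ⟨p, hp.pos, hζ.pow_eq_one⟩).pow_eq_pow_iff_modEq).2 (by rw [← hζ.eq_orderOf]; exact hpm))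
      rw [pow_one] at h1
      nth_rewrite 2 [← h1]
      rw [← hiω, map_pow, hτ, ← pow_mul, ← pow_mul, mul_comm]
    have hE : Set.EqOn τ (RingHom.id ℂ) (Subfield.closure {ζ} : Subfield ℂ) := by
      apply RingHom.eqOn_field_closure
      intro x hx
      rw [Set.mem_singleton_iff.1 hx]
      exact hτζ
    exact hE (h g)
  · intro h g
    have hj : ∀ j g, f (g ^ (m ^ j)) = f g := by
      intro j
      induction j with
      | zero => simp
      | succ j ih => intro g; rw [pow_succ, pow_mul, h, ih]
    have hinv : ∀ g : G, (g ^ (m ^ p ^ a)) ^ (m ^ p ^ a) = g := by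
      intro g
      rw [← pow_mul]
      conv_rhs => rw [← pow_one g]
      apply pow_eq_pow_of_modEq' hGn
      rw [hpN]
      refine (Nat.modEq_and_modEq_iff_modEq_mul (hr.pow_right _).symm).1 ⟨?_, ?_⟩
      · exact hσ1.mul hσ1
      · have hs : 1 ≤ m ^ p ^ a * m ^ p ^ a := by
          have : 0 < m ^ p ^ a := by
            apply pow_pos
            rcases Nat.eq_zero_or_pos m with h0 | h0
            · subst h0
              have := Nat.modEq_zero_iff_dvd.1 hpm.symm
              exact absurd (Nat.dvd_one.1 this) hp.one_lt.ne'
            · exact h0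
          exact Nat.mul_pos this this
        apply Nat.ModEq.symm
        rw [Nat.modEq_iff_dvd' hs]
        obtain ⟨t, ht⟩ := hσ2
        refine ⟨t * (m ^ p ^ a - 1), ?_⟩
        rw [← mul_assoc, ← ht]
        have := Nat.mul_self_sub_mul_self_eq (m ^ p ^ a) 1
        simpa using this
    have hfix : ∀ g : G, g ^ (m ^ p ^ a) = g → g ^ p ^ (a + 1) = 1 := by
      intro g hg
      have h1 : IsConj g (g ^ (m ^ p ^ a)) := by rw [hg]
      apply eq_one_of_inv_eq hodd
      rw [inv_eq_iff_mul_eq_one]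
      nth_rewrite 1 [← hg]
      rw [← pow_mul, ← pow_add]
      obtain ⟨t, ht⟩ := hσ2
      have : m ^ p ^ a * p ^ (a + 1) + p ^ (a + 1) = Nat.card G * (p * t) := by
        calc _ = (m ^ p ^ a + 1) * p ^ (a + 1) := by ring
          _ = (p ^ (a + 1) * r) * t := by rw [ht]; ring
          _ = _ := by rw [← hpN, hn]; ring
      rw [this, pow_mul, pow_card_eq_one', one_pow]
    have hk : ∀ k : ℕ, k.Coprime n → k ≡ 1 [MOD p] → ∀ g, f (g ^ k) = f g := by
      intro k hkn hkp
      have hψ := Irr.pow hf (hkn.coprime_dvd_right hGn)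
      by_contra hcon
      have hneq : (fun g => f (g ^ k)) ≠ f := fun e => hcon (fun g => congrFun e g)
      have h1 := (mem_Irr_iff.1 hf).2
      have h2 := Irr.orth hψ hf hneq
      obtain ⟨j, hjk⟩ := exists_pow_one_add (a := a) hp2 k hkp
      have hev : Even ((Nat.card G : ℤ)) := by
        apply even_sum (fun g : G => (f g - f (g ^ k)) * f g⁻¹) _ (fun g => g ^ (m ^ p ^ a)) hinv
        · intro g
          have e1 : (g ^ m ^ p ^ a) ^ k = (g ^ k) ^ m ^ p ^ a := by rw [← pow_mul, ← pow_mul, mul_comm]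
          rw [e1, ← inv_pow, hj, hj, hj]
        · intro g hg
          have h3 := hfix g hg
          have : g ^ k = g ^ (m ^ j) := by
            apply pow_eq_pow_iff_modEq.2
            exact (hjk.symm.trans (hm1.symm.pow j)).of_dvd (orderOf_dvd_of_pow_eq_one h3)
          rw [this, hj, sub_self, zero_mul]
        · simp only [sub_mul, Finset.sum_sub_distrib]
          rw [h1, h2]; simp
        · intro g
          exact (((Irr.isChar hf).isIntegral g).sub ((Irr.isChar hf).isIntegral _)).mul ((Irr.isChar hf).isIntegral _)
      exact (Nat.not_even_iff_odd.2 hodd) (by exact_mod_cast hev)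
    have hgn : g ^ n = 1 := by rw [hn, mul_comm, pow_mul, pow_card_eq_one', one_pow]
    obtain ⟨d, hd⟩ := IsChar.power_formula (Irr.isChar hf) hn0 ω hω g hgn
    have h1 := hd 1
    rw [pow_one] at h1
    rw [h1]
    simp only [mul_one]
    apply galois_descend hn0 (Dvd.intro _ rfl) hω hζ d
    intro k hkn hkp
    have := hk k hkn hkp g
    rw [hd k, h1] at this
    simpa using this

/-- The number of stable classes of `p`-elements. -/
noncomputable def Kc (p : ℕ) (G : Type) [Group G] : ℕ :=
  (ConjClasses.mk '' {x : G | (∃ k, x ^ p ^ k = 1) ∧ IsConj x (x ^ (1 + p))}).ncard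

/-- The set of cyclotomic irreducible characters. -/
def Sp (ζ : ℂ) (G : Type) [Group G] : Set (G → ℂ) :=
  {f ∈ Irr G | ∀ g, f g ∈ Subfield.closure {ζ}}

theorem Sp_ncard {p : ℕ} [Fact p.Prime] (hp2 : p ≠ 2) (hodd : Odd (Nat.card G))
    {ζ : ℂ} (hζ : IsPrimitiveRoot ζ p) : (Sp ζ G).ncard = Kc p G := by
  obtain ⟨a, r, m, hpN, hr, hm1, hrm, hσ1, hσ2, hm, hr0⟩ := num_data (p := p) hp2 hodd
  have h1 := count_fixed (G := G) m (fun f hf => Irr.pow hf (hm.coprime_dvd_right (Dvd.intro_left p rfl)))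
  have h2 : {f ∈ Irr G | ∀ g, f (g ^ m) = f g} = Sp ζ G := by
    ext f
    constructor
    · rintro ⟨hf, h⟩
      exact ⟨hf, (mem_Sp_iff hp2 hodd hpN hr hm1 hσ1 hσ2 hm hζ hf).2 h⟩
    · rintro ⟨hf, h⟩
      exact ⟨hf, (mem_Sp_iff hp2 hodd hpN hr hm1 hσ1 hσ2 hm hζ hf).1 h⟩
  rw [← h2, h1, Kc]
  congr 2
  ext g
  exact isConj_pow_iff hodd hpN hr hm1 hσ2 g

end count

section lin

/-- linear characters with `p`-th power trivial -/
noncomputable def Lam (p : ℕ) (G : Type) [Group G] : Subgroup (G →* ℂˣ) := (powMonoidHom p).ker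

noncomputable def Dl (p : ℕ) (G : Type) [Group G] : ℕ := Nat.card (Lam p G)

def toC {G : Type} [Group G] (l : G →* ℂˣ) : G → ℂ := fun g => (l g : ℂ)

theorem toC_inj {G : Type} [Group G] : Function.Injective (toC (G := G)) := by
  intro l l' h
  ext g
  exact congrFun h g

theorem mem_Lam {p : ℕ} {G : Type} [Group G] {l : G →* ℂˣ} : l ∈ Lam p G ↔ ∀ g, l g ^ p = 1 := by
  rw [Lam, MonoidHom.mem_ker]
  constructor
  · intro h g
    have := DFunLike.congr_fun h g
    simpa using this
  · intro h
    ext g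
    have := h g
    simp [this]

variable {G : Type} [Group G] [Fintype G]

theorem IsChar.twist {f : G → ℂ} (hf : IsChar f) (l : G →* ℂˣ) : IsChar (fun g => toC l g * f g) := by
  obtain ⟨n, ρ, h⟩ := hf
  refine ⟨n, { toFun := fun g => toC l g • ρ g, map_one' := by simp [toC], map_mul' := ?_ }, ?_⟩
  · intro x y
    simp only [toC, map_mul, Units.val_mul, Matrix.smul_mul, Matrix.mul_smul, smul_smul]
    rw [mul_comm]
  · intro g
    simp [Matrix.trace_smul, h]

theorem Irr.twist {f : G → ℂ} (hf : f ∈ Irr G) (l : G →* ℂˣ) : (fun g => toC l g * f g) ∈ Irr G := by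
  refine mem_Irr_iff.2 ⟨(Irr.isChar hf).twist l, ?_⟩
  rw [← (mem_Irr_iff.1 hf).2]
  apply Finset.sum_congr rfl
  intro g _
  have : toC l g * toC l g⁻¹ = 1 := by simp [toC]
  calc _ = (toC l g * toC l g⁻¹) * (f g * f g⁻¹) := by ring
    _ = _ := by rw [this, one_mul]

theorem toC_irr (l : G →* ℂˣ) : toC l ∈ Irr G := by
  refine mem_Irr_iff.2 ⟨⟨1, { toFun := fun g => toC l g • 1, map_one' := by simp [toC], map_mul' := ?_ }, ?_⟩, ?_⟩
  · intro x y
    simp only [toC, map_mul, Units.val_mul, Matrix.smul_mul, Matrix.mul_smul, smul_smul, mul_one]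
    rw [mul_comm]
  · intro g
    simp [Matrix.trace_smul]
  · have : ∀ g, toC l g * toC l g⁻¹ = 1 := by intro g; simp [toC]
    simp [this]

theorem toC_mem_closure {p : ℕ} [Fact p.Prime] {ζ : ℂ} (hζ : IsPrimitiveRoot ζ p) {l : G →* ℂˣ}
    (hl : l ∈ Lam p G) (g : G) : toC l g ∈ Subfield.closure {ζ} := by
  have hp := Fact.out (p := p.Prime)
  have : NeZero p := ⟨hp.ne_zero⟩
  have h1 : toC l g ^ p = 1 := by
    have := mem_Lam.1 hl g
    rw [toC, ← Units.val_pow_eq_pow_val, this, Units.val_one]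
  obtain ⟨i, _, hi⟩ := hζ.eq_pow_of_pow_eq_one h1
  rw [← hi]
  exact pow_mem (Subfield.subset_closure (Set.mem_singleton ζ)) i

theorem toC_mem_Sp {p : ℕ} [Fact p.Prime] {ζ : ℂ} (hζ : IsPrimitiveRoot ζ p) {l : G →* ℂˣ}
    (hl : l ∈ Lam p G) : toC l ∈ Sp ζ G := ⟨toC_irr l, toC_mem_closure hζ hl⟩

theorem Sp_finite (ζ : ℂ) : (Sp ζ G).Finite := Irr.finite.subset (fun _ h => h.1)

theorem Lam_finite (p : ℕ) (G : Type) [Group G] [Fintype G] : Finite (Lam p G) := by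
  have := (Irr.finite (G := G)).to_subtype
  exact Finite.of_injective (fun l : Lam p G => (⟨toC l.1, toC_irr l.1⟩ : Irr G))
    (fun l l' h => Subtype.ext (toC_inj (congrArg Subtype.val h)))

theorem Dl_pos (p : ℕ) (G : Type) [Group G] [Fintype G] : 0 < Dl p G := by
  have := Lam_finite p G
  exact Nat.card_pos

theorem Sp_linear {p : ℕ} [Fact p.Prime] (hp2 : p ≠ 2) (hodd : Odd (Nat.card G))
    {ζ : ℂ} (hζ : IsPrimitiveRoot ζ p) {f : G → ℂ} (hf : f ∈ Sp ζ G) (h1 : f 1 = 1) :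
    ∃ l ∈ Lam p G, toC l = f := by
  obtain ⟨a, r, m, hpN, hr, hm1, hrm, hσ1, hσ2, hm, hr0⟩ := num_data (p := p) hp2 hodd
  have hfix := (mem_Sp_iff hp2 hodd hpN hr hm1 hσ1 hσ2 hm hζ hf.1).1 hf.2
  obtain ⟨n, ρ, h⟩ := Irr.isChar hf.1
  have hn : n = 1 := by
    have := h 1
    rw [h1, map_one, Matrix.trace_one, Fintype.card_fin] at this
    exact_mod_cast this.symm
  subst hn
  let l : G →* ℂˣ := MonoidHom.toHomUnits (Matrix.detMonoidHom.comp ρ)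
  have hlf : toC l = f := by
    funext g
    rw [h]
    simp [toC, l, Matrix.trace_fin_one]
  refine ⟨l, ?_, hlf⟩
  rw [mem_Lam]
  intro g
  have hlm : l g ^ m = l g := by
    have := hfix g
    rw [← hlf] at this
    rw [← map_pow]
    exact Units.ext this
  have hls : ∀ j, l g ^ (m ^ j) = l g := by
    intro j
    induction j with
    | zero => simp
    | succ j ih => rw [pow_succ, pow_mul, ih, hlm]
  have hμ : (l g ^ p ^ (a + 1)) = 1 := by
    have h2 : (l g ^ p ^ (a + 1)) ^ 2 = 1 := by
      rw [pow_two]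
      nth_rewrite 1 [← hls (p ^ a)]
      rw [← pow_mul, ← pow_add]
      obtain ⟨t, ht⟩ := hσ2
      have : m ^ p ^ a * p ^ (a + 1) + p ^ (a + 1) = Nat.card G * (p * t) := by
        calc _ = (m ^ p ^ a + 1) * p ^ (a + 1) := by ring
          _ = (p ^ (a + 1) * r) * t := by rw [ht]; ring
          _ = _ := by rw [← hpN]; ring
      rw [this, pow_mul, ← map_pow, pow_card_eq_one', map_one, one_pow]
    have h3 : (l g ^ p ^ (a + 1)) ^ (Nat.card G) = 1 := by
      rw [← pow_mul, mul_comm, pow_mul, ← map_pow, pow_card_eq_one', map_one, one_pow]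
    have h4 := pow_gcd_eq_one.2 ⟨h2, h3⟩
    rwa [(Nat.coprime_two_left.2 hodd).gcd_eq_one, pow_one] at h4
  have h5 : l g ^ m = l g ^ (1 + p) :=
    pow_eq_pow_iff_modEq.2 (hm1.of_dvd (orderOf_dvd_of_pow_eq_one hμ))
  rw [hlm, pow_add, pow_one] at h5
  exact (mul_eq_left.1 h5.symm)

theorem Dl_le_Kc {p : ℕ} [Fact p.Prime] (hp2 : p ≠ 2) (hodd : Odd (Nat.card G)) :
    Dl p G ≤ Kc p G := by
  have hp := Fact.out (p := p.Prime)
  have hζ := Complex.isPrimitiveRoot_exp p hp.ne_zero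
  rw [← Sp_ncard hp2 hodd hζ, Dl, ← Nat.card_coe_set_eq]
  have := (Sp_finite (G := G) (Complex.exp (2 * Real.pi * Complex.I / p))).to_subtype
  exact Nat.card_le_card_of_injective (fun l : Lam p G => (⟨toC l.1, toC_mem_Sp hζ l.2⟩ : Sp _ G))
    (fun l l' h => Subtype.ext (toC_inj (congrArg Subtype.val h)))

theorem acd_bridge {p : ℕ} [Fact p.Prime] (hp2 : p ≠ 2) (hodd : Odd (Nat.card G))
    {ζ : ℂ} (hζ : IsPrimitiveRoot ζ p) (h : acd (Sp ζ G) < 2) : Kc p G < 2 * Dl p G := by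
  classical
  have hK : 0 < Kc p G := (Dl_pos p G).trans_le (Dl_le_Kc hp2 hodd)
  have hfin := Sp_finite (G := G) ζ
  set S := hfin.toFinset with hS
  have hScard : S.card = Kc p G := by
    rw [← Sp_ncard hp2 hodd hζ, Set.ncard_eq_toFinset_card _ hfin]
  have hmem : ∀ f, f ∈ S ↔ f ∈ Sp ζ G := fun f => hfin.mem_toFinset
  have hD : (S.filter (fun f => f 1 = 1)).card ≤ Dl p G := by
    have := Lam_finite p G
    rw [Dl]
    have hx : ∀ f : (S.filter (fun f => f 1 = 1)), ∃ l : Lam p G, toC l.1 = f.1 := by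
      rintro ⟨f, hf⟩
      rw [Finset.mem_filter, hmem] at hf
      obtain ⟨l, hl, he⟩ := Sp_linear hp2 hodd hζ hf.1 hf.2
      exact ⟨⟨l, hl⟩, he⟩
    choose F hF using hx
    rw [← Nat.card_eq_finsetCard]
    exact Nat.card_le_card_of_injective F (fun x y hxy => Subtype.ext (by rw [← hF, ← hF, hxy]))
  have h1 : ∑ᶠ f ∈ Sp ζ G, (f 1).re = ∑ f ∈ S, (f 1).re := by
    rw [finsum_mem_eq_finite_toFinset_sum _ hfin]
  rw [acd, h1, Sp_ncard hp2 hodd hζ, div_lt_iff₀ (by exact_mod_cast hK)] at h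
  have h2 : ∑ f ∈ S, ((3 : ℝ) - if f 1 = 1 then 2 else 0) ≤ ∑ f ∈ S, (f 1).re := by
    apply Finset.sum_le_sum
    intro f hf
    obtain ⟨n, hn, hno⟩ := Irr.odd_deg hodd ((hmem f).1 hf).1
    rw [hn]
    by_cases h1 : n = 1
    · subst h1; norm_num
    · have : ((n : ℂ) = 1) ↔ False := by simp [h1]
      simp only [this, if_false, Complex.natCast_re, sub_zero]
      have : 3 ≤ n := by
        obtain ⟨t, ht⟩ := hno
        omega
      exact_mod_cast this
  rw [Finset.sum_sub_distrib, ← Finset.sum_filter, Finset.sum_const, Finset.sum_const, hScard] at h2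
  simp only [nsmul_eq_mul] at h2
  have h3 : ((S.filter (fun f => f 1 = 1)).card : ℝ) ≤ Dl p G := by exact_mod_cast hD
  have : (Kc p G : ℝ) < 2 * Dl p G := by linarith
  exact_mod_cast this

theorem sum_quot {H : Type} [Group H] [Fintype H] (π : G →* H) (hπ : Function.Surjective π) (F : H → ℂ)
    (hF : ∑ q, F q = Nat.card H) : ∑ g, F (π g) = Nat.card G := by
  classical
  have hc : ∀ q : H, (Finset.univ.filter (fun g => π g = q)).card = (Finset.univ.filter (fun g => π g = 1)).card :=
    fun q => MonoidHom.card_fiber_eq_of_mem_range π (by exact hπ q) (by exact hπ 1)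
  have key : ∀ F : H → ℂ, ∑ g, F (π g) = (Finset.univ.filter (fun g => π g = 1)).card * ∑ q, F q := by
    intro F
    rw [← Finset.sum_fiberwise Finset.univ π, Finset.mul_sum]
    apply Finset.sum_congr rfl
    intro q _
    rw [Finset.sum_congr rfl (g := fun _ => F q), Finset.sum_const, hc, nsmul_eq_mul]
    intro x hx
    rw [(Finset.mem_filter.1 hx).2]
  have h1 := key (fun _ => 1)
  rw [key, hF]
  simp only [Finset.sum_const, nsmul_eq_mul, mul_one, Finset.card_univ] at h1
  rw [Nat.card_eq_fintype_card, Nat.card_eq_fintype_card, h1]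

theorem Sp_inflate {ζ : ℂ} {H : Type} [Group H] [Fintype H] (π : G →* H) (hπ : Function.Surjective π)
    {f : H → ℂ} (hf : f ∈ Sp ζ H) : (fun g => f (π g)) ∈ Sp ζ G := by
  refine ⟨mem_Irr_iff.2 ⟨?_, ?_⟩, fun g => hf.2 _⟩
  · obtain ⟨n, ρ, h⟩ := Irr.isChar hf.1
    exact ⟨n, ρ.comp π, fun g => h _⟩
  · have := sum_quot π hπ (fun q => f q * f q⁻¹) (mem_Irr_iff.1 hf.1).2
    simpa using this

theorem quot_ineq {p : ℕ} [Fact p.Prime] (hp2 : p ≠ 2) (hodd : Odd (Nat.card G))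
    {H : Type} [Group H] [Fintype H] (π : G →* H) (hπ : Function.Surjective π) :
    Dl p G * Kc p H ≤ Dl p H * Kc p G := by
  classical
  have hp := Fact.out (p := p.Prime)
  obtain ⟨ζ, hζ⟩ : ∃ ζ : ℂ, IsPrimitiveRoot ζ p := ⟨_, Complex.isPrimitiveRoot_exp p hp.ne_zero⟩
  have hoddH : Odd (Nat.card H) := hodd.of_dvd_nat (Subgroup.card_dvd_of_surjective π hπ)
  have := Lam_finite p G
  have := Lam_finite p H
  have := Fintype.ofFinite (Lam p G)
  have := Fintype.ofFinite (Lam p H)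
  have f1 := Sp_finite (G := G) ζ
  have f2 := Sp_finite (G := H) ζ
  rw [← Sp_ncard hp2 hodd hζ, ← Sp_ncard hp2 hoddH hζ, Set.ncard_eq_toFinset_card _ f1,
    Set.ncard_eq_toFinset_card _ f2, Dl, Dl, Nat.card_eq_fintype_card, ← Finset.card_univ, ← Finset.card_product,
    Nat.card_eq_fintype_card]
  apply Finset.card_le_mul_card_image_of_maps_to
    (f := fun (x : Lam p G × (H → ℂ)) => (fun g => toC x.1.1 g * x.2 (π g)))
  · rintro ⟨l, f⟩ hx
    simp only [Finset.mem_product, Finset.mem_univ, true_and, f2.mem_toFinset] at hx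
    rw [f1.mem_toFinset]
    have h1 := Sp_inflate π hπ hx
    exact ⟨Irr.twist h1.1 l.1, fun g => Subfield.mul_mem _ (toC_mem_closure hζ l.2 g) (h1.2 g)⟩
  · intro F hF
    rcases Finset.eq_empty_or_nonempty (Finset.filter (fun x : Lam p G × (H → ℂ) => (fun g => toC x.1.1 g * x.2 (π g)) = F)
      (Finset.univ ×ˢ f2.toFinset)) with he | ⟨⟨l0, f0⟩, h0⟩
    · rw [he]; simp
    · simp only [Finset.mem_filter, Finset.mem_product, Finset.mem_univ, true_and, f2.mem_toFinset] at h0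
      rw [← Finset.card_univ]
      have hone : ∀ f ∈ Sp ζ H, f 1 ≠ 0 := by
        intro f hf
        obtain ⟨n, hn, hno⟩ := Irr.odd_deg hoddH hf.1
        rw [hn]
        obtain ⟨t, rfl⟩ := hno
        exact_mod_cast Nat.succ_ne_zero (2 * t)
      -- key
      have hker : ∀ l : Lam p G, ∀ f ∈ Sp ζ H, (fun g => toC l.1 g * f (π g)) = F →
          π.ker ≤ (l * l0⁻¹).1.ker := by
        intro l f hf hlF g hg
        have e := hlF.trans h0.2.symm
        have e1 := congrFun e 1
        have eg := congrFun e g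
        simp only [toC, map_one, Units.val_one, one_mul, MonoidHom.mem_ker.1 hg] at e1 eg
        rw [e1] at eg
        have := mul_right_cancel₀ (hone f0 h0.1) eg
        rw [MonoidHom.mem_ker]
        change l.1 g * (l0.1 g)⁻¹ = 1
        rw [Units.ext this, mul_inv_cancel]
      have hex : ∀ x : Lam p G × (H → ℂ), ∃ μ : Lam p H,
          x.2 ∈ Sp ζ H → (fun g => toC x.1.1 g * x.2 (π g)) = F → ∀ g, μ.1 (π g) = x.1.1 g * (l0.1 g)⁻¹ := by
        rintro ⟨l, f⟩
        by_cases hc : f ∈ Sp ζ H ∧ (fun g => toC l.1 g * f (π g)) = F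
        · refine ⟨⟨(π.liftOfSurjective hπ) ⟨(l * l0⁻¹).1, hker l f hc.1 hc.2⟩, ?_⟩, ?_⟩
          · rw [mem_Lam]
            intro h
            obtain ⟨g, rfl⟩ := hπ h
            simp only [MonoidHom.liftOfRightInverse_comp_apply]
            exact mem_Lam.1 (l * l0⁻¹).2 g
          · intro _ _ g
            simp only [MonoidHom.liftOfRightInverse_comp_apply]
            rfl
        · exact ⟨1, fun h1 h2 => absurd ⟨h1, h2⟩ hc⟩
      choose μ hμ using hex
      apply Finset.card_le_card_of_injOn μ
      · intro x _; exact Finset.mem_coe.2 (Finset.mem_univ _)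
      · rintro ⟨l, f⟩ hx ⟨l', f'⟩ hx' he
        simp only [Finset.coe_filter, Finset.mem_product, Finset.mem_univ, true_and, f2.mem_toFinset, Set.mem_ofPred_eq] at hx hx'
        have hll : l = l' := by
          apply Subtype.ext
          ext g
          have a1 := hμ (l, f) hx.1 hx.2 g
          have a2 := hμ (l', f') hx'.1 hx'.2 g
          rw [he, a2] at a1
          exact congrArg Units.val (mul_right_cancel a1.symm)
        subst hll
        have hff : f = f' := by
          funext h
          obtain ⟨g, rfl⟩ := hπ h
          have := congrFun (hx.2.trans hx'.2.symm) g
          exact mul_left_cancel₀ (Units.ne_zero (l.1 g)) this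
        rw [hff]

theorem quot_KD {p : ℕ} [Fact p.Prime] (hp2 : p ≠ 2) (hodd : Odd (Nat.card G))
    {H : Type} [Group H] [Fintype H] (π : G →* H) (hπ : Function.Surjective π) (h : Kc p G < 2 * Dl p G) :
    Kc p H < 2 * Dl p H := by
  have h1 := quot_ineq (p := p) hp2 hodd π hπ
  have h2 := Dl_pos p G
  have h3 := Dl_pos p H
  have h4 : Dl p H * Kc p G < Dl p H * (2 * Dl p G) := Nat.mul_lt_mul_of_pos_left h h3
  have h5 : Dl p G * Kc p H < Dl p G * (2 * Dl p H) := by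
    calc _ ≤ _ := h1
      _ < _ := h4
      _ = _ := by ring
  exact Nat.lt_of_mul_lt_mul_left h5

end lin

section frob
open scoped commutatorElement

variable {G : Type} [Group G] [Finite G] {p : ℕ} [Fact p.Prime]

theorem eq_bot_of_le_commutator {P Q : Subgroup G} (hP : IsPGroup p P) (hQP : Q ≤ P)
    (h : Q ≤ ⁅Q, P⁆) : Q = ⊥ := by
  have hnil : Group.IsNilpotent P := hP.isNilpotent
  have h1 : Q.subgroupOf P ≤ ⁅Q.subgroupOf P, (⊤ : Subgroup P)⁆ := by
    have h2 : (Q.subgroupOf P).map P.subtype = Q := Subgroup.map_subgroupOf_eq_of_le hQP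
    have h3 : (⁅Q.subgroupOf P, (⊤ : Subgroup P)⁆).map P.subtype = ⁅Q, P⁆ := by
      rw [Subgroup.map_commutator, h2, ← MonoidHom.range_eq_map, Subgroup.range_subtype]
    rw [← h3] at h
    intro x hx
    obtain ⟨y, hy, hyx⟩ := h hx
    have : y = x := Subtype.ext hyx
    rwa [← this]
  have h4 : ∀ n, Q.subgroupOf P ≤ (⊤ : Subgroup P).lowerCentralSeries n := by
    intro n
    induction n with
    | zero => simp
    | succ n ih =>
      exact h1.trans (Subgroup.commutator_mono ih le_rfl)
  obtain ⟨n, hn⟩ := Subgroup.nilpotent_iff_lowerCentralSeries.1 hnil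
  have h5 := h4 n
  rw [hn, le_bot_iff, Subgroup.subgroupOf_eq_bot] at h5
  rw [eq_bot_iff]
  intro x hx
  exact (Subgroup.disjoint_def.1 h5) hx (hQP hx)

theorem index_pow_of_pow {M : Subgroup G} [M.Normal] (h : ∀ g : G, ∃ k, g ^ p ^ k ∈ M) :
    ∃ n, M.index = p ^ n := by
  have h1 : IsPGroup p (G ⧸ M) := by
    intro x
    obtain ⟨g, rfl⟩ := QuotientGroup.mk_surjective x
    obtain ⟨k, hk⟩ := h g
    exact ⟨k, by rw [← QuotientGroup.mk_pow]; exact (QuotientGroup.eq_one_iff (N := M) _).2 hk⟩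
  obtain ⟨n, hn⟩ := IsPGroup.iff_card.1 h1
  exact ⟨n, hn⟩

theorem pow_mem_of_index {M : Subgroup G} [M.Normal] {n : ℕ} (h : M.index = p ^ n) (g : G) :
    g ^ p ^ n ∈ M := by
  rw [← h]; exact Subgroup.pow_index_mem M g

theorem frob_self {P : Subgroup G} (hP : IsSyl p P ⊤)
    (hfus : ∀ x ∈ P, ∀ g : G, g * x * g⁻¹ ∈ P → ∃ q ∈ P, q * x * q⁻¹ = g * x * g⁻¹) :
    HasNormalPComplement p G := by
  have hp := Fact.out (p := p.Prime)
  obtain ⟨N, hN⟩ := (Set.toFinite {N : Subgroup G | N.Normal ∧ ∃ n, N.index = p ^ n}).exists_minimal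
    ⟨⊤, inferInstance, 0, by simp⟩
  have hNn : N.Normal := hN.1.1
  obtain ⟨n, hn⟩ := hN.1.2
  have hQ : IsSyl p (P ⊓ N) N := hP.inf_normal le_top (by rw [Subgroup.normalizer_eq_top_iff.2 hNn])
  have hQ1 : P ⊓ N = ⊥ := by
    apply eq_bot_of_le_commutator hP.2.1 inf_le_left
    -- Q ≤ [N,N]
    have hC : (⁅N, N⁆ : Subgroup G).Normal := inferInstance
    set C := (⁅N, N⁆ : Subgroup G) with hCd
    have hCN : C ≤ N := Subgroup.commutator_le_right N N
    obtain ⟨a, r, hr, hNr⟩ := Nat.exists_eq_pow_mul_and_not_dvd (Nat.card_pos (α := G)).ne' p hp.ne_one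
    have hcomm : ∀ x ∈ N, ∀ y ∈ N, Commute (x : G ⧸ C) (y : G ⧸ C) := by
      intro x hx y hy
      rw [← commutatorElement_eq_one_iff_commute]
      exact (QuotientGroup.eq_one_iff (N := C) ⁅x, y⁆).2 (Subgroup.commutator_mem_commutator hx hy)
    let M : Subgroup G :=
      { carrier := {x | x ∈ N ∧ (x : G ⧸ C) ^ r = 1}
        one_mem' := ⟨N.one_mem, by simp⟩
        mul_mem' := by
          rintro x y ⟨hx, hx'⟩ ⟨hy, hy'⟩
          refine ⟨N.mul_mem hx hy, ?_⟩
          rw [QuotientGroup.mk_mul, (hcomm x hx y hy).mul_pow, hx', hy', one_mul]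
        inv_mem' := by
          rintro x ⟨hx, hx'⟩
          refine ⟨N.inv_mem hx, ?_⟩
          rw [QuotientGroup.mk_inv, inv_pow, hx', inv_one] }
    have hMn : M.Normal := by
      constructor
      rintro x ⟨hx, hx'⟩ g
      refine ⟨hNn.conj_mem x hx g, ?_⟩
      rw [QuotientGroup.mk_mul, QuotientGroup.mk_mul, QuotientGroup.mk_inv, conj_pow, hx', mul_one, mul_inv_cancel]
    have hMi : ∃ n, M.index = p ^ n := by
      apply index_pow_of_pow
      intro g
      refine ⟨n + a, ?_, ?_⟩
      · rw [pow_add, pow_mul]; exact N.pow_mem (pow_mem_of_index hn g) _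
      · rw [← QuotientGroup.mk_pow, ← pow_mul, pow_add, mul_assoc, ← hNr, mul_comm, pow_mul, pow_card_eq_one', one_pow]
        rfl
    have hMN : N ≤ M := hN.2 ⟨hMn, hMi⟩ (fun x hx => hx.1)
    have hQC : P ⊓ N ≤ C := by
      rintro x ⟨hxP, hxN⟩
      obtain ⟨k, hk⟩ := hP.2.1 ⟨x, hxP⟩
      have hk' : x ^ p ^ k = 1 := congrArg Subtype.val hk
      have h1 := (hMN hxN).2
      have h2 : (x : G ⧸ C) ^ p ^ k = 1 := by
        rw [← QuotientGroup.mk_pow, hk']; rfl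
      have h3 := pow_gcd_eq_one.2 ⟨h1, h2⟩
      have h4 : r.gcd (p ^ k) = 1 := ((hp.coprime_iff_not_dvd).2 hr).symm.pow_right k
      rw [h4, pow_one] at h3
      exact (QuotientGroup.eq_one_iff (N := C) x).1 h3
    obtain ⟨S, hS⟩ := hQ.exists_sylow
    have hfoc := Subgroup.commutator_inf_eq_focalSubgroup S
    intro x hx
    have hxN : x ∈ N := hx.2
    have hx1 : (⟨x, hxN⟩ : N) ∈ commutator N ⊓ (S : Subgroup N) := by
      refine ⟨?_, ?_⟩
      · have h1 := hQC hx
        rw [hCd, ← Subgroup.map_subtype_commutator] at h1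
        obtain ⟨y, hy, hyx⟩ := h1
        have : y = ⟨x, hxN⟩ := Subtype.ext hyx
        rwa [← this]
      · rw [hS]; exact hx
    rw [hfoc] at hx1
    have hle : (S : Subgroup N).focalSubgroup ≤ (⁅P ⊓ N, P⁆ : Subgroup G).subgroupOf N := by
      rw [Subgroup.focalSubgroup_def, Subgroup.closure_le]
      rintro _ ⟨hg, z, hz, u, rfl⟩
      rw [hS] at hz hg
      have hz' : (z : G) ∈ P ⊓ N := hz
      have hg' : (z : G) * u * (z : G)⁻¹ * (u : G)⁻¹ ∈ P ⊓ N := hg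
      have h1 : (u : G) * (z : G)⁻¹ * (u : G)⁻¹ ∈ P := by
        have := P.mul_mem (P.inv_mem hz'.1) hg'.1
        have e : (z : G)⁻¹ * ((z : G) * u * (z : G)⁻¹ * (u : G)⁻¹) = (u : G) * (z : G)⁻¹ * (u : G)⁻¹ := by group
        rwa [e] at this
      obtain ⟨q, hq, hq'⟩ := hfus _ (P.inv_mem hz'.1) u h1
      change (z : G) * u * (z : G)⁻¹ * (u : G)⁻¹ ∈ (⁅P ⊓ N, P⁆ : Subgroup G)
      have e : (z : G) * u * (z : G)⁻¹ * (u : G)⁻¹ = ⁅(z : G), q⁆ := by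
        rw [commutatorElement_def]
        calc _ = (z : G) * (u * (z : G)⁻¹ * (u : G)⁻¹) := by group
          _ = (z : G) * (q * (z : G)⁻¹ * q⁻¹) := by rw [hq']
          _ = _ := by group
      rw [e]
      exact Subgroup.commutator_mem_commutator hz' hq
    exact hle hx1
  refine ⟨N, hNn, ?_, n, hn⟩
  rw [Nat.coprime_comm, hp.coprime_iff_not_dvd]
  intro hd
  obtain ⟨x, hx⟩ := exists_prime_orderOf_dvd_card' p hd
  have h1 : IsPGroup p (Subgroup.zpowers (x : G)) := by
    apply IsPGroup.of_card (n := 1)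
    rw [Nat.card_zpowers, pow_one, Subgroup.orderOf_coe, hx]
  obtain ⟨y, hy, h2⟩ := hQ.conj_le h1 (by rw [Subgroup.zpowers_le]; exact x.2)
  have h3 := h2 x (Subgroup.mem_zpowers _)
  rw [hQ1, Subgroup.mem_bot, mul_inv_eq_one, mul_eq_left] at h3
  have : x = 1 := Subtype.ext h3
  rw [this, orderOf_one] at hx
  exact hp.one_lt.ne hx

end frob

section fusion

variable {G : Type} [Group G] [Finite G] {p : ℕ} [Fact p.Prime]

theorem isPGroup_zpowers {x : G} (h : ∃ k, x ^ p ^ k = 1) : IsPGroup p (Subgroup.zpowers x) := by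
  obtain ⟨k, hk⟩ := h
  have hd := orderOf_dvd_of_pow_eq_one hk
  obtain ⟨j, _, hj⟩ := (Nat.dvd_prime_pow Fact.out).1 hd
  exact IsPGroup.of_card (n := j) (by rw [Nat.card_zpowers, hj])

theorem IsSyl.conj_elt {P L : Subgroup G} (hP : IsSyl p P L) {x : G} (hx : x ∈ L)
    (h : ∃ k, x ^ p ^ k = 1) : ∃ y ∈ L, y * x * y⁻¹ ∈ P := by
  obtain ⟨y, hy, h1⟩ := hP.conj_le (isPGroup_zpowers h) (by rwa [Subgroup.zpowers_le])
  exact ⟨y, hy, h1 x (Subgroup.mem_zpowers x)⟩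

theorem Kc_le_of_fusion {L : Subgroup G}
    (h : ∀ x y : L, (∃ k, x ^ p ^ k = 1) → (∃ k, y ^ p ^ k = 1) → IsConj (x : G) (y : G) → IsConj x y) :
    Kc p L ≤ Kc p G := by
  unfold Kc
  apply Set.ncard_le_ncard_of_injOn (ConjClasses.map L.subtype) _ _ (Set.toFinite _)
  · rintro _ ⟨x, ⟨⟨k, hk⟩, hx⟩, rfl⟩
    refine ⟨(x : G), ⟨⟨k, congrArg Subtype.val hk⟩, ?_⟩, rfl⟩
    obtain ⟨c, hc⟩ := isConj_iff.1 hx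
    exact isConj_iff.2 ⟨c, congrArg Subtype.val hc⟩
  · rintro _ ⟨x, hx, rfl⟩ _ ⟨y, hy, rfl⟩ he
    have h1 : IsConj (x : G) (y : G) := ConjClasses.mk_eq_mk_iff_isConj.1 he
    exact ConjClasses.mk_eq_mk_iff_isConj.2 (h x y hx.1 hy.1 h1)

theorem Dl_le_of_syl {P L : Subgroup G} (hP : IsSyl p P ⊤) (hPL : P ≤ L) : Dl p G ≤ Dl p L := by
  have := Fintype.ofFinite G
  have := Fintype.ofFinite L
  have := Lam_finite p L
  unfold Dl
  apply Nat.card_le_card_of_injective (fun l : Lam p G => (⟨l.1.comp L.subtype, by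
    rw [mem_Lam]; intro g; exact mem_Lam.1 l.2 _⟩ : Lam p L))
  intro l l' he
  have he' : ∀ x ∈ L, l.1 x = l'.1 x := by
    intro x hx
    exact DFunLike.congr_fun (congrArg Subtype.val he) (⟨x, hx⟩ : L)
  apply Subtype.ext
  ext g
  congr 1
  obtain ⟨i, j, hi, ⟨m, hm, hj⟩, hij⟩ := exists_pp p g
  obtain ⟨y, _, hy⟩ := hP.conj_elt (Subgroup.mem_top _) hi
  have h1 : l.1 (g ^ i) = l'.1 (g ^ i) := by
    have := he' _ (hPL hy)
    simp only [map_mul, map_inv] at this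
    rwa [mul_inv_cancel_comm, mul_inv_cancel_comm] at this
  have h2 : ∀ l : Lam p G, l.1 (g ^ j) = 1 := by
    intro l
    have a1 : l.1 (g ^ j) ^ m = 1 := by rw [← map_pow, hj, map_one]
    have a2 := mem_Lam.1 l.2 (g ^ j)
    have := pow_gcd_eq_one.2 ⟨a1, a2⟩
    rwa [hm.gcd_eq_one, pow_one] at this
  rw [← hij, map_mul, map_mul, h1, h2, h2]

theorem case_fusion (hp2 : p ≠ 2) (hodd : Odd (Nat.card G)) (hKD : Kc p G < 2 * Dl p G)
    (ih : ∀ L : Subgroup G, L < ⊤ → Kc p L < 2 * Dl p L → HasNormalPComplement p L)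
    (hOp : ∀ N : Subgroup G, N.Normal → IsPGroup p N → N = ⊥) : HasNormalPComplement p G := by
  have hp := Fact.out (p := p.Prime)
  obtain ⟨P, hP⟩ := exists_isSyl p (⊤ : Subgroup G)
  by_cases hP1 : P = ⊥
  · apply frob_self hP
    intro x hx g _
    refine ⟨1, P.one_mem, ?_⟩
    rw [hP1, Subgroup.mem_bot] at hx
    simp [hx]
  have hcf := cf_main (p := p) hp2 _ G rfl hodd
  set L := Subgroup.normalizer (Wz P : Set G) with hL
  have hLlt : L < ⊤ := by
    rw [lt_top_iff_ne_top]
    intro h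
    have hn := Subgroup.normalizer_eq_top_iff.1 h
    exact Wz_ne_bot hP.2.1 hP1 (hOp _ hn (hP.2.1.to_le (Wz_le P)))
  have hPL : P ≤ L := Subgroup.le_normalizer.trans (Wz_normalizer P)
  have hPsL : IsSyl p P L := hP.mono le_top hPL
  have hfusP : ∀ x ∈ P, ∀ g : G, g * x * g⁻¹ ∈ P → ∃ l ∈ L, l * x * l⁻¹ = g * x * g⁻¹ := by
    intro x hx g hg
    obtain ⟨l, hl, h1⟩ := hcf P (Subgroup.zpowers x) g hP (by rwa [Subgroup.zpowers_le]) (Subgroup.mem_top g)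
      (by
        rintro _ ⟨z, hz, rfl⟩
        obtain ⟨t, rfl⟩ := Subgroup.mem_zpowers_iff.1 hz
        have := P.zpow_mem hg t
        rw [conj_zpow] at this
        exact this)
    exact ⟨l, hl.2, h1 x (Subgroup.mem_zpowers x)⟩
  have hKL : Kc p L ≤ Kc p G := by
    apply Kc_le_of_fusion
    rintro ⟨x, hxL⟩ ⟨y, hyL⟩ ⟨k, hk⟩ ⟨k', hk'⟩ hxy
    obtain ⟨u, hu, hux⟩ := hPsL.conj_elt hxL ⟨k, congrArg Subtype.val hk⟩
    obtain ⟨v, hv, hvy⟩ := hPsL.conj_elt hyL ⟨k', congrArg Subtype.val hk'⟩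
    obtain ⟨c, hc⟩ := isConj_iff.1 hxy
    simp only at hc
    have e : (v * c * u⁻¹) * (u * x * u⁻¹) * (v * c * u⁻¹)⁻¹ = v * y * v⁻¹ := by
      rw [← hc]; group
    obtain ⟨l, hl, h1⟩ := hfusP _ hux (v * c * u⁻¹) (by rwa [e])
    rw [e] at h1
    refine isConj_iff.2 ⟨⟨v⁻¹ * l * u, L.mul_mem (L.mul_mem (L.inv_mem hv) hl) hu⟩, ?_⟩
    apply Subtype.ext
    change (v⁻¹ * l * u) * x * (v⁻¹ * l * u)⁻¹ = y
    calc _ = v⁻¹ * (l * (u * x * u⁻¹) * l⁻¹) * v := by group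
      _ = v⁻¹ * (v * y * v⁻¹) * v := by rw [h1]
      _ = y := by group
  obtain ⟨M, hMn, hMc, n, hMi⟩ := ih L hLlt
    (hKL.trans_lt (hKD.trans_le (Nat.mul_le_mul_left 2 (Dl_le_of_syl hP hPL))))
  apply frob_self hP
  intro x hx g hg
  obtain ⟨l, hl, h1⟩ := hfusP x hx g hg
  -- l = q m
  have hlq : ∃ q ∈ P, ∃ m ∈ M, l = q * (m : L) := by
    -- the Sylow subgroup P maps onto L / M
    have hsup : P.subgroupOf L ⊔ M = ⊤ := by
      obtain ⟨S, hS⟩ := hPsL.exists_sylow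
      rw [← hS, ← Subgroup.index_eq_one]
      have d1 : ((S : Subgroup L) ⊔ M).index ∣ (S : Subgroup L).index := Subgroup.index_dvd_of_le le_sup_left
      have d2 : ((S : Subgroup L) ⊔ M).index ∣ M.index := Subgroup.index_dvd_of_le le_sup_right
      rw [hMi] at d2
      have c1 : (S : Subgroup L).index.Coprime (p ^ n) :=
        (((hp.coprime_iff_not_dvd).2 S.not_dvd_index).symm).pow_right n
      exact Nat.dvd_one.1 (c1.gcd_eq_one ▸ Nat.dvd_gcd d1 d2)
    have : (⟨l, hl⟩ : L) ∈ P.subgroupOf L ⊔ M := by rw [hsup]; exact Subgroup.mem_top _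
    obtain ⟨q, hq, m, hm, hqm⟩ := Subgroup.mem_sup_of_normal_right.1 this
    exact ⟨q, hq, m, hm, (congrArg Subtype.val hqm).symm⟩
  obtain ⟨q, hq, m, hm, rfl⟩ := hlq
  refine ⟨q, hq, ?_⟩
  rw [← h1]
  have hmx : (m : G) * x * (m : G)⁻¹ * x⁻¹ = 1 := by
    set w := (m : G) * x * (m : G)⁻¹ * x⁻¹ with hw
    have hwP : w ∈ P := by
      have h2 : q * m * x * (q * m)⁻¹ ∈ P := by rw [h1]; exact hg
      have h3 := P.mul_mem (P.mul_mem (P.mul_mem (P.inv_mem hq) h2) hq) (P.inv_mem hx)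
      have e : q⁻¹ * (q * m * x * (q * m)⁻¹) * q * x⁻¹ = w := by rw [hw]; group
      rwa [e] at h3
    have hwM : (⟨w, hPL hwP⟩ : L) ∈ M := by
      have h4 := M.mul_mem hm (hMn.conj_mem _ (M.inv_mem hm) ⟨x, hPL hx⟩)
      have e : m * (⟨x, hPL hx⟩ * m⁻¹ * ⟨x, hPL hx⟩⁻¹) = (⟨w, hPL hwP⟩ : L) := by
        apply Subtype.ext
        change (m : G) * (x * (m : G)⁻¹ * x⁻¹) = w
        rw [hw]; group
      rwa [e] at h4
    have a1 : (⟨w, hPL hwP⟩ : L) ^ Nat.card M = 1 := pow_card_of_mem hwM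
    have a2 : w ^ Nat.card M = 1 := congrArg Subtype.val a1
    obtain ⟨k, hk⟩ := hP.2.1 ⟨w, hwP⟩
    have a3 : w ^ p ^ k = 1 := congrArg Subtype.val hk
    have := pow_gcd_eq_one.2 ⟨a2, a3⟩
    rwa [(hMc.pow_right k).gcd_eq_one, pow_one] at this
  have : (m : G) * x * (m : G)⁻¹ = x := mul_inv_eq_one.1 hmx
  calc q * x * q⁻¹ = q * ((m : G) * x * (m : G)⁻¹) * q⁻¹ := by rw [this]
    _ = _ := by group

end fusion

section dbl

theorem one_add_pow_mod {p : ℕ} [Fact p.Prime] (hp2 : p ≠ 2) (a : ℕ) :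
    (1 + p) ^ (p ^ a) ≡ 1 [MOD p ^ a] := by
  have hp := Fact.out (p := p.Prime)
  have := ZMod.orderOf_one_add_prime hp hp2 a
  have h2 := pow_orderOf_eq_one (1 + p : ZMod (p ^ (a + 1)))
  rw [this] at h2
  have h3 : (1 + p) ^ (p ^ a) ≡ 1 [MOD p ^ (a + 1)] := by
    rw [← ZMod.natCast_eq_natCast_iff]
    push_cast
    exact_mod_cast h2
  exact h3.of_dvd (pow_dvd_pow p (Nat.le_succ a))

variable {G : Type} [Group G]

/-- the subgroup of commutators `[R,y]` -/
def brk (R : Subgroup G) (hR : R.Normal) (hab : ∀ x ∈ R, ∀ y ∈ R, x * y = y * x) (y : G) : Subgroup G where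
  carrier := {w | ∃ s ∈ R, w = s * y * s⁻¹ * y⁻¹}
  one_mem' := ⟨1, R.one_mem, by group⟩
  mul_mem' := by
    rintro _ _ ⟨s, hs, rfl⟩ ⟨t, ht, rfl⟩
    refine ⟨s * t, R.mul_mem hs ht, ?_⟩
    have h1 : y * s⁻¹ * y⁻¹ ∈ R := hR.conj_mem _ (R.inv_mem hs) y
    have h2 := hab _ h1 _ ht
    have h3 : y * t⁻¹ * y⁻¹ ∈ R := hR.conj_mem _ (R.inv_mem ht) y
    have h4 := hab _ h1 _ h3
    calc s * y * s⁻¹ * y⁻¹ * (t * y * t⁻¹ * y⁻¹)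
        = s * ((y * s⁻¹ * y⁻¹) * t) * (y * t⁻¹ * y⁻¹) := by group
      _ = s * t * ((y * s⁻¹ * y⁻¹) * (y * t⁻¹ * y⁻¹)) := by rw [h2]; group
      _ = s * t * ((y * t⁻¹ * y⁻¹) * (y * s⁻¹ * y⁻¹)) := by rw [h4]
      _ = s * t * y * (s * t)⁻¹ * y⁻¹ := by group
  inv_mem' := by
    rintro _ ⟨s, hs, rfl⟩
    refine ⟨s⁻¹, R.inv_mem hs, ?_⟩
    have h1 : y * s * y⁻¹ ∈ R := hR.conj_mem _ hs y
    have h2 := hab _ h1 _ (R.inv_mem hs)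
    calc (s * y * s⁻¹ * y⁻¹)⁻¹ = (y * s * y⁻¹) * s⁻¹ := by group
      _ = s⁻¹ * (y * s * y⁻¹) := h2
      _ = _ := by group

theorem brk_pow {R : Subgroup G} (hR : R.Normal) (hab : ∀ x ∈ R, ∀ y ∈ R, x * y = y * x) (y : G)
    {s : G} (hs : s ∈ R) (k : ℕ) : s * y ^ k * s⁻¹ * (y ^ k)⁻¹ ∈ brk R hR hab y := by
  induction k with
  | zero => simp [Subgroup.one_mem]
  | succ k ih =>
    obtain ⟨t, ht, h⟩ := ih
    have h1 : s * y ^ (k + 1) * s⁻¹ * (y ^ (k + 1))⁻¹ =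
      (s * y * s⁻¹ * y⁻¹) * ((y * t * y⁻¹) * y * (y * t * y⁻¹)⁻¹ * y⁻¹) := by
      calc s * y ^ (k + 1) * s⁻¹ * (y ^ (k + 1))⁻¹
          = (s * y * s⁻¹ * y⁻¹) * (y * (s * y ^ k * s⁻¹ * (y ^ k)⁻¹) * y⁻¹) := by rw [pow_succ']; group
        _ = _ := by rw [h]; group
    rw [h1]
    exact Subgroup.mul_mem _ ⟨s, hs, rfl⟩ ⟨_, hR.conj_mem _ ht y, rfl⟩

theorem conj_pow_pow {y n : G} {q : ℕ} (h : n * y * n⁻¹ = y ^ q) (t : ℕ) :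
    n ^ t * y * (n ^ t)⁻¹ = y ^ (q ^ t) := by
  induction t with
  | zero => simp
  | succ t ih =>
    calc n ^ (t + 1) * y * (n ^ (t + 1))⁻¹ = n * (n ^ t * y * (n ^ t)⁻¹) * n⁻¹ := by rw [pow_succ']; group
      _ = _ := by rw [ih, ← conj_pow, h, ← pow_mul, pow_succ']

variable [Finite G] {p : ℕ} [Fact p.Prime]

theorem exists_pconj (hp2 : p ≠ 2) {y n : G} {a : ℕ} (hy : y ^ p ^ a = 1) (hn : n * y * n⁻¹ = y ^ (1 + p)) :
    ∃ n' : G, (∃ k, n' ^ p ^ k = 1) ∧ n' * y * n'⁻¹ = y ^ (1 + p) := by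
  have hp := Fact.out (p := p.Prime)
  obtain ⟨i, j, hi, ⟨m, hm, hj⟩, hij⟩ := exists_pp p n
  refine ⟨n ^ i, hi, ?_⟩
  have h1 : n ^ (j * p ^ a) * y * (n ^ (j * p ^ a))⁻¹ = y := by
    rw [conj_pow_pow hn]
    conv_rhs => rw [← pow_one y]
    apply pow_eq_pow_iff_modEq.2
    have h2 := (one_add_pow_mod (p := p) hp2 a).pow j
    rw [one_pow, ← pow_mul, mul_comm (p ^ a)] at h2
    exact h2.of_dvd (orderOf_dvd_of_pow_eq_one hy)
  have h2 : (n ^ j) ^ p ^ a ∈ Subgroup.centralizer ({y} : Set G) := by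
    rw [Subgroup.mem_centralizer_singleton_iff, ← pow_mul]
    exact mul_inv_eq_iff_eq_mul.1 h1
  have h3 : n ^ j ∈ Subgroup.centralizer ({y} : Set G) := by
    have e : ((p ^ a).Coprime m) := (hm.pow_right a).symm
    have h4 : (n ^ j) ^ (Nat.gcd (p ^ a) m) ∈ Subgroup.centralizer ({y} : Set G) := by
      rw [← zpow_natCast, Nat.gcd_eq_gcd_ab, zpow_add, zpow_mul, zpow_mul, zpow_natCast, zpow_natCast, hj, one_zpow, mul_one]
      exact Subgroup.zpow_mem _ h2 _
    rwa [e.gcd_eq_one, pow_one] at h4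
  rw [Subgroup.mem_centralizer_singleton_iff] at h3
  have h4 : n ^ j * y * (n ^ j)⁻¹ = y := mul_inv_eq_iff_eq_mul.2 h3
  calc n ^ i * y * (n ^ i)⁻¹ = n ^ i * (n ^ j * y * (n ^ j)⁻¹) * (n ^ i)⁻¹ := by rw [h4]
    _ = (n ^ i * n ^ j) * y * (n ^ i * n ^ j)⁻¹ := by group
    _ = _ := by rw [hij, hn]

theorem exists_stable (hp2 : p ≠ 2) {R : Subgroup G} (hR : R.Normal)
    (hab : ∀ x ∈ R, ∀ y ∈ R, x * y = y * x) (hexp : ∀ x ∈ R, x ^ p = 1) (hR1 : R ≠ ⊥)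
    {y : G} (hy : ∃ k, y ^ p ^ k = 1) (hst : IsConj y (y ^ (1 + p))) :
    ∃ r ∈ R, (∀ s ∈ R, s * y * s⁻¹ * y⁻¹ ≠ r) ∧ (∃ k, (r * y) ^ p ^ k = 1) ∧
      IsConj (r * y) ((r * y) ^ (1 + p)) := by
  have hRp : IsPGroup p R := by
    rintro ⟨x, hx⟩
    exact ⟨1, Subtype.ext (by simpa using hexp x hx)⟩
  obtain ⟨a, ha⟩ := hy
  obtain ⟨n0, hn0⟩ := isConj_iff.1 hst
  obtain ⟨n, hnp, hn⟩ := exists_pconj hp2 ha hn0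
  set W := brk R hR hab y with hW
  have hWR : W ≤ R := by
    rintro _ ⟨s, hs, rfl⟩
    have := R.mul_mem hs (hR.conj_mem _ (R.inv_mem hs) y)
    have e : s * (y * s⁻¹ * y⁻¹) = s * y * s⁻¹ * y⁻¹ := by group
    rwa [e] at this
  have hsup : ∀ z : G, (∃ k, z ^ p ^ k = 1) → IsPGroup p (R ⊔ Subgroup.zpowers z : Subgroup G) := fun z hz =>
    IsPGroup.to_sup_of_normal_left hRp (isPGroup_zpowers hz)
  have hRtop : Subgroup.normalizer (R : Set G) = ⊤ := Subgroup.normalizer_eq_top_iff.2 hR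
  have hWlt : W < R := by
    refine lt_of_le_of_ne hWR ?_
    intro he
    obtain ⟨x, hxR, hx1, hx⟩ := exists_central_mod (hsup y ⟨a, ha⟩) (bot_lt_iff_ne_bot.2 hR1) le_sup_left
      (by rw [Subgroup.normalizer_eq_top_iff.2 inferInstance]; exact le_top) (by rw [hRtop]; exact le_top)
    have hyx := hx y ((le_sup_right : _ ≤ R ⊔ Subgroup.zpowers y) (Subgroup.mem_zpowers y))
    rw [Subgroup.mem_bot] at hyx hx1
    let ψ : R → R := fun s => ⟨(s : G) * y * (s : G)⁻¹ * y⁻¹, hWR ⟨s, s.2, rfl⟩⟩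
    have hsurj : Function.Surjective ψ := by
      rintro ⟨w, hw⟩
      have hw' := hw
      rw [← he] at hw'
      obtain ⟨s, hs, h⟩ := hw'
      exact ⟨⟨s, hs⟩, Subtype.ext h.symm⟩
    have hinj := Finite.injective_iff_surjective.2 hsurj
    have h5 : ψ ⟨x, hxR⟩ = ψ 1 := by
      apply Subtype.ext
      change x * y * x⁻¹ * y⁻¹ = 1 * y * 1⁻¹ * y⁻¹
      have e : x * y * x⁻¹ * y⁻¹ = (y * x * y⁻¹ * x⁻¹)⁻¹ := by group
      rw [e, hyx]; group
    exact hx1 (congrArg Subtype.val (hinj h5))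
  have hWn : ∀ g : G, g ∈ R ∨ g = n → g ∈ Subgroup.normalizer (W : Set G) := by
    intro g hg
    apply mem_normalizer_of_conj
    intro w hw
    rcases hg with hg | rfl
    · rw [hab g hg w (hWR hw), mul_inv_cancel_right]; exact hw
    · obtain ⟨s, hs, rfl⟩ := hw
      have e : g * (s * y * s⁻¹ * y⁻¹) * g⁻¹ = (g * s * g⁻¹) * (g * y * g⁻¹) * (g * s * g⁻¹)⁻¹ * (g * y * g⁻¹)⁻¹ := by group
      rw [e, hn]
      exact brk_pow hR hab y (hR.conj_mem _ hs g) _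
  obtain ⟨r, hrR, hrW, hr⟩ := exists_central_mod (hsup n hnp) hWlt le_sup_left
    (sup_le (fun g hg => hWn g (Or.inl hg)) (by rw [Subgroup.zpowers_le]; exact hWn n (Or.inr rfl)))
    (by rw [hRtop]; exact le_top)
  have hrn := hr n ((le_sup_right : _ ≤ R ⊔ Subgroup.zpowers n) (Subgroup.mem_zpowers n))
  refine ⟨r, hrR, fun s hs he => hrW ⟨s, hs, he.symm⟩, ?_, ?_⟩
  · exact (hsup y ⟨a, ha⟩).exists_pow (Subgroup.mul_mem _ ((le_sup_left : R ≤ _) hrR) ((le_sup_right : _ ≤ R ⊔ Subgroup.zpowers y) (Subgroup.mem_zpowers y)))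
  · have hpw : ∀ k, ∃ w ∈ W, (r * y) ^ k = r ^ k * w * y ^ k := by
      intro k
      induction k with
      | zero => exact ⟨1, W.one_mem, by simp⟩
      | succ k ih =>
        obtain ⟨w, hw, h⟩ := ih
        have h1 := brk_pow hR hab y (R.inv_mem hrR) k
        refine ⟨w * (r⁻¹ * y ^ k * r⁻¹⁻¹ * (y ^ k)⁻¹), W.mul_mem hw h1, ?_⟩
        rw [pow_succ, h]
        have h2 := hab w (hWR hw) r hrR
        calc r ^ k * w * y ^ k * (r * y) = r ^ k * (w * r) * (r⁻¹ * y ^ k * r⁻¹⁻¹ * (y ^ k)⁻¹) * (y ^ k * y) := by group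
          _ = _ := by rw [h2, pow_succ, pow_succ]; group
    obtain ⟨w2, hw2, h2⟩ := hpw (1 + p)
    have hr1 : r ^ (1 + p) = r := by rw [pow_add, hexp r hrR, pow_one, mul_one]
    rw [hr1] at h2
    rw [h2]
    set y' := y ^ (1 + p) with hy'
    obtain ⟨j, hj⟩ : ∃ j, y' ^ j = y := by
      refine ⟨(1 + p) ^ (p ^ a - 1), ?_⟩
      rw [hy', ← pow_mul, ← pow_succ', Nat.sub_add_cancel (Nat.pos_of_ne_zero (pow_ne_zero _ (Fact.out (p := p.Prime)).ne_zero))]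
      conv_rhs => rw [← pow_one y]
      apply pow_eq_pow_iff_modEq.2
      exact (one_add_pow_mod (p := p) hp2 a).of_dvd (orderOf_dvd_of_pow_eq_one ha)
    set w1 := n * r * n⁻¹ * r⁻¹ with hw1
    obtain ⟨t, ht, hteq⟩ := W.mul_mem (W.inv_mem hrn) hw2
    have hmem := brk_pow hR hab y' ht j
    rw [hj] at hmem
    obtain ⟨s, hs, hseq⟩ := hmem
    refine isConj_iff.2 ⟨s * n, ?_⟩
    have c1 := hab s hs (n * r * n⁻¹) (hR.conj_mem _ hrR n)
    have c2 := hab w1 (hWR hrn) r hrR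
    calc s * n * (r * y) * (s * n)⁻¹ = (s * (n * r * n⁻¹)) * (n * y * n⁻¹) * s⁻¹ := by group
      _ = (n * r * n⁻¹) * (s * y' * s⁻¹ * y'⁻¹) * y' := by rw [c1, hn]; group
      _ = (w1 * r) * (w1⁻¹ * w2) * y' := by rw [← hseq, ← hteq, hw1]; group
      _ = _ := by rw [c2]; group

theorem Kc_double (hp2 : p ≠ 2) {R N : Subgroup G} (hR : R.Normal)
    (hab : ∀ x ∈ R, ∀ y ∈ R, x * y = y * x) (hexp : ∀ x ∈ R, x ^ p = 1) (hR1 : R ≠ ⊥)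
    (hRN : R ⊓ N = ⊥) (hsup : R ⊔ N = ⊤) : 2 * Kc p N ≤ Kc p G := by
  have huniq : ∀ a ∈ R, ∀ b ∈ R, ∀ x ∈ N, ∀ y ∈ N, a * x = b * y → x = y := by
    intro a ha b hb x hx y hy h
    have h1 : x * y⁻¹ ∈ R ⊓ N := by
      refine ⟨?_, N.mul_mem hx (N.inv_mem hy)⟩
      have e : x * y⁻¹ = a⁻¹ * b := by
        rw [eq_inv_mul_iff_mul_eq, ← mul_assoc, h, mul_inv_cancel_right]
      rw [e]; exact R.mul_mem (R.inv_mem ha) hb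
    rw [hRN, Subgroup.mem_bot] at h1
    exact mul_inv_eq_one.1 h1
  have hdec : ∀ g : G, ∃ s ∈ R, ∃ n ∈ N, s * n = g := by
    intro g
    exact Subgroup.mem_sup_of_normal_left.1 (by rw [hsup]; exact Subgroup.mem_top g)
  -- conjugacy
  have hconj : ∀ a ∈ R, ∀ b ∈ R, ∀ x ∈ N, ∀ y ∈ N, IsConj (a * x) (b * y) →
      ∃ s ∈ R, ∃ n ∈ N, n * x * n⁻¹ = y ∧ s * n * (a * x) * (s * n)⁻¹ = b * y := by
    intro a ha b hb x hx y hy h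
    obtain ⟨g, hg⟩ := isConj_iff.1 h
    obtain ⟨s, hs, n, hn, rfl⟩ := hdec g
    refine ⟨s, hs, n, hn, ?_, hg⟩
    have hn' : n * x * n⁻¹ ∈ N := N.mul_mem (N.mul_mem hn hx) (N.inv_mem hn)
    apply huniq (s * (n * a * n⁻¹) * ((n * x * n⁻¹) * s⁻¹ * (n * x * n⁻¹)⁻¹)) _ b hb _ hn' y hy
    · rw [← hg]; group
    · exact R.mul_mem (R.mul_mem hs (hR.conj_mem _ ha n)) (hR.conj_mem _ (R.inv_mem hs) _)
  have hch : ∀ c : ConjClasses N, ∃ (y : N) (r : G), c ∈ (ConjClasses.mk '' {x : N | (∃ k, x ^ p ^ k = 1) ∧ IsConj x (x ^ (1 + p))}) →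
      ConjClasses.mk y = c ∧ (∃ k, (y : G) ^ p ^ k = 1) ∧ IsConj (y : G) ((y : G) ^ (1 + p)) ∧
      r ∈ R ∧ (∀ s ∈ R, s * y * s⁻¹ * (y : G)⁻¹ ≠ r) ∧ (∃ k, (r * y) ^ p ^ k = 1) ∧
      IsConj (r * y) ((r * y) ^ (1 + p)) := by
    intro c
    by_cases hc : c ∈ (ConjClasses.mk '' {x : N | (∃ k, x ^ p ^ k = 1) ∧ IsConj x (x ^ (1 + p))})
    · obtain ⟨y, ⟨⟨k, hk⟩, hy⟩, rfl⟩ := hc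
      have h1 : (∃ k, (y : G) ^ p ^ k = 1) := ⟨k, congrArg Subtype.val hk⟩
      have h2 : IsConj (y : G) ((y : G) ^ (1 + p)) := by
        obtain ⟨c, hc⟩ := isConj_iff.1 hy
        exact isConj_iff.2 ⟨c, congrArg Subtype.val hc⟩
      obtain ⟨r, hr⟩ := exists_stable hp2 hR hab hexp hR1 h1 h2
      exact ⟨y, r, fun _ => ⟨rfl, h1, h2, hr⟩⟩
    · exact ⟨1, 1, fun h => absurd h hc⟩
  choose Y r hYr using hch
  have hb : (Set.univ : Set Bool).ncard = 2 := by rw [Set.ncard_univ]; simp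
  unfold Kc
  rw [mul_comm, ← hb, ← Set.ncard_prod]
  apply Set.ncard_le_ncard_of_injOn
    (fun x : ConjClasses N × Bool => ConjClasses.mk ((if x.2 then r x.1 else 1) * (Y x.1 : G))) _ _ (Set.toFinite _)
  · rintro ⟨c, b⟩ ⟨hc, -⟩
    obtain ⟨h1, h2, h3, h4, h5, h6, h7⟩ := hYr c hc
    cases b
    · exact ⟨_, by simpa using ⟨h2, isConj_iff.1 h3⟩, rfl⟩
    · exact ⟨_, by simpa using ⟨h6, isConj_iff.1 h7⟩, rfl⟩
  · rintro ⟨c, b⟩ ⟨hc, -⟩ ⟨c', b'⟩ ⟨hc', -⟩ he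
    obtain ⟨h1, h2, h3, h4, h5, h6, h7⟩ := hYr c hc
    obtain ⟨h1', h2', h3', h4', h5', h6', h7'⟩ := hYr c' hc'
    have he1 := ConjClasses.mk_eq_mk_iff_isConj.1 he
    have hif : ∀ (b : Bool) c, r c ∈ R → (if b then r c else 1) ∈ R := by
      intro b c h
      cases b
      · simpa using R.one_mem
      · simpa using h
    have hcc : c = c' := by
      obtain ⟨s, hs, n, hn, hnx, _⟩ := hconj _ (hif b c h4) _ (hif b' c' h4') _ (Y c).2 _ (Y c').2 he1
      rw [← h1, ← h1']
      exact ConjClasses.mk_eq_mk_iff_isConj.2 (isConj_iff.2 ⟨⟨n, hn⟩, Subtype.ext hnx⟩)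
    subst hcc
    have hno : ¬ IsConj (1 * (Y c : G)) (r c * (Y c : G)) := by
      intro h
      obtain ⟨s, hs, n, hn, hnx, h8⟩ := hconj _ R.one_mem _ h4 _ (Y c).2 _ (Y c).2 h
      apply h5 s hs
      have e : s * (n * (Y c : G) * n⁻¹) * s⁻¹ = r c * (Y c : G) := by rw [← h8]; group
      rw [hnx] at e
      rw [e, mul_inv_cancel_right]
    cases b <;> cases b'
    · rfl
    · exact absurd (by simpa using he1) hno
    · exact absurd (by simpa using he1.symm) hno
    · rfl

end dbl

section avg

theorem averaging {A H : Type} [CommGroup A] [Group H] [Finite H] (α : H →* MulAut A) (r : H → A)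
    (hr : ∀ h h', r (h * h') = r h * α h (r h')) (e : ℕ) (he : ∀ a : A, a ^ (Nat.card H * e) = a) :
    ∃ t : A, ∀ h, r h = t * (α h t)⁻¹ := by
  have := Fintype.ofFinite H
  refine ⟨(∏ h, r h) ^ e, fun h => ?_⟩
  have h1 : (∏ h, r h) = r h ^ Nat.card H * α h (∏ h, r h) := by
    conv_lhs => rw [← Equiv.prod_comp (Equiv.mulLeft h)]
    simp only [Equiv.coe_mulLeft, hr, Finset.prod_mul_distrib, map_prod, Finset.prod_const,
      Finset.card_univ, Nat.card_eq_fintype_card]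
  have h2 := congrArg (· ^ e) h1
  simp only [mul_pow, ← pow_mul, he] at h2
  rw [map_pow, eq_mul_inv_iff_mul_eq]
  exact h2.symm

end avg

section op

variable {G : Type} [Group G] [Finite G] {p : ℕ} [Fact p.Prime]

theorem frattini_compl {R H : Subgroup G} (hR : R.Normal) (hab : ∀ x ∈ R, ∀ y ∈ R, x * y = y * x)
    (hRH : R ⊓ H = ⊥) (hco : (Nat.card H).Coprime (Nat.card R)) (hn : (R ⊔ H).Normal) :
    R ⊔ Subgroup.normalizer (H : Set G) = ⊤ := by
  rw [eq_top_iff]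
  rintro g -
  have huni : ∀ a ∈ R, ∀ b ∈ R, ∀ h, g⁻¹ * (a * h) * g ∈ H → g⁻¹ * (b * h) * g ∈ H → a = b := by
    intro a ha b hb h h1 h2
    have h3 : g⁻¹ * (a * b⁻¹) * g ∈ R ⊓ H := by
      refine ⟨by simpa using hR.conj_mem _ (R.mul_mem ha (R.inv_mem hb)) g⁻¹, ?_⟩
      have := H.mul_mem h1 (H.inv_mem h2)
      have e : g⁻¹ * (a * b⁻¹) * g = g⁻¹ * (a * h) * g * (g⁻¹ * (b * h) * g)⁻¹ := by group
      rw [e]; exact this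
    rw [hRH, Subgroup.mem_bot] at h3
    have h4 : a * b⁻¹ = 1 := by
      have : a * b⁻¹ = g * (g⁻¹ * (a * b⁻¹) * g) * g⁻¹ := by group
      rw [this, h3]; group
    exact mul_inv_eq_one.1 h4
  have hex : ∀ h : H, ∃ a : R, g⁻¹ * ((a : G) * h) * g ∈ H := by
    intro h
    have h1 : g⁻¹ * (h : G) * g ∈ R ⊔ H := by
      simpa using hn.conj_mem _ (Subgroup.mem_sup_right h.2 : (h : G) ∈ R ⊔ H) g⁻¹
    obtain ⟨ρ, hρ, h', hh', e⟩ := Subgroup.mem_sup_of_normal_left.1 h1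
    refine ⟨⟨(g * ρ * g⁻¹)⁻¹, R.inv_mem (hR.conj_mem _ hρ g)⟩, ?_⟩
    have : g⁻¹ * ((g * ρ * g⁻¹)⁻¹ * (h : G)) * g = h' := by
      rw [eq_comm, ← inv_mul_eq_iff_eq_mul.2 e.symm]; group
    exact this.symm ▸ hh'
  choose r hr using hex
  letI : CommGroup R := { (inferInstance : Group R) with
    mul_comm := fun a b => Subtype.ext (hab _ a.2 _ b.2) }
  obtain ⟨e, he⟩ : ∃ e, ∀ a : R, a ^ (Nat.card H * e) = a := by
    by_cases h1 : Nat.card R = 1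
    · refine ⟨0, fun a => ?_⟩
      have := (Nat.card_eq_one_iff_unique.1 h1).1
      exact Subsingleton.elim _ _
    · have hlt : 1 < Nat.card R := by have := Nat.card_pos (α := R); omega
      obtain ⟨e, he⟩ := Nat.exists_mul_mod_eq_one_of_coprime hco hlt
      refine ⟨e, fun a => ?_⟩
      rw [← pow_mod_natCard, he.2, pow_one]
  obtain ⟨t, ht⟩ := averaging (A := R) (H := H) (MulAut.conjNormal.comp H.subtype) r (by
    intro h h'
    apply Subtype.ext
    apply huni _ (r (h * h')).2 _ (r h * _).2 ((h * h' : H) : G) (hr _)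
    have := H.mul_mem (hr h) (hr h')
    have e : g⁻¹ * (((r h * (MulAut.conjNormal.comp H.subtype) h (r h') : R) : G) * ((h * h' : H) : G)) * g
        = g⁻¹ * ((r h : G) * h) * g * (g⁻¹ * ((r h' : G) * h') * g) := by
      simp [MulAut.conjNormal_apply]
      group
    rw [e]; exact this) e he
  have ht' : ∀ h : H, (r h : G) = (t : G) * ((h : G) * (t : G) * (h : G)⁻¹)⁻¹ := by
    intro h
    have := congrArg Subtype.val (ht h)
    simpa [MulAut.conjNormal_apply] using this
  have h1 : g⁻¹ * (t : G) ∈ Subgroup.normalizer (H : Set G) := by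
    apply mem_normalizer_of_conj
    intro s hs
    have h2 := hr ⟨s, hs⟩
    rw [ht'] at h2
    have e : g⁻¹ * (t : G) * s * (g⁻¹ * (t : G))⁻¹ = g⁻¹ * ((t : G) * (s * (t : G) * s⁻¹)⁻¹ * s) * g := by group
    rw [e]; exact h2
  have : g = t * (g⁻¹ * (t : G))⁻¹ := by group
  rw [this]
  exact Subgroup.mul_mem_sup t.2 (inv_mem h1)

end op

section op2

variable {G : Type} [Group G] [Finite G] {p : ℕ} [Fact p.Prime]

theorem exists_min_normal (hOp : ∃ N : Subgroup G, N.Normal ∧ IsPGroup p N ∧ N ≠ ⊥) :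
    ∃ R : Subgroup G, R.Normal ∧ IsPGroup p R ∧ R ≠ ⊥ ∧ (∀ x ∈ R, ∀ y ∈ R, x * y = y * x) ∧
      (∀ x ∈ R, x ^ p = 1) ∧ ∀ N : Subgroup G, N.Normal → N ≤ R → N = ⊥ ∨ N = R := by
  obtain ⟨R, hR⟩ := (Set.toFinite {N : Subgroup G | N.Normal ∧ IsPGroup p N ∧ N ≠ ⊥}).exists_minimal hOp
  obtain ⟨hRn, hRp, hR1⟩ := hR.1
  have hmin : ∀ N : Subgroup G, N.Normal → N ≤ R → N = ⊥ ∨ N = R := by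
    intro N hN hle
    by_cases h : N = ⊥
    · exact Or.inl h
    · exact Or.inr (le_antisymm hle (hR.2 ⟨hN, hRp.to_le hle, h⟩ hle))
  have hab : ∀ x ∈ R, ∀ y ∈ R, x * y = y * x := by
    obtain ⟨x, hxS, hx1, hx⟩ := exists_central_mod (A := ⊥) (C := R) hRp (bot_lt_iff_ne_bot.2 hR1) le_rfl
      (by intro s _; apply mem_normalizer_of_conj; simp) Subgroup.le_normalizer
    have hN : (R ⊓ Subgroup.centralizer (R : Set G)).Normal := inferInstance
    rcases hmin _ hN inf_le_left with h | h
    · exfalso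
      apply hx1
      rw [← h]
      refine ⟨hxS, Subgroup.mem_centralizer_iff.2 fun s hs => ?_⟩
      have := hx s hs
      rwa [Subgroup.mem_bot, mul_inv_eq_one, mul_inv_eq_iff_eq_mul] at this
    · intro x hx y hy
      rw [← h] at hy
      exact Subgroup.mem_centralizer_iff.1 hy.2 x hx
  refine ⟨R, hRn, hRp, hR1, hab, ?_, hmin⟩
  let E : Subgroup G :=
    { carrier := {x | x ∈ R ∧ x ^ p = 1}
      one_mem' := ⟨R.one_mem, one_pow _⟩
      mul_mem' := by
        rintro a b ⟨ha, ha1⟩ ⟨hb, hb1⟩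
        refine ⟨R.mul_mem ha hb, ?_⟩
        rw [(show Commute a b from hab a ha b hb).mul_pow, ha1, hb1, one_mul]
      inv_mem' := by
        rintro a ⟨ha, ha1⟩
        exact ⟨R.inv_mem ha, by rw [inv_pow, ha1, inv_one]⟩ }
  have hE : E.Normal := ⟨by
    rintro x ⟨hx, hx1⟩ g
    exact ⟨hRn.conj_mem x hx g, by rw [conj_pow, hx1]; group⟩⟩
  rcases hmin E hE (fun x hx => hx.1) with h | h
  · exfalso
    have hd : p ∣ Nat.card R := by
      obtain ⟨n, hn⟩ := IsPGroup.iff_card.1 hRp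
      rw [hn]
      apply dvd_pow_self
      rintro rfl
      rw [pow_zero] at hn
      exact hR1 (Subgroup.card_eq_one.1 hn)
    obtain ⟨x, hx⟩ := exists_prime_orderOf_dvd_card' p hd
    have h1 : (x : G) ∈ E := ⟨x.2, by
      have := pow_orderOf_eq_one x
      rw [hx] at this
      exact_mod_cast congrArg Subtype.val this⟩
    rw [h, Subgroup.mem_bot] at h1
    have h2 : x = 1 := Subtype.ext h1
    rw [h2, orderOf_one] at hx
    exact (Fact.out (p := p.Prime)).one_lt.ne hx
  · intro x hx
    rw [← h] at hx
    exact hx.2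

theorem case_op (hp2 : p ≠ 2) (hodd : Odd (Nat.card G)) (hKD : Kc p G < 2 * Dl p G)
    (ih : ∀ (R : Subgroup G) [R.Normal], R ≠ ⊥ → Kc p (G ⧸ R) < 2 * Dl p (G ⧸ R) →
      HasNormalPComplement p (G ⧸ R))
    (hOp : ∃ N : Subgroup G, N.Normal ∧ IsPGroup p N ∧ N ≠ ⊥) : HasNormalPComplement p G := by
  have hp := Fact.out (p := p.Prime)
  have := Fintype.ofFinite G
  obtain ⟨R, hRn, hRp, hR1, hab, hexp, hmin⟩ := exists_min_normal hOp
  have := Fintype.ofFinite (G ⧸ R)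
  obtain ⟨M, hMn, hMc, n, hMi⟩ := ih R hR1
    (quot_KD hp2 hodd (QuotientGroup.mk' R) (QuotientGroup.mk'_surjective R) hKD)
  obtain ⟨r, hr⟩ := IsPGroup.iff_card.1 hRp
  set K := M.comap (QuotientGroup.mk' R) with hK
  have hKn : K.Normal := hMn.comap _
  have hRK : R ≤ K := by
    intro x hx
    rw [hK, Subgroup.mem_comap, QuotientGroup.mk'_apply, (QuotientGroup.eq_one_iff (N := R) x).2 hx]
    exact M.one_mem
  have hidx : (R.subgroupOf K).index = Nat.card M := by
    have h1 : R = (⊥ : Subgroup (G ⧸ R)).comap (QuotientGroup.mk' R) := by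
      rw [MonoidHom.comap_bot, QuotientGroup.ker_mk']
    have h2 : R.relIndex K = Nat.card M := by
      conv_lhs => rw [h1]
      rw [Subgroup.relIndex_comap, hK, Subgroup.map_comap_eq_self_of_surjective
        (QuotientGroup.mk'_surjective R), Subgroup.relIndex_bot_left]
    exact h2
  have hcR : Nat.card (R.subgroupOf K) = Nat.card R :=
    Nat.card_congr (Subgroup.subgroupOfEquivOfLe hRK).toEquiv
  have hMR : (Nat.card M).Coprime (Nat.card R) := by
    rw [hr]; exact hMc.pow_right r
  obtain ⟨H', hH'⟩ := Subgroup.exists_right_complement'_of_coprime (N := R.subgroupOf K)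
    (by rw [hidx, hcR]; exact hMR.symm)
  set H := H'.map K.subtype with hH
  have hHc : Nat.card H = Nat.card M := by
    rw [hH, Subgroup.card_map_of_injective K.subtype_injective, ← hidx]
    exact hH'.symm.index_eq_card.symm
  have hsupK : R ⊔ H = K := by
    have := congrArg (Subgroup.map K.subtype) hH'.sup_eq_top
    rwa [Subgroup.map_sup, Subgroup.map_subgroupOf_eq_of_le hRK, ← MonoidHom.range_eq_map,
      Subgroup.range_subtype] at this
  have hco : (Nat.card H).Coprime (Nat.card R) := hHc ▸ hMR
  have hRH : R ⊓ H = ⊥ := (Subgroup.disjoint_of_coprime_natCard hco.symm).eq_bot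
  have hfr := frattini_compl hRn hab hRH hco (hsupK.symm ▸ hKn)
  set N := Subgroup.normalizer (H : Set G) with hN
  have hCn : (R ⊓ N).Normal := ⟨by
    rintro x ⟨hx, hxN⟩ g
    obtain ⟨a, ha, m, hm, rfl⟩ := Subgroup.mem_sup_of_normal_left.1 (hfr ▸ Subgroup.mem_top g : g ∈ R ⊔ N)
    have h1 : m * x * m⁻¹ ∈ R := hRn.conj_mem x hx m
    have h2 : a * m * x * (a * m)⁻¹ = m * x * m⁻¹ := by
      have : a * m * x * (a * m)⁻¹ = a * (m * x * m⁻¹) * a⁻¹ := by group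
      rw [this, hab a ha _ h1, mul_inv_cancel_right]
    rw [h2]
    exact ⟨h1, N.mul_mem (N.mul_mem hm hxN) (N.inv_mem hm)⟩⟩
  rcases hmin _ hCn inf_le_left with hC | hC
  · exfalso
    have hncent : ¬ ∀ x ∈ R, ∀ g : G, g * x * g⁻¹ * x⁻¹ = 1 := by
      intro h
      apply hR1
      rw [← hC, eq_comm, inf_eq_left]
      intro x hx
      apply mem_normalizer_of_conj
      intro s hs
      have := h x hx s
      rw [mul_inv_eq_one, mul_inv_eq_iff_eq_mul] at this
      rwa [← this, mul_inv_cancel_right]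
    have htriv : ∀ l ∈ Lam p G, ∀ x ∈ R, l x = 1 := by
      intro l hl
      have hkn : (R ⊓ l.ker).Normal := inferInstance
      rcases hmin _ hkn inf_le_left with h | h
      · exfalso
        apply hncent
        intro x hx g
        rw [← Subgroup.mem_bot, ← h]
        refine ⟨R.mul_mem (hRn.conj_mem x hx g) (R.inv_mem hx), ?_⟩
        refine MonoidHom.mem_ker.2 ?_
        simp
      · intro x hx
        rw [← h] at hx
        exact hx.2
    have hD : Dl p G ≤ Dl p N := by
      have := Fintype.ofFinite N
      have := Lam_finite p N
      unfold Dl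
      apply Nat.card_le_card_of_injective (fun l : Lam p G => (⟨l.1.comp N.subtype, by
        rw [mem_Lam]; intro g; exact mem_Lam.1 l.2 _⟩ : Lam p N))
      intro l l' he
      have he' : ∀ x ∈ N, l.1 x = l'.1 x := by
        intro x hx
        exact DFunLike.congr_fun (congrArg Subtype.val he) (⟨x, hx⟩ : N)
      apply Subtype.ext
      ext g
      congr 1
      obtain ⟨a, ha, m, hm, rfl⟩ :=
        Subgroup.mem_sup_of_normal_left.1 (hfr ▸ Subgroup.mem_top g : g ∈ R ⊔ N)
      rw [map_mul, map_mul, htriv _ l.2 a ha, htriv _ l'.2 a ha, he' m hm]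
    have hNo : Odd (Nat.card N) := hodd.of_dvd_nat (Subgroup.card_subgroup_dvd_card N)
    have := Fintype.ofFinite N
    have h1 := Dl_le_Kc (G := N) (p := p) hp2 hNo
    have h2 := Kc_double (p := p) hp2 hRn hab hexp hR1 hC hfr
    omega
  · have hRN : R ≤ N := inf_eq_left.1 hC
    rw [sup_eq_right.2 hRN] at hfr
    have hHn : H.Normal := Subgroup.normalizer_eq_top_iff.1 hfr
    refine ⟨H, hHn, hHc ▸ hMc, n + r, ?_⟩
    have h1 := H.card_mul_index
    have h2 := M.card_mul_index
    have h3 := Subgroup.card_eq_card_quotient_mul_card_subgroup R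
    rw [h3, ← h2, hr, hMi, hHc, mul_assoc, ← pow_add] at h1
    exact Nat.eq_of_mul_eq_mul_left Nat.card_pos h1

end op2

theorem main_ind {p : ℕ} [Fact p.Prime] (hp2 : p ≠ 2) (n : ℕ) : ∀ (G : Type) [Group G] [Finite G],
    Nat.card G = n → Odd (Nat.card G) → Kc p G < 2 * Dl p G → HasNormalPComplement p G := by
  induction n using Nat.strong_induction_on with
  | _ n ih =>
    intro G _ _ hn hodd hKD
    by_cases hOp : ∃ N : Subgroup G, N.Normal ∧ IsPGroup p N ∧ N ≠ ⊥
    · apply case_op hp2 hodd hKD _ hOp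
      intro R _ hR1 hq
      refine ih (Nat.card (G ⧸ R)) ?_ (G ⧸ R) rfl (hodd.of_dvd_nat (Subgroup.card_quotient_dvd_card R)) hq
      have h3 := Subgroup.card_eq_card_quotient_mul_card_subgroup R
      have h4 : 1 < Nat.card R := Subgroup.one_lt_card_iff_ne_bot R |>.2 hR1
      rw [← hn, h3]
      exact lt_mul_of_one_lt_right Nat.card_pos h4
    · apply case_fusion hp2 hodd hKD
      · intro L hL hKL
        refine ih (Nat.card L) ?_ L rfl (hodd.of_dvd_nat (Subgroup.card_subgroup_dvd_card L)) hKL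
        rw [← hn]
        refine lt_of_le_of_ne (Subgroup.card_le_card_group L) ?_
        intro h
        exact hL.ne (Subgroup.eq_top_of_card_eq L h)
      · intro N hN hNp
        by_contra h
        exact hOp ⟨N, hN, hNp, h⟩

theorem odd_order_avg_cyclotomic_lt_two_implies_pNilpotent
    (G : Type) [Group G] [Fintype G] (hodd : Odd (Nat.card G))
    (p : ℕ) (hp : p.Prime) (hpodd : Odd p)
    (ζ : ℂ) (hζ : IsPrimitiveRoot ζ p)
    (h : acd {f ∈ Irr G | ∀ g, f g ∈ Subfield.closure {ζ}} < 2) :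
    HasNormalPComplement p G := by
  have := Fact.mk hp
  have hp2 : p ≠ 2 := by
    rintro rfl
    exact absurd hpodd (by decide)
  have h' : acd (Sp ζ G) < 2 := h
  exact main_ind hp2 _ G rfl hodd (acd_bridge hp2 hodd hζ h')
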